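/- Bouillot's reduction theorem: for positive integers k₁,…,k_d, the stuffle-regularized multitangent function satisfies Ψ_{k₁,…,k_d}(z) = δ^{k₁,…,k_d} + ∑_{j=1}^d ∑_{a+s+b=k_j, a,b≥0, s≥1} (-1)^{k₁+⋯+k_{j-1}+a} ζ_a^*(k_{j-1},…,k₁) ζ_b^*(k_{j+1},…,k_d) Ψ_s(z), where δ^{k₁,…,k_d} = (-1)^n π^{2n}/(2n)! if (k₁,…,k_d) = (1,…,1) of even length 2n (n ≥ 0), and 0 otherwise. -/

import Mathlib

open scoped BigOperators
open Real

/-- The multiple zeta value `ζ(k₁,…,k_d) = ∑_{0<m₁<⋯<m_d} ∏ 1/m_i^{k_i}`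
(as a `tsum` over strictly increasing tuples of positive integers). -/
noncomputable def MZV (k : List ℕ) : ℝ :=
  ∑' m : {f : Fin k.length → ℕ+ // StrictMono f}, ∏ i, 1 / ((m.1 i : ℕ) : ℝ) ^ k.get i

/-- The stuffle (quasi-shuffle) product of two words, as a multiset of words. -/
def stuffle : List ℕ → List ℕ → Multiset (List ℕ)
  | [], v => {v}
  | u, [] => {u}
  | a :: u, b :: v =>
      (stuffle u (b :: v)).map (a :: ·) + (stuffle (a :: u) v).map (b :: ·) +
        (stuffle u v).map ((a + b) :: ·)
  termination_by u v => u.length + v.length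

/-- All contractions of a word: the results of replacing each comma by `,` or `+`. -/
def contractions : List ℕ → Multiset (List ℕ)
  | [] => {[]}
  | [a] => {[a]}
  | a :: b :: t => (contractions (b :: t)).map (a :: ·) + contractions ((a + b) :: t)
  termination_by l => l.length

/-- `Z` is a stuffle (harmonic) regularization of multiple zeta values:
it takes the value `1` on the empty word, agrees with the convergent multiple zeta
values on admissible words, and is a homomorphism for the stuffle product. -/
structure IsStuffleReg (Z : List ℕ → ℝ) : Prop where
  empty : Z [] = 1
  conv : ∀ l : List ℕ, (∀ i ∈ l, 0 < i) → 2 ≤ l.getLastD 2 → Z l = MZV l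
  mul : ∀ u v : List ℕ, (∀ i ∈ u, 0 < i) → (∀ i ∈ v, 0 < i) →
    Z u * Z v = ((stuffle u v).map Z).sum

/-- The star version `ζ^{⋆,*}(k₁,…,k_d)`: the sum of `Z` over all contractions. -/
noncomputable def zetaStarOf (Z : List ℕ → ℝ) (l : List ℕ) : ℝ :=
  ((contractions l).map Z).sum

/-- `ζ_a^*(l₁,…,l_r) = (-1)^a ∑_{a₁+⋯+a_r=a} ζ^*(l₁+a₁,…,l_r+a_r) ∏ C(l_i-1+a_i,a_i)`. -/
noncomputable def zetaA (Z : List ℕ → ℝ) (a : ℕ) (l : List ℕ) : ℝ :=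
  (-1 : ℝ) ^ a *
    ∑ f ∈ (Fintype.piFinset fun _ : Fin l.length => Finset.range (a + 1)).filter
        (fun f => ∑ i, f i = a),
      Z (List.ofFn fun i => l.get i + f i) *
        ∏ i, (Nat.choose (l.get i - 1 + f i) (f i) : ℝ)

/-- `δ^{k₁,…,k_d}`: equal to `(-1)^n π^{2n}/(2n)!` if `(k₁,…,k_d) = (1,…,1)` has even
length `2n`, and `0` otherwise. -/
noncomputable def deltaVal (l : List ℕ) : ℝ :=
  if l.all (· = 1) ∧ l.length % 2 = 0 then
    (-1 : ℝ) ^ (l.length / 2) * π ^ l.length / (Nat.factorial l.length) else 0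

/-- The stuffle-regularized Hurwitz multiple zeta value
`ζ^{(z),*}(l₁,…,l_r) := ∑_{a≥0} z^a ζ_a^*(l₁,…,l_r)`. -/
noncomputable def HReg (Z : List ℕ → ℝ) (z : ℂ) (l : List ℕ) : ℂ :=
  ∑' a : ℕ, z ^ a * ((zetaA Z a l : ℝ) : ℂ)

/-- The stuffle-regularized multitangent function
`Ψ_{k₁,…,k_d}(z) := ∑_{0≤i≤j≤d, j-i≤1} (-1)^{k₁+⋯+k_i} ζ^{(-z),*}(k_i,…,k₁)
ζ^{(z),*}(k_{j+1},…,k_d) c_{i,j}(z)` with `c_{i,i} = 1`, `c_{i,i+1} = 1/z^{k_{i+1}}`. -/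
noncomputable def PsiReg (Z : List ℕ → ℝ) (k : List ℕ) (z : ℂ) : ℂ :=
  (∑ i ∈ Finset.range (k.length + 1),
      (-1 : ℂ) ^ (k.take i).sum * HReg Z (-z) ((k.take i).reverse) * HReg Z z (k.drop i)) +
    ∑ i ∈ Finset.range k.length,
      (-1 : ℂ) ^ (k.take i).sum * HReg Z (-z) ((k.take i).reverse) *
        HReg Z z (k.drop (i + 1)) * (1 / z ^ k.getD i 0)

namespace Multitangent

section Conv

variable {R S : Type*} [CommRing R] [CommRing S]

/-- Deconcatenation (convolution) product of functions on words. -/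
def conv : (List ℕ → R) → (List ℕ → R) → List ℕ → R
  | φ, ψ, [] => φ [] * ψ []
  | φ, ψ, k :: w => φ [] * ψ (k :: w) + conv (fun v => φ (k :: v)) ψ w

@[simp] lemma conv_nil (φ ψ : List ℕ → R) : conv φ ψ [] = φ [] * ψ [] := by
  simp [conv]

lemma conv_cons (φ ψ : List ℕ → R) (k : ℕ) (w : List ℕ) :
    conv φ ψ (k :: w) = φ [] * ψ (k :: w) + conv (fun v => φ (k :: v)) ψ w := by
  rw [conv]

lemma conv_eq_sum (φ ψ : List ℕ → R) (w : List ℕ) :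
    conv φ ψ w = ∑ i ∈ Finset.range (w.length + 1), φ (w.take i) * ψ (w.drop i) := by
  induction w generalizing φ with
  | nil => simp
  | cons k w ih => rw [conv_cons, ih, List.length_cons, Finset.sum_range_succ' _ (w.length + 1)]
                   simp [add_comm]

lemma conv_add_left (φ φ' ψ : List ℕ → R) (w : List ℕ) :
    conv (fun v => φ v + φ' v) ψ w = conv φ ψ w + conv φ' ψ w := by
  simp [conv_eq_sum, add_mul, Finset.sum_add_distrib]

lemma conv_sub_right (φ ψ ψ' : List ℕ → R) (w : List ℕ) :
    conv φ (fun v => ψ v - ψ' v) w = conv φ ψ w - conv φ ψ' w := by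
  simp [conv_eq_sum, mul_sub, Finset.sum_sub_distrib]

lemma conv_mul_left (c : R) (φ ψ : List ℕ → R) (w : List ℕ) :
    conv (fun v => c * φ v) ψ w = c * conv φ ψ w := by
  simp [conv_eq_sum, mul_assoc, Finset.mul_sum]

lemma conv_mul_right (c : R) (φ ψ : List ℕ → R) (w : List ℕ) :
    conv φ (fun v => c * ψ v) w = c * conv φ ψ w := by
  simp [conv_eq_sum, mul_left_comm, Finset.mul_sum]

lemma conv_assoc (φ ψ χ : List ℕ → R) (w : List ℕ) :
    conv (conv φ ψ) χ w = conv φ (conv ψ χ) w := by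
  induction w generalizing φ with
  | nil => simp [mul_assoc]
  | cons k w ih =>
    have : (fun v => conv φ ψ (k :: v))
        = fun v => φ [] * ψ (k :: v) + conv (fun u => φ (k :: u)) ψ v := by
      funext v; rw [conv_cons]
    rw [conv_cons, this, conv_add_left, conv_mul_left, ih, conv_cons φ, conv_cons ψ, conv_nil]
    ring

lemma conv_assoc' (φ ψ χ : List ℕ → R) : conv (conv φ ψ) χ = conv φ (conv ψ χ) :=
  funext (conv_assoc φ ψ χ)

lemma conv_congr {φ φ' ψ ψ' : List ℕ → R} {w : List ℕ}
    (h : ∀ u v, u ++ v = w → φ u = φ' u ∧ ψ v = ψ' v) : conv φ ψ w = conv φ' ψ' w := by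
  rw [conv_eq_sum, conv_eq_sum]
  refine Finset.sum_congr rfl fun i _ => ?_
  obtain ⟨h1, h2⟩ := h _ _ (List.take_append_drop i w)
  rw [h1, h2]

lemma map_conv (θ : R →+* S) (φ ψ : List ℕ → R) (w : List ℕ) :
    θ (conv φ ψ w) = conv (fun v => θ (φ v)) (fun v => θ (ψ v)) w := by
  simp [conv_eq_sum, map_sum]

lemma conv_reverse (φ ψ : List ℕ → R) (w : List ℕ) :
    conv φ ψ w.reverse = conv (fun v => ψ v.reverse) (fun v => φ v.reverse) w := by
  rw [conv_eq_sum, conv_eq_sum, ← Finset.sum_range_reflect, List.length_reverse]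
  refine Finset.sum_congr rfl fun i hi => ?_
  have hi' := Finset.mem_range.1 hi
  rw [List.take_reverse, List.drop_reverse, mul_comm]
  have : w.length - (w.length + 1 - 1 - i) = i := by omega
  rw [this]

/-- The counit: the indicator function of the empty word. -/
def eps : List ℕ → R
  | [] => 1
  | _ :: _ => 0

@[simp] lemma eps_nil : (eps [] : R) = 1 := rfl
@[simp] lemma eps_cons (k : ℕ) (w : List ℕ) : (eps (k :: w) : R) = 0 := rfl

lemma conv_eps (φ : List ℕ → R) (w : List ℕ) : conv φ eps w = φ w := by
  induction w generalizing φ with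
  | nil => simp
  | cons k w ih => simp [conv_cons, ih]

lemma eps_conv (φ : List ℕ → R) (w : List ℕ) : conv eps φ w = φ w := by
  cases w with
  | nil => simp
  | cons k w =>
    have h : (fun v => (eps (k :: v) : R)) = fun v => 0 * eps v := by simp
    rw [conv_cons, h, conv_mul_left]; simp

/-- The function supported on words of length at most one with value `x ^ k` at the letter `k`. -/
def letter (x : R) : List ℕ → R
  | [] => 1
  | [k] => x ^ k
  | _ :: _ :: _ => 0

@[simp] lemma letter_nil (x : R) : letter x [] = 1 := rfl
@[simp] lemma letter_singleton (x : R) (k : ℕ) : letter x [k] = x ^ k := rfl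
@[simp] lemma letter_cons_cons (x : R) (k l : ℕ) (w : List ℕ) : letter x (k :: l :: w) = 0 := rfl

lemma letter_cons (x : R) (k : ℕ) : (fun v => letter x (k :: v)) = fun v => x ^ k * eps v := by
  funext v
  cases v <;> simp

lemma letter_conv_cons (x : R) (φ : List ℕ → R) (k : ℕ) (w : List ℕ) :
    conv (letter x) φ (k :: w) = φ (k :: w) + x ^ k * φ w := by
  rw [conv_cons, letter_cons, conv_mul_left, eps_conv]; simp

/-- The sum of `∏ x_{i_j} ^ {k_j}` over `i_1 < ⋯ < i_d`, as a function of the word `k`. -/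
def ordSum : List R → List ℕ → R
  | [] => eps
  | x :: xs => conv (letter x) (ordSum xs)

@[simp] lemma ordSum_nil_left : (ordSum ([] : List R)) = eps := rfl
lemma ordSum_cons_left (x : R) (xs : List R) :
    ordSum (x :: xs) = conv (letter x) (ordSum xs) := rfl

@[simp] lemma ordSum_nil (xs : List R) : ordSum xs [] = 1 := by
  induction xs with
  | nil => rfl
  | cons x xs ih => simp [ordSum_cons_left, ih]

lemma ordSum_cons (x : R) (xs : List R) (k : ℕ) (w : List ℕ) :
    ordSum (x :: xs) (k :: w) = ordSum xs (k :: w) + x ^ k * ordSum xs w := by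
  rw [ordSum_cons_left, letter_conv_cons]

lemma ordSum_append (xs ys : List R) : ordSum (xs ++ ys) = conv (ordSum xs) (ordSum ys) := by
  induction xs with
  | nil => funext w; simp [eps_conv]
  | cons x xs ih => rw [List.cons_append, ordSum_cons_left, ih, ordSum_cons_left, conv_assoc']

lemma letter_reverse (x : R) (w : List ℕ) : letter x w.reverse = letter x w := by
  match w with
  | [] => rfl
  | [k] => rfl
  | k :: l :: w =>
    have : 2 ≤ (k :: l :: w).reverse.length := by simp
    match h : (k :: l :: w).reverse with
    | [] => simp [h] at this
    | [_] => simp [h] at this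
    | _ :: _ :: _ => rfl

lemma ordSum_singleton (x : R) : ordSum [x] = letter x := by
  funext w; rw [ordSum_cons_left, ordSum_nil_left, conv_eps]

lemma ordSum_reverse (xs : List R) (w : List ℕ) :
    ordSum xs.reverse w = ordSum xs w.reverse := by
  induction xs generalizing w with
  | nil => cases w with
    | nil => rfl
    | cons k w =>
      have : (k :: w).reverse ≠ [] := by simp
      cases h : (k :: w).reverse with
      | nil => exact absurd h this
      | cons _ _ => rfl
  | cons x xs ih =>
    rw [List.reverse_cons, ordSum_append, ordSum_singleton, ordSum_cons_left, conv_reverse]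
    exact conv_congr fun u v _ => ⟨ih u, (letter_reverse x v).symm⟩

lemma map_letter (θ : R →+* S) (x : R) (w : List ℕ) : θ (letter x w) = letter (θ x) w := by
  match w with
  | [] => simp
  | [k] => simp
  | k :: l :: w => simp

lemma map_ordSum (θ : R →+* S) (xs : List R) (w : List ℕ) :
    θ (ordSum xs w) = ordSum (xs.map θ) w := by
  induction xs generalizing w with
  | nil => cases w <;> simp
  | cons x xs ih =>
    rw [ordSum_cons_left, map_conv, List.map_cons, ordSum_cons_left]
    exact conv_congr fun u v _ => ⟨map_letter θ x u, ih v⟩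

lemma ordSum_neg (xs : List R) (w : List ℕ) :
    ordSum (xs.map fun x => -x) w = (-1) ^ w.sum * ordSum xs w := by
  induction xs generalizing w with
  | nil => cases w <;> simp
  | cons x xs ih =>
    cases w with
    | nil => simp
    | cons k w =>
      rw [List.map_cons, ordSum_cons, ordSum_cons, ih, ih, List.sum_cons, neg_pow, pow_add]
      ring

lemma conv_sign (φ ψ : List ℕ → R) (w : List ℕ) :
    conv (fun v => (-1) ^ v.sum * φ v) (fun v => (-1) ^ v.sum * ψ v) w
      = (-1) ^ w.sum * conv φ ψ w := by
  rw [conv_eq_sum, conv_eq_sum, Finset.mul_sum]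
  refine Finset.sum_congr rfl fun i _ => ?_
  have h : w.sum = (w.take i).sum + (w.drop i).sum := by
    rw [← List.sum_append, List.take_append_drop]
  rw [h, pow_add]; ring

lemma conv_letter_conv (φ ψ : List ℕ → R) (x : R) (w : List ℕ) :
    conv φ (conv (letter x) ψ) w = conv φ ψ w
      + ∑ j ∈ Finset.range w.length, φ (w.take j) * (x ^ w.getD j 0 * ψ (w.drop (j + 1))) := by
  induction w generalizing φ with
  | nil => simp
  | cons k w ih =>
    rw [conv_cons, ih, letter_conv_cons, conv_cons, List.length_cons, Finset.sum_range_succ']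
    simp
    ring

end Conv

section Stuffle

variable {R : Type*} [CommRing R]

/-- The words in the stuffle product of the word `[1]` with `w`. -/
def stuffleOne : List ℕ → List (List ℕ)
  | [] => [[1]]
  | k :: w => (1 :: k :: w) :: ((k + 1) :: w) :: (stuffleOne w).map (k :: ·)

/-- The sum of `φ` over the stuffle product of `[1]` and `w`. -/
def sumStuffleOne (φ : List ℕ → R) (w : List ℕ) : R := ((stuffleOne w).map φ).sum

@[simp] lemma sumStuffleOne_nil (φ : List ℕ → R) : sumStuffleOne φ [] = φ [1] := by
  simp [sumStuffleOne, stuffleOne]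

lemma sumStuffleOne_cons (φ : List ℕ → R) (k : ℕ) (w : List ℕ) :
    sumStuffleOne φ (k :: w)
      = φ (1 :: k :: w) + φ ((k + 1) :: w) + sumStuffleOne (fun v => φ (k :: v)) w := by
  simp [sumStuffleOne, stuffleOne, add_assoc, Function.comp_def]

lemma sumStuffleOne_add (φ ψ : List ℕ → R) (w : List ℕ) :
    sumStuffleOne (fun v => φ v + ψ v) w = sumStuffleOne φ w + sumStuffleOne ψ w := by
  simp [sumStuffleOne, List.sum_map_add]

lemma sumStuffleOne_sub (φ ψ : List ℕ → R) (w : List ℕ) :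
    sumStuffleOne (fun v => φ v - ψ v) w = sumStuffleOne φ w - sumStuffleOne ψ w := by
  induction w generalizing φ ψ with
  | nil => simp
  | cons k w ih => simp only [sumStuffleOne_cons, ih]; ring

lemma sumStuffleOne_mul (c : R) (φ : List ℕ → R) (w : List ℕ) :
    sumStuffleOne (fun v => c * φ v) w = c * sumStuffleOne φ w := by
  simp [sumStuffleOne, List.sum_map_mul_left]

/-- Stuffling with the primitive element `[1]` is a derivation for convolution. -/
lemma sumStuffleOne_conv (φ ψ : List ℕ → R) (w : List ℕ) :
    sumStuffleOne (conv φ ψ) w = conv (sumStuffleOne φ) ψ w + conv φ (sumStuffleOne ψ) w := by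
  induction w generalizing φ with
  | nil => simp [conv_cons]; ring
  | cons k w ih =>
    have h1 : (fun v => conv φ ψ (k :: v))
        = fun v => φ [] * ψ (k :: v) + conv (fun u => φ (k :: u)) ψ v := by
      funext v; rw [conv_cons]
    have h2 : (fun v => sumStuffleOne φ (k :: v))
        = fun v =>
          (φ (1 :: k :: v) + φ ((k + 1) :: v)) + sumStuffleOne (fun u => φ (k :: u)) v := by
      funext v; rw [sumStuffleOne_cons]
    rw [sumStuffleOne_cons, h1, sumStuffleOne_add, sumStuffleOne_mul, ih,
      conv_cons (sumStuffleOne φ),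
      h2, conv_add_left, conv_add_left, conv_cons φ (sumStuffleOne ψ), sumStuffleOne_cons ψ]
    simp only [conv_cons, sumStuffleOne_nil]
    ring

lemma sumStuffleOne_eps (w : List ℕ) : sumStuffleOne (eps : List ℕ → R) w = 0 := by
  cases w with
  | nil => simp
  | cons k w =>
    have h : (fun v => (eps (k :: v) : R)) = fun v => 0 * eps v := by simp
    rw [sumStuffleOne_cons, h, sumStuffleOne_mul]; simp

lemma sumStuffleOne_letter (x : R) (w : List ℕ) :
    sumStuffleOne (letter x) w = x * letter x w := by
  cases w with
  | nil => simp
  | cons k w =>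
    rw [sumStuffleOne_cons, letter_cons, sumStuffleOne_mul, sumStuffleOne_eps]
    cases w <;> simp [pow_succ']

lemma sumStuffleOne_ordSum (xs : List R) (w : List ℕ) :
    sumStuffleOne (ordSum xs) w = xs.sum * ordSum xs w := by
  induction xs generalizing w with
  | nil => simp [sumStuffleOne_eps]
  | cons x xs ih =>
    rw [ordSum_cons_left, sumStuffleOne_conv, funext (sumStuffleOne_letter x), funext ih,
      conv_mul_left, conv_mul_right, List.sum_cons]
    ring

lemma stuffle_nil_right (u : List ℕ) : stuffle u [] = {u} := by
  cases u <;> simp [stuffle]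

lemma stuffle_one_cons (k : ℕ) (w : List ℕ) :
    stuffle [1] (k :: w)
      = {1 :: k :: w} + (stuffle [1] w).map (k :: ·) + {(1 + k) :: w} := by
  rw [stuffle]; simp [stuffle]

lemma stuffle_one_append (w : List ℕ) (k : ℕ) :
    stuffle [1] (w ++ [k])
      = {w ++ [k, 1]} + (stuffle [1] w).map (· ++ [k]) + {w ++ [k + 1]} := by
  induction w with
  | nil => simp [stuffle_one_cons, stuffle_nil_right, add_comm]
  | cons l w ih =>
    rw [List.cons_append, stuffle_one_cons, ih, stuffle_one_cons]
    simp only [Multiset.map_add, Multiset.map_map, Multiset.map_singleton, Function.comp_def,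
      List.cons_append]
    abel

lemma stuffle_one_reverse (w : List ℕ) :
    stuffle [1] w.reverse = ((stuffleOne w).map List.reverse : List (List ℕ)) := by
  induction w with
  | nil => simp [stuffle_nil_right, stuffleOne]
  | cons k w ih =>
    rw [List.reverse_cons, stuffle_one_append, ih]
    simp [stuffleOne, Function.comp_def]
    rw [← Multiset.coe_singleton, Multiset.coe_add, Multiset.coe_eq_coe]
    exact (List.perm_append_singleton _ _).cons _

end Stuffle

section Expo

/-- The function `1^n ↦ x ^ n / n!`, vanishing on words with a letter different from `1`. -/
noncomputable def expo (x : ℂ) (w : List ℕ) : ℂ :=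
  if ∀ i ∈ w, i = 1 then x ^ w.length / (w.length.factorial : ℂ) else 0

@[simp] lemma expo_nil (x : ℂ) : expo x [] = 1 := by simp [expo]

lemma expo_of_not {x : ℂ} {w : List ℕ} (h : ¬ ∀ i ∈ w, i = 1) : expo x w = 0 := if_neg h

lemma expo_of_ones {x : ℂ} {w : List ℕ} (h : ∀ i ∈ w, i = 1) :
    expo x w = x ^ w.length / (w.length.factorial : ℂ) := if_pos h

lemma expo_zero (w : List ℕ) : expo 0 w = eps w := by
  cases w <;> simp [expo]

lemma expo_reverse (x : ℂ) (w : List ℕ) : expo x w.reverse = expo x w := by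
  simp [expo]

lemma sum_eq_length_of_ones {w : List ℕ} (h : ∀ i ∈ w, i = 1) : w.sum = w.length := by
  rw [List.eq_replicate_of_mem h]; simp

lemma sign_mul_expo (x : ℂ) (w : List ℕ) : (-1) ^ w.sum * expo x w = expo (-x) w := by
  by_cases h : ∀ i ∈ w, i = 1
  · rw [expo_of_ones h, expo_of_ones h, sum_eq_length_of_ones h, neg_pow x]; ring
  · rw [expo_of_not h, expo_of_not h, mul_zero]

lemma conv_expo_expo (x y : ℂ) (w : List ℕ) : conv (expo x) (expo y) w = expo (x + y) w := by
  rw [conv_eq_sum]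
  by_cases h : ∀ i ∈ w, i = 1
  · rw [expo_of_ones h, add_pow, Finset.sum_div]
    refine Finset.sum_congr rfl fun i hi => ?_
    have hi' : i ≤ w.length := Nat.lt_succ_iff.1 (Finset.mem_range.1 hi)
    rw [expo_of_ones fun a ha => h a (List.mem_of_mem_take ha),
      expo_of_ones fun a ha => h a (List.mem_of_mem_drop ha), List.length_take, List.length_drop,
      min_eq_left hi', Nat.cast_choose ℂ hi']
    have := Nat.cast_ne_zero (R := ℂ).2 (Nat.factorial_ne_zero w.length)
    field_simp
  · rw [expo_of_not h]
    refine Finset.sum_eq_zero fun i _ => ?_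
    by_cases h1 : ∀ a ∈ w.take i, a = 1
    · rw [expo_of_not (w := w.drop i), mul_zero]
      intro h2
      refine h fun a ha => ?_
      rw [← List.take_append_drop i w, List.mem_append] at ha
      exact ha.elim (h1 a) (h2 a)
    · rw [expo_of_not h1, zero_mul]

lemma norm_expo_le (x : ℂ) (w : List ℕ) : ‖expo x w‖ ≤ (1 + ‖x‖) ^ w.length := by
  by_cases h : ∀ i ∈ w, i = 1
  · rw [expo_of_ones h, norm_div, norm_pow]
    have h1 : (1 : ℝ) ≤ ‖(w.length.factorial : ℂ)‖ := by
      rw [Complex.norm_natCast]; exact_mod_cast Nat.one_le_iff_ne_zero.2 (Nat.factorial_ne_zero _)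
    refine (div_le_self (by positivity) h1).trans ?_
    gcongr
    linarith
  · rw [expo_of_not h, norm_zero]; positivity

lemma norm_expo_cons_le (x : ℂ) (k : ℕ) (w : List ℕ) :
    ‖expo x (k :: w)‖ ≤ ‖x‖ * (1 + ‖x‖) ^ w.length := by
  by_cases h : ∀ i ∈ k :: w, i = 1
  · rw [expo_of_ones h, norm_div, norm_pow]
    have h1 : (1 : ℝ) ≤ ‖((k :: w).length.factorial : ℂ)‖ := by
      rw [Complex.norm_natCast]; exact_mod_cast Nat.one_le_iff_ne_zero.2 (Nat.factorial_ne_zero _)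
    refine (div_le_self (by positivity) h1).trans ?_
    rw [List.length_cons, pow_succ']
    gcongr
    linarith
  · rw [expo_of_not h, norm_zero]; positivity

lemma pos_of_append {u v w : List ℕ} (h : u ++ v = w) (hw : ∀ i ∈ w, 0 < i) :
    (∀ i ∈ u, 0 < i) ∧ ∀ i ∈ v, 0 < i :=
  ⟨fun i hi => hw i (h ▸ List.mem_append_left v hi),
    fun i hi => hw i (h ▸ List.mem_append_right u hi)⟩

lemma length_stuffleOne (w : List ℕ) : (stuffleOne w).length = 2 * w.length + 1 := by
  induction w with
  | nil => rfl
  | cons k w ih => simp [stuffleOne, ih]; ring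

lemma mem_stuffleOne {w r : List ℕ} (hw : ∀ i ∈ w, 0 < i) (hr : r ∈ stuffleOne w) :
    (∀ i ∈ r, 0 < i) ∧ r.length ≤ w.length + 1 := by
  induction w generalizing r with
  | nil => simp [stuffleOne] at hr; subst hr; simp
  | cons k w ih =>
    simp only [List.mem_cons, forall_eq_or_imp] at hw
    simp only [stuffleOne, List.mem_cons, List.mem_map] at hr
    rcases hr with rfl | rfl | ⟨v, hv, rfl⟩
    · simpa using hw
    · simpa using hw.2
    · obtain ⟨h1, h2⟩ := ih hw.2 hv
      simpa [hw.1] using ⟨h1, h2⟩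

lemma not_ones_of_mem_stuffleOne {w r : List ℕ} (hw : ∀ i ∈ w, 0 < i) (h1 : ¬ ∀ i ∈ w, i = 1)
    (hr : r ∈ stuffleOne w) : ¬ ∀ i ∈ r, i = 1 := by
  induction w generalizing r with
  | nil => simp at h1
  | cons k w ih =>
    simp only [List.mem_cons, forall_eq_or_imp] at hw h1
    simp only [stuffleOne, List.mem_cons, List.mem_map] at hr
    rcases hr with rfl | rfl | ⟨v, hv, rfl⟩
    · simpa using h1
    · have := hw.1
      simp; omega
    · simp only [List.mem_cons, forall_eq_or_imp]
      rintro ⟨rfl, h3⟩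
      exact ih hw.2 (by tauto) hv h3

lemma sumStuffleOne_replicate {φ : List ℕ → ℂ} (hφ : ∀ w, (¬ ∀ i ∈ w, i = 1) → φ w = 0) (n : ℕ) :
    sumStuffleOne φ (List.replicate n 1) = (n + 1) * φ (List.replicate (n + 1) 1) := by
  induction n generalizing φ with
  | zero => simp
  | succ n ih =>
    rw [List.replicate_succ, sumStuffleOne_cons, ih, hφ ((1 + 1) :: _) (by simp)]
    · simp only [List.replicate_succ]; push_cast; ring
    · intro w hw; exact hφ _ (by simpa using hw)

lemma sumStuffleOne_expo (x : ℂ) {w : List ℕ} (hw : ∀ i ∈ w, 0 < i) :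
    sumStuffleOne (expo x) w = x * expo x w := by
  by_cases h : ∀ i ∈ w, i = 1
  · rw [List.eq_replicate_of_mem h, sumStuffleOne_replicate fun w => expo_of_not,
      expo_of_ones (by simp), expo_of_ones (by simp)]
    simp only [List.length_replicate, Nat.factorial_succ]
    have := Nat.cast_ne_zero (R := ℂ).2 (Nat.factorial_ne_zero w.length)
    have : (w.length + 1 : ℂ) ≠ 0 := Nat.cast_add_one_ne_zero _
    push_cast
    field_simp
    exact pow_succ' _ _
  · rw [expo_of_not h, mul_zero, sumStuffleOne]
    refine List.sum_eq_zero fun a ha => ?_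
    obtain ⟨r, hr, rfl⟩ := List.mem_map.1 ha
    exact expo_of_not (not_ones_of_mem_stuffleOne hw h hr)

lemma sumStuffleOne_expo_conv {x c : ℂ} {φ : List ℕ → ℂ}
    (hφ : ∀ w, (∀ i ∈ w, 0 < i) → sumStuffleOne φ w = c * φ w) {w : List ℕ} (hw : ∀ i ∈ w, 0 < i) :
    sumStuffleOne (conv (expo x) φ) w = (x + c) * conv (expo x) φ w := by
  rw [sumStuffleOne_conv, add_mul, ← conv_mul_left, ← conv_mul_right]
  congr 1
  · exact conv_congr fun u v h => ⟨sumStuffleOne_expo x (pos_of_append h hw).1, rfl⟩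
  · exact conv_congr fun u v h => ⟨rfl, hφ v (pos_of_append h hw).2⟩

/-- The number of leading letters `1` of a word. -/
def lead : List ℕ → ℕ
  | [] => 0
  | k :: w => if k = 1 then lead w + 1 else 0

lemma lead_le_length (w : List ℕ) : lead w ≤ w.length := by
  induction w with
  | nil => simp [lead]
  | cons k w ih => rw [lead]; split_ifs <;> simp [ih]

lemma exists_sumStuffleOne_eq {w : List ℕ} (hw : ∀ i ∈ w, 0 < i) :
    ∃ L : List (List ℕ), (∀ φ : List ℕ → ℂ,
        sumStuffleOne φ w = (lead w + 1) * φ (1 :: w) + (L.map φ).sum) ∧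
      L.length ≤ 2 * w.length ∧
      ∀ r ∈ L, (∀ i ∈ r, 0 < i) ∧ r.length ≤ w.length + 1 ∧ lead r ≤ lead w := by
  induction w with
  | nil => exact ⟨[], by simp [lead]⟩
  | cons k w ih =>
    have hk : 0 < k := hw k (by simp)
    have hw' : ∀ i ∈ w, 0 < i := fun i hi => hw i (by simp [hi])
    by_cases h1 : k = 1
    · subst h1
      obtain ⟨L, h2, h3, h4⟩ := ih hw'
      refine ⟨(2 :: w) :: L.map (1 :: ·), fun φ => ?_, by simp; omega, ?_⟩
      · rw [sumStuffleOne_cons, h2]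
        simp [lead, Function.comp_def]
        ring
      · intro r hr
        simp only [List.mem_cons, List.mem_map] at hr
        rcases hr with rfl | ⟨v, hv, rfl⟩
        · simp [lead]; exact hw'
        · obtain ⟨a, b, c⟩ := h4 v hv
          simp [lead, b, c]; exact a
    · refine ⟨((k + 1) :: w) :: (stuffleOne w).map (k :: ·), fun φ => ?_, ?_, ?_⟩
      · rw [sumStuffleOne_cons, sumStuffleOne]
        simp [lead, h1, Function.comp_def]
        ring
      · simp [length_stuffleOne]; omega
      · intro r hr
        simp only [List.mem_cons, List.mem_map] at hr
        rcases hr with rfl | ⟨v, hv, rfl⟩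
        · simp [lead, h1, hk.ne']; exact hw'
        · obtain ⟨a, b⟩ := mem_stuffleOne hw' hv
          simp [lead, h1, b, hk]; exact a

lemma exists_bound_of_sumStuffleOne (T : ℂ) (d : ℕ) :
    ∃ K : ℝ, 1 ≤ K ∧ ∀ (D : List ℕ → ℂ) (ε : ℝ), 0 ≤ ε →
      (∀ w, (∀ i ∈ w, 0 < i) → sumStuffleOne D w = T * D w) →
      (∀ w, (∀ i ∈ w, 0 < i) → w.length ≤ d → lead w = 0 → ‖D w‖ ≤ ε) →
      ∀ w, (∀ i ∈ w, 0 < i) → w.length ≤ d → ‖D w‖ ≤ K * ε := by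
  have key : ∀ n : ℕ, ∃ K : ℝ, 1 ≤ K ∧ ∀ (D : List ℕ → ℂ) (ε : ℝ), 0 ≤ ε →
      (∀ w, (∀ i ∈ w, 0 < i) → sumStuffleOne D w = T * D w) →
      (∀ w, (∀ i ∈ w, 0 < i) → w.length ≤ d → lead w = 0 → ‖D w‖ ≤ ε) →
      ∀ w, (∀ i ∈ w, 0 < i) → w.length ≤ d → lead w ≤ n → ‖D w‖ ≤ K * ε := by
    intro n
    induction n with
    | zero =>
      refine ⟨1, le_rfl, fun D ε _ _ h w h1 h2 h3 => ?_⟩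
      rw [one_mul]; exact h w h1 h2 (Nat.le_zero.1 h3)
    | succ n ih =>
      obtain ⟨K, hK, ih⟩ := ih
      refine ⟨(‖T‖ + 2 * d + 1) * K, ?_, fun D ε hε hD h w h1 h2 h3 => ?_⟩
      · have : 1 ≤ ‖T‖ + 2 * d + 1 := by linarith [norm_nonneg T, (Nat.cast_nonneg d : (0:ℝ) ≤ d)]
        nlinarith
      have ih' := ih D ε hε hD h
      have hKε : 0 ≤ K * ε := by positivity
      rcases Nat.lt_or_ge n (lead w) with h4 | h4
      · cases w with
        | nil => simp [lead] at h4
        | cons k w =>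
          have hk1 : k = 1 := by by_contra hk; simp [lead, hk] at h4
          subst hk1
          have hw : ∀ i ∈ w, 0 < i := fun i hi => h1 i (by simp [hi])
          have hl : lead w = n := by simp [lead] at h3 h4; omega
          rw [List.length_cons] at h2
          obtain ⟨L, e1, e2, e3⟩ := exists_sumStuffleOne_eq hw
          have e4 : (lead w + 1) * D (1 :: w) = T * D w - (L.map D).sum := by
            rw [← hD w hw, e1]; ring
          have e5 : ‖D (1 :: w)‖ ≤ ‖((lead w : ℂ) + 1) * D (1 :: w)‖ := by
            rw [norm_mul]
            refine le_mul_of_one_le_left (norm_nonneg _) ?_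
            have : ((lead w : ℂ) + 1) = ((lead w + 1 : ℕ) : ℂ) := by push_cast; ring
            rw [this, Complex.norm_natCast]
            exact_mod_cast Nat.le_add_left 1 _
          have e6 : ‖(L.map D).sum‖ ≤ 2 * d * (K * ε) := by
            have : ‖(L.map D).sum‖ ≤ ((L.map D).map norm).sum  :=
              List.le_sum_of_subadditive norm norm_zero.le norm_add_le _
            refine this.trans ?_
            have := List.sum_le_card_nsmul ((L.map D).map norm) (K * ε) ?_
            · refine this.trans ?_
              rw [nsmul_eq_mul]
              gcongr
              simp only [List.length_map]
              have : L.length ≤ 2 * d := by omega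
              exact_mod_cast this
            · intro x hx
              simp only [List.map_map, List.mem_map, Function.comp] at hx
              obtain ⟨r, hr, rfl⟩ := hx
              obtain ⟨a, b, c⟩ := e3 r hr
              exact ih' r a (by omega) (by omega)
          have e7 : ‖T * D w‖ ≤ ‖T‖ * (K * ε) := by
            rw [norm_mul]; gcongr; exact ih' w hw (by omega) (by omega)
          calc _ ≤ _ := e5
            _ ≤ ‖T * D w‖ + ‖(L.map D).sum‖ := by rw [e4]; exact norm_sub_le _ _
            _ ≤ ‖T‖ * (K * ε) + 2 * d * (K * ε) := add_le_add e7 e6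
            _ ≤ _ := by nlinarith
      · refine (ih' w h1 h2 h4).trans ?_
        have : 0 ≤ ‖T‖ + 2 * d := by positivity
        nlinarith
  obtain ⟨K, hK, h⟩ := key d
  exact ⟨K, hK, fun D ε hε hD h' w h1 h2 => h D ε hε hD h' w h1 h2 ((lead_le_length w).trans h2)⟩

end Expo

section HarmonicSums

/-- The list `[M, M - 1, …, 1]`. -/
def desc : ℕ → List ℕ
  | 0 => []
  | n + 1 => (n + 1) :: desc n

/-- The truncated multiple harmonic sum
`∑_{M ≥ n₁ > ⋯ > n_d > 0} ∏ n_i^{-k_i}`. -/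
noncomputable def hsum (M : ℕ) (w : List ℕ) : ℂ :=
  ordSum ((desc M).map fun n : ℕ => (n : ℂ)⁻¹) w

@[simp] lemma hsum_nil (M : ℕ) : hsum M [] = 1 := ordSum_nil _

lemma hsum_zero_cons (k : ℕ) (w : List ℕ) : hsum 0 (k :: w) = 0 := by
  simp [hsum, desc, ordSum_nil_left]

lemma hsum_succ_cons (M k : ℕ) (w : List ℕ) :
    hsum (M + 1) (k :: w) = hsum M (k :: w) + (((M + 1 : ℕ) : ℂ))⁻¹ ^ k * hsum M w := by
  simp only [hsum, desc, List.map_cons, ordSum_cons]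

/-- The harmonic numbers. -/
noncomputable def harm (M : ℕ) : ℝ := (harmonic M : ℝ)

lemma harm_zero : harm 0 = 0 := by simp [harm]

lemma harm_succ (M : ℕ) : harm (M + 1) = harm M + ((M : ℝ) + 1)⁻¹ := by
  simp [harm, harmonic_succ]

lemma harm_nonneg (M : ℕ) : 0 ≤ harm M := by
  induction M with
  | zero => simp [harm_zero]
  | succ n ih => rw [harm_succ]; positivity

lemma harm_mono : Monotone harm := monotone_nat_of_le_succ fun n => by
  rw [harm_succ]; linarith [show (0:ℝ) ≤ ((n:ℝ)+1)⁻¹ by positivity]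

lemma sum_desc (M : ℕ) : ((desc M).map fun n : ℕ => (n : ℂ)⁻¹).sum = (harm M : ℂ) := by
  induction M with
  | zero => simp [desc, harm_zero]
  | succ n ih => simp [desc, ih, harm_succ]; ring

lemma sumStuffleOne_hsum (M : ℕ) (w : List ℕ) :
    sumStuffleOne (hsum M) w = (harm M : ℂ) * hsum M w := by
  have := sumStuffleOne_ordSum ((desc M).map fun n : ℕ => (n : ℂ)⁻¹) w
  rw [sum_desc] at this
  exact this

lemma norm_inv_succ_pow_le (M : ℕ) {k : ℕ} {j : ℕ} (hk : j ≤ k) :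
    ‖((((M + 1 : ℕ) : ℂ))⁻¹ ^ k)‖ ≤ (((M : ℝ) + 1)⁻¹) ^ j := by
  rw [norm_pow, norm_inv, Complex.norm_natCast, Nat.cast_add_one]
  refine pow_le_pow_of_le_one (by positivity) (inv_le_one_of_one_le₀ ?_) hk
  linarith [(Nat.cast_nonneg M : (0:ℝ) ≤ M)]

lemma norm_hsum_le (M : ℕ) {w : List ℕ} (hw : ∀ i ∈ w, 0 < i) :
    ‖hsum M w‖ ≤ harm M ^ w.length := by
  induction M generalizing w with
  | zero => cases w <;> simp [hsum_zero_cons, harm_zero]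
  | succ M ih =>
    cases w with
    | nil => simp
    | cons k w =>
      rw [hsum_succ_cons]
      have hw' : ∀ i ∈ w, 0 < i := fun i hi => hw i (by simp [hi])
      have h1 := ih hw
      have h2 := ih hw'
      have h3 := norm_inv_succ_pow_le M (hw k (by simp) : 1 ≤ k)
      have h4 := harm_nonneg M
      have h5 : (0:ℝ) ≤ ((M:ℝ)+1)⁻¹ := by positivity
      rw [pow_one] at h3
      calc _ ≤ harm M ^ (w.length + 1) + ((M : ℝ) + 1)⁻¹ * harm M ^ w.length := by
            refine (norm_add_le _ _).trans (add_le_add h1 ?_)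
            rw [norm_mul]; gcongr
        _ = (harm M + ((M : ℝ) + 1)⁻¹) * harm M ^ w.length := by ring
        _ ≤ (harm M + ((M : ℝ) + 1)⁻¹) * (harm M + ((M : ℝ) + 1)⁻¹) ^ w.length := by
            gcongr; linarith
        _ = _ := by rw [harm_succ, List.length_cons, pow_succ']

lemma exists_harm_pow_le (d : ℕ) :
    ∃ C : ℝ, 0 ≤ C ∧ ∀ M : ℕ, (2 + harm M) ^ d ≤ C * ((M : ℝ) + 1) ^ (1 / 4 : ℝ) := by
  set ε : ℝ := 1 / (4 * (d + 1)) with hε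
  have hε0 : 0 < ε := by positivity
  refine ⟨(3 + 1 / ε) ^ d, by positivity, fun M => ?_⟩
  have hM : (0:ℝ) ≤ (M:ℝ) + 1 := by positivity
  have hM1 : (1:ℝ) ≤ (M:ℝ) + 1 := by linarith [(Nat.cast_nonneg M : (0:ℝ) ≤ M)]
  have h1 : 2 + harm M ≤ (3 + 1 / ε) * ((M : ℝ) + 1) ^ ε := by
    have a1 : harm M ≤ 1 + Real.log M := harmonic_le_one_add_log M
    have a2 : Real.log M ≤ Real.log ((M:ℝ) + 1) := by
      rcases Nat.eq_zero_or_pos M with rfl | h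
      · simp
      · exact Real.log_le_log (by exact_mod_cast h) (by linarith)
    have a3 : Real.log ((M:ℝ)+1) ≤ ((M:ℝ)+1) ^ ε / ε := Real.log_le_rpow_div hM hε0
    have a4 : 1 ≤ ((M:ℝ)+1) ^ ε := Real.one_le_rpow hM1 hε0.le
    have : (3 + 1 / ε) * ((M : ℝ) + 1) ^ ε =
        3 * ((M : ℝ) + 1) ^ ε + ((M : ℝ) + 1) ^ ε / ε := by ring
    rw [this]; linarith
  calc (2 + harm M) ^ d ≤ ((3 + 1 / ε) * ((M : ℝ) + 1) ^ ε) ^ d := by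
        gcongr; linarith [harm_nonneg M]
    _ = (3 + 1 / ε) ^ d * ((M : ℝ) + 1) ^ (ε * d) := by
        rw [mul_pow, ← Real.rpow_mul_natCast hM]
    _ ≤ _ := by
        refine mul_le_mul_of_nonneg_left (Real.rpow_le_rpow_of_exponent_le hM1 ?_) (by positivity)
        · rw [hε, div_mul_eq_mul_div, div_le_div_iff₀ (by positivity) (by norm_num)]
          linarith

/-- The strictly increasing tuples of positive integers at most `M`. -/
def incr (M n : ℕ) : Finset (Fin n → ℕ) :=
  (Fintype.piFinset fun _ => Finset.range (M + 1)).filter fun f => StrictMono f ∧ ∀ i, 0 < f i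

lemma mem_incr {M n : ℕ} {f : Fin n → ℕ} :
    f ∈ incr M n ↔ (∀ i, f i ≤ M) ∧ StrictMono f ∧ ∀ i, 0 < f i := by
  simp [incr]

lemma strictMono_snoc_iff {n : ℕ} {f : Fin n → ℕ} {M : ℕ} :
    StrictMono (Fin.snoc (α := fun _ => ℕ) f M : Fin (n + 1) → ℕ) ↔
      StrictMono f ∧ ∀ i, f i < M := by
  constructor
  · intro h
    refine ⟨fun i j hij => ?_, fun i => ?_⟩
    · have := h (Fin.castSucc_lt_castSucc_iff.2 hij)
      simpa using this
    · have := h (Fin.castSucc_lt_last i)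
      simpa using this
  · rintro ⟨h1, h2⟩ i j hij
    induction j using Fin.lastCases with
    | last =>
      induction i using Fin.lastCases with
      | last => simp at hij
      | cast i => simpa using h2 i
    | cast j =>
      induction i using Fin.lastCases with
      | last => exact absurd (hij.trans (Fin.castSucc_lt_last j)) (lt_irrefl _)
      | cast i => simpa using h1 (Fin.castSucc_lt_castSucc_iff.1 hij)

lemma forall_snoc_iff {n : ℕ} {f : Fin n → ℕ} {M : ℕ} {p : ℕ → Prop} :
    (∀ i, p ((Fin.snoc (α := fun _ => ℕ) f M : Fin (n + 1) → ℕ) i)) ↔ (∀ i, p (f i)) ∧ p M := by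
  constructor
  · intro h
    exact ⟨fun i => by simpa using h i.castSucc, by simpa using h (Fin.last n)⟩
  · rintro ⟨h1, h2⟩ i
    induction i using Fin.lastCases with
    | last => simpa using h2
    | cast i => simpa using h1 i

lemma incr_succ (M n : ℕ) :
    incr (M + 1) (n + 1) = incr M (n + 1) ∪
      (incr M n).image fun f => (Fin.snoc (α := fun _ => ℕ) f (M + 1) : Fin (n + 1) → ℕ) := by
  ext f
  obtain ⟨g, x, rfl⟩ : ∃ (g : Fin n → ℕ) (x : ℕ), f = Fin.snoc (α := fun _ => ℕ) g x :=
    ⟨Fin.init f, f (Fin.last n), (Fin.snoc_init_self f).symm⟩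
  have hinj : ∀ g' : Fin n → ℕ, (Fin.snoc (α := fun _ => ℕ) g' (M + 1) : Fin (n + 1) → ℕ) =
      Fin.snoc (α := fun _ => ℕ) g x ↔ g' = g ∧ M + 1 = x := fun g' => Fin.snoc_inj
  simp only [Finset.mem_union, Finset.mem_image, mem_incr, hinj, strictMono_snoc_iff,
    forall_snoc_iff (p := fun i => 0 < i), forall_snoc_iff (p := fun i => i ≤ M),
    forall_snoc_iff (p := fun i => i ≤ M + 1)]
  constructor
  · rintro ⟨⟨h1, h2⟩, ⟨h3, h4⟩, h5, h6⟩
    rcases Nat.lt_or_ge M x with h | h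
    · obtain rfl : x = M + 1 := by omega
      exact Or.inr ⟨g, ⟨fun i => Nat.lt_succ_iff.1 (h4 i), h3, h5⟩, rfl, rfl⟩
    · exact Or.inl ⟨⟨fun i => ((h4 i).trans_le h).le, h⟩, ⟨h3, h4⟩, h5, h6⟩
  · rintro (⟨⟨h1, h2⟩, ⟨h3, h4⟩, h5, h6⟩ | ⟨g', ⟨h1, h2, h3⟩, rfl, rfl⟩)
    · exact ⟨⟨fun i => (h1 i).trans M.le_succ, h2.trans M.le_succ⟩, ⟨h3, h4⟩, h5, h6⟩
    · exact ⟨⟨fun i => (h1 i).trans M.le_succ, le_rfl⟩, ⟨h2, fun i => Nat.lt_succ_iff.2 (h1 i)⟩,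
        h3, Nat.succ_pos _⟩

lemma hsum_eq_sum_incr (M n : ℕ) (κ : Fin n → ℕ) :
    hsum M (List.ofFn κ).reverse =
      ((∑ f ∈ incr M n, ∏ i, 1 / (f i : ℝ) ^ κ i : ℝ) : ℂ) := by
  induction M generalizing n with
  | zero =>
    cases n with
    | zero =>
      have : incr 0 0 = Finset.univ := Finset.eq_univ_of_forall fun f =>
        mem_incr.2 ⟨fun i => i.elim0, Subsingleton.strictMono f, fun i => i.elim0⟩
      simp [this]
    | succ n =>
      have : incr 0 (n + 1) = ∅ := by
        ext f
        simp only [mem_incr, Finset.notMem_empty, iff_false]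
        rintro ⟨h1, -, h2⟩
        have := h1 0; have := h2 0; omega
      rw [this, List.ofFn_succ_last]
      simp [hsum_zero_cons]
  | succ M ih =>
    cases n with
    | zero =>
      have : incr (M + 1) 0 = Finset.univ := Finset.eq_univ_of_forall fun f =>
        mem_incr.2 ⟨fun i => i.elim0, Subsingleton.strictMono f, fun i => i.elim0⟩
      simp [this]
    | succ n =>
      have e : (List.ofFn κ).reverse =
          κ (Fin.last n) :: (List.ofFn fun i : Fin n => κ i.castSucc).reverse := by
        rw [List.ofFn_succ_last]; simp
      rw [e, hsum_succ_cons, ← e, ih, ih, incr_succ, Finset.sum_union, Finset.sum_image]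
      · simp only [Fin.prod_univ_castSucc, Fin.snoc_castSucc, Fin.snoc_last, ← Finset.sum_mul]
        push_cast
        ring
      · intro f _ g _ h
        exact (Fin.snoc_inj.1 h).1
      · rw [Finset.disjoint_left]
        intro f h1 h2
        obtain ⟨g, -, rfl⟩ := Finset.mem_image.1 h2
        have := (mem_incr.1 h1).1 (Fin.last n)
        simp at this

/-- The rate `1 / √(M + 1)`. -/
noncomputable def rate (M : ℕ) : ℝ := (√((M : ℝ) + 1))⁻¹

lemma rate_pos (M : ℕ) : 0 < rate M := by
  have : (0 : ℝ) < (M : ℝ) + 1 := by positivity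
  unfold rate; positivity

lemma inv_mul_sqrt_le (M : ℕ) :
    (((M : ℝ) + 1) * √((M : ℝ) + 1))⁻¹ ≤ 4 * (rate M - rate (M + 1)) := by
  have ha : (1 : ℝ) ≤ (M : ℝ) + 1 := by linarith [(Nat.cast_nonneg M : (0:ℝ) ≤ M)]
  unfold rate
  rw [Nat.cast_add_one]
  set a : ℝ := (M : ℝ) + 1 with ha'
  set x := √a with hx
  set y := √(a + 1) with hy
  have hx0 : 0 < x := Real.sqrt_pos.2 (by linarith)
  have hy0 : 0 < y := Real.sqrt_pos.2 (by linarith)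
  have hxx : x * x = a := Real.mul_self_sqrt (by linarith)
  have hyy : y * y = a + 1 := Real.mul_self_sqrt (by linarith)
  have hyx : y ≤ 3 / 2 * x := by
    refine abs_le_of_sq_le_sq' ?_ (by positivity) |>.2
    nlinarith
  have e : x⁻¹ - y⁻¹ = (x * y * (x + y))⁻¹ := by
    have : x + y ≠ 0 := by positivity
    field_simp
    nlinarith
  rw [e, ← one_div, ← div_eq_mul_inv, div_le_div_iff₀ (by positivity) (by positivity), one_mul,
    ← hxx]
  have h1 : x * y * (x + y) ≤ x * (3 / 2 * x) * (x + 3 / 2 * x) := by gcongr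
  have h2 : (0:ℝ) ≤ x ^ 3 := by positivity
  nlinarith

lemma exists_norm_hsum_succ_sub_le (d : ℕ) :
    ∃ C : ℝ, 0 ≤ C ∧ ∀ (M k : ℕ) (w : List ℕ), 2 ≤ k → (∀ i ∈ w, 0 < i) → w.length ≤ d →
      ‖hsum (M + 1) (k :: w) - hsum M (k :: w)‖ ≤ C * (rate M - rate (M + 1)) := by
  obtain ⟨C, hC, h⟩ := exists_harm_pow_le d
  refine ⟨C * 4, by positivity, fun M k w hk hw hd => ?_⟩
  have ha : (1 : ℝ) ≤ (M : ℝ) + 1 := by linarith [(Nat.cast_nonneg M : (0:ℝ) ≤ M)]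
  have h1 : ‖hsum M w‖ ≤ C * √((M : ℝ) + 1) := by
    refine (norm_hsum_le M hw).trans ?_
    calc harm M ^ w.length ≤ (2 + harm M) ^ w.length := by
          have := harm_nonneg M
          gcongr; linarith
      _ ≤ (2 + harm M) ^ d := by
          gcongr
          linarith [harm_nonneg M]
      _ ≤ _ := h M
      _ ≤ C * √((M : ℝ) + 1) := by
          rw [Real.sqrt_eq_rpow]
          exact mul_le_mul_of_nonneg_left
            (Real.rpow_le_rpow_of_exponent_le ha (by norm_num)) hC
  rw [hsum_succ_cons, add_sub_cancel_left, norm_mul, mul_assoc]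
  calc _ ≤ (((M : ℝ) + 1)⁻¹) ^ 2 * (C * √((M : ℝ) + 1)) := by
        gcongr
        exact norm_inv_succ_pow_le M hk
    _ = C * (((M : ℝ) + 1) * √((M : ℝ) + 1))⁻¹ := by
        have hx0 : 0 < √((M : ℝ) + 1) := Real.sqrt_pos.2 (by linarith)
        have hxx : √((M : ℝ) + 1) * √((M : ℝ) + 1) = (M : ℝ) + 1 :=
          Real.mul_self_sqrt (by linarith)
        set x := √((M : ℝ) + 1)
        rw [← hxx]
        field_simp
    _ ≤ _ := by gcongr; exact inv_mul_sqrt_le M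

lemma exists_norm_hsum_sub_le (d : ℕ) :
    ∃ C : ℝ, 0 ≤ C ∧ ∀ (M N k : ℕ) (w : List ℕ), M ≤ N → 2 ≤ k → (∀ i ∈ w, 0 < i) →
      w.length ≤ d → ‖hsum N (k :: w) - hsum M (k :: w)‖ ≤ C * rate M := by
  obtain ⟨C, hC, h⟩ := exists_norm_hsum_succ_sub_le d
  refine ⟨C, hC, fun M N k w hMN hk hw hd => ?_⟩
  have : ‖hsum N (k :: w) - hsum M (k :: w)‖ ≤ C * (rate M - rate N) := by
    induction N, hMN using Nat.le_induction with
    | base => simp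
    | succ N hMN ih =>
      calc _ = ‖(hsum (N + 1) (k :: w) - hsum N (k :: w)) +
            (hsum N (k :: w) - hsum M (k :: w))‖ := by
            ring_nf
        _ ≤ C * (rate N - rate (N + 1)) + C * (rate M - rate N) :=
            (norm_add_le _ _).trans (add_le_add (h N k w hk hw hd) ih)
        _ = _ := by ring
  refine this.trans ?_
  gcongr
  linarith [rate_pos N]

/-- The summand of a multiple zeta value, extended by zero to all tuples of integers. -/
noncomputable def mzvTerm {n : ℕ} (κ : Fin n → ℕ) (f : Fin n → ℕ) : ℝ :=
  Set.indicator {f : Fin n → ℕ | StrictMono f ∧ ∀ i, 0 < f i}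
    (fun f => ∏ i, 1 / (f i : ℝ) ^ κ i) f

lemma mzvTerm_nonneg {n : ℕ} (κ f : Fin n → ℕ) : 0 ≤ mzvTerm κ f :=
  Set.indicator_nonneg (fun _ _ => by positivity) _

lemma tsum_mzvTerm (l : List ℕ) : ∑' f, mzvTerm l.get f = MZV l := by
  let ι : {f : Fin l.length → ℕ+ // StrictMono f} → Fin l.length → ℕ := fun f i => f.1 i
  have hι : Function.Injective ι := fun f g h =>
    Subtype.ext (funext fun i => PNat.coe_injective (congrFun h i))
  rw [MZV, ← hι.tsum_eq]
  · refine tsum_congr fun f => ?_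
    rw [mzvTerm, Set.indicator_of_mem]
    exact ⟨fun i j hij => f.2 hij, fun i => (f.1 i).pos⟩
  · intro f hf
    have hf' := Set.mem_of_indicator_ne_zero hf
    exact ⟨⟨fun i => ⟨f i, hf'.2 i⟩, fun i j hij => hf'.1 hij⟩, rfl⟩

lemma sum_incr_eq (M n : ℕ) (κ : Fin n → ℕ) :
    ∑ f ∈ incr M n, ∏ i, 1 / (f i : ℝ) ^ κ i =
      ∑ f ∈ Fintype.piFinset fun _ : Fin n => Finset.range (M + 1), mzvTerm κ f := by
  rw [incr, Finset.sum_filter]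
  refine Finset.sum_congr rfl fun f _ => ?_
  simp only [mzvTerm, Set.indicator_apply, Set.mem_ofPred_eq]

lemma tendsto_box (n : ℕ) :
    Filter.Tendsto (fun M : ℕ => Fintype.piFinset fun _ : Fin n => Finset.range (M + 1))
      Filter.atTop Filter.atTop := by
  refine Filter.tendsto_atTop_finset_of_monotone ?_ ?_
  · intro M N h
    exact Fintype.piFinset_subset _ _ fun _ => Finset.range_mono (by omega)
  · intro f
    refine ⟨∑ i, f i, Fintype.mem_piFinset.2 fun i => Finset.mem_range.2 ?_⟩
    exact Nat.lt_succ_iff.2 (Finset.single_le_sum (fun _ _ => Nat.zero_le _) (Finset.mem_univ i))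

lemma tendsto_hsum {k : ℕ} {w : List ℕ} (hk : 2 ≤ k) (hw : ∀ i ∈ w, 0 < i) :
    Filter.Tendsto (fun M => hsum M (k :: w)) Filter.atTop
      (nhds (MZV (k :: w).reverse : ℂ)) := by
  obtain ⟨C, hC, h⟩ := exists_norm_hsum_sub_le w.length
  set l := (k :: w).reverse with hl
  have e : ∀ M, hsum M (k :: w) = ((∑ f ∈ Fintype.piFinset fun _ : Fin l.length =>
      Finset.range (M + 1), mzvTerm l.get f : ℝ) : ℂ) := fun M => by
    rw [← sum_incr_eq, ← hsum_eq_sum_incr, List.ofFn_get, hl, List.reverse_reverse]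
  have hs : Summable (mzvTerm l.get) := by
    refine summable_of_sum_le (c := C * rate 0) (fun f => mzvTerm_nonneg _ _) fun s => ?_
    obtain ⟨M, hM⟩ := ((tendsto_box l.length).eventually (Filter.eventually_ge_atTop s)).exists
    refine (Finset.sum_le_sum_of_subset_of_nonneg hM fun f _ _ => mzvTerm_nonneg _ _).trans ?_
    have := h 0 M k w (Nat.zero_le _) hk hw le_rfl
    rw [hsum_zero_cons, sub_zero, e, Complex.norm_real] at this
    exact (Real.le_norm_self _).trans this
  have := hs.hasSum.comp (tendsto_box l.length)
  rw [tsum_mzvTerm] at this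
  refine ((Complex.continuous_ofReal.tendsto _).comp this).congr fun M => ?_
  rw [e]; rfl

lemma exists_norm_hsum_sub_mzv_le (d : ℕ) :
    ∃ C : ℝ, 0 ≤ C ∧ ∀ (M k : ℕ) (w : List ℕ), 2 ≤ k → (∀ i ∈ w, 0 < i) →
      w.length ≤ d → ‖hsum M (k :: w) - (MZV (k :: w).reverse : ℂ)‖ ≤ C * rate M := by
  obtain ⟨C, hC, h⟩ := exists_norm_hsum_sub_le d
  refine ⟨C, hC, fun M k w hk hw hd => ?_⟩
  rw [norm_sub_rev]
  refine le_of_tendsto ((tendsto_hsum hk hw).sub_const _).norm ?_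
  filter_upwards [Filter.eventually_ge_atTop M] with N hN using h M N k w hN hk hw hd

end HarmonicSums

section Regularization

variable {Z : List ℕ → ℝ}

/-- The reversal of a regularization, with complex values. -/
noncomputable def revZ (Z : List ℕ → ℝ) (w : List ℕ) : ℂ := (Z w.reverse : ℂ)

lemma revZ_nil (hZ : IsStuffleReg Z) : revZ Z [] = 1 := by simp [revZ, hZ.empty]

lemma sumStuffleOne_revZ (hZ : IsStuffleReg Z) {w : List ℕ} (hw : ∀ i ∈ w, 0 < i) :
    sumStuffleOne (revZ Z) w = (Z [1] : ℂ) * revZ Z w := by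
  have := hZ.mul [1] w.reverse (by simp) (by simpa using hw)
  rw [stuffle_one_reverse] at this
  rw [revZ, ← Complex.ofReal_mul, this, sumStuffleOne]
  simp only [Multiset.map_coe, Multiset.sum_coe, List.map_map]
  rw [← Complex.ofRealHom_eq_coe, map_list_sum, List.map_map]
  rfl

/-- The multiple harmonic sums, regularized to have the value `T` at the word `1`. -/
noncomputable def regHsum (T : ℝ) (M : ℕ) : List ℕ → ℂ :=
  conv (expo ((T - harm M : ℝ) : ℂ)) (hsum M)

lemma sumStuffleOne_regHsum (T : ℝ) (M : ℕ) {w : List ℕ} (hw : ∀ i ∈ w, 0 < i) :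
    sumStuffleOne (regHsum T M) w = (T : ℂ) * regHsum T M w := by
  rw [regHsum, sumStuffleOne_expo_conv (fun w _ => sumStuffleOne_hsum M w) hw]
  push_cast; ring

lemma conv_expo_eq_of_lead {x : ℂ} {φ : List ℕ → ℂ} {w : List ℕ} (h : lead w = 0) :
    conv (expo x) φ w = φ w := by
  cases w with
  | nil => simp
  | cons k w =>
    have hk : k ≠ 1 := by rintro rfl; simp [lead] at h
    rw [conv_cons]
    simp only [expo_nil, one_mul, add_eq_left]
    rw [conv_congr (φ' := fun _ => 0) (ψ' := φ)]
    · rw [conv_eq_sum]; simp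
    · exact fun u v _ => ⟨expo_of_not fun h => hk (h k (by simp)), rfl⟩

lemma exists_norm_regHsum_sub_le (hZ : IsStuffleReg Z) (d : ℕ) :
    ∃ K : ℝ, 0 ≤ K ∧ ∀ (M : ℕ) (w : List ℕ), (∀ i ∈ w, 0 < i) → w.length ≤ d →
      ‖regHsum (Z [1]) M w - revZ Z w‖ ≤ K * rate M := by
  obtain ⟨C, hC, h⟩ := exists_norm_hsum_sub_mzv_le d
  obtain ⟨K, hK, h'⟩ := exists_bound_of_sumStuffleOne (Z [1] : ℂ) d
  refine ⟨K * C, by positivity, fun M => ?_⟩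
  rw [mul_assoc]
  refine h' (fun w => regHsum (Z [1]) M w - revZ Z w) _ (mul_nonneg hC (rate_pos M).le) ?_ ?_
  · intro w hw
    rw [sumStuffleOne_sub, sumStuffleOne_regHsum _ _ hw, sumStuffleOne_revZ hZ hw, mul_sub]
  · intro w hw hd hl
    rw [regHsum, conv_expo_eq_of_lead hl]
    cases w with
    | nil => simpa [revZ_nil hZ] using mul_nonneg hC (rate_pos M).le
    | cons k w =>
      have hk : 2 ≤ k := by
        have h1 : 0 < k := hw k (by simp)
        have h2 : k ≠ 1 := by rintro rfl; simp [lead] at hl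
        omega
      have hw' : ∀ i ∈ w, 0 < i := fun i hi => hw i (by simp [hi])
      rw [revZ, hZ.conv _ (fun i hi => hw i (List.mem_reverse.1 hi)) (by simpa using hk)]
      exact h M k w hk hw' (by simp at hd; omega)

lemma exists_norm_le (hZ : IsStuffleReg Z) (d : ℕ) :
    ∃ K : ℝ, 0 ≤ K ∧ ∀ w : List ℕ, (∀ i ∈ w, 0 < i) → w.length ≤ d → ‖revZ Z w‖ ≤ K := by
  obtain ⟨K, hK, h⟩ := exists_norm_regHsum_sub_le hZ d
  refine ⟨K + (1 + |Z [1]|) ^ d, by positivity, fun w hw hd => ?_⟩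
  have h0 := h 0 w hw hd
  have e : regHsum (Z [1]) 0 w = expo (Z [1] : ℂ) w := by
    have : conv (expo ((Z [1] - harm 0 : ℝ) : ℂ)) (hsum 0) w
        = conv (expo ((Z [1] - harm 0 : ℝ) : ℂ)) eps w := by
      refine conv_congr fun u v _ => ⟨rfl, ?_⟩
      cases v <;> simp [hsum_zero_cons]
    rw [regHsum, this, conv_eps, harm_zero, sub_zero]
  have e2 := norm_expo_le (Z [1] : ℂ) w
  rw [e, norm_sub_rev] at h0
  have e3 : (1 + ‖(Z [1] : ℂ)‖) ^ w.length ≤ (1 + |Z [1]|) ^ d := by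
    rw [Complex.norm_real, Real.norm_eq_abs]
    gcongr
    linarith [abs_nonneg (Z [1])]
  have e4 : rate 0 = 1 := by simp [rate]
  rw [e4, mul_one] at h0
  have := norm_le_norm_sub_add (revZ Z w) (expo (Z [1] : ℂ) w)
  linarith

end Regularization

section Taylor

open PowerSeries Finset

lemma sum_antidiagonal_assoc {M : Type*} [AddCommMonoid M] (n : ℕ) (f : ℕ → ℕ → ℕ → M) :
    ∑ x ∈ antidiagonal n, ∑ y ∈ antidiagonal x.1, f y.1 y.2 x.2 =
      ∑ x ∈ antidiagonal n, ∑ y ∈ antidiagonal x.2, f x.1 y.1 y.2 := by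
  rw [sum_sigma', sum_sigma']
  refine sum_nbij' (fun t => ⟨(t.2.1, t.2.2 + t.1.2), (t.2.2, t.1.2)⟩)
    (fun t => ⟨(t.1.1 + t.2.1, t.2.2), (t.1.1, t.2.1)⟩) ?_ ?_ ?_ ?_ ?_ <;>
    rintro ⟨⟨a, b⟩, c, d⟩ h <;> simp_all <;> omega

lemma sum_antidiagonal_comm {M : Type*} [AddCommMonoid M] (n : ℕ) (f : ℕ → ℕ → ℕ → M) :
    ∑ x ∈ antidiagonal n, ∑ y ∈ antidiagonal x.2, f x.1 y.1 y.2 =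
      ∑ x ∈ antidiagonal n, ∑ y ∈ antidiagonal x.2, f y.1 x.1 y.2 := by
  rw [sum_sigma', sum_sigma']
  refine sum_nbij' (fun t => ⟨(t.2.1, t.1.1 + t.2.2), (t.1.1, t.2.2)⟩)
    (fun t => ⟨(t.2.1, t.1.1 + t.2.2), (t.1.1, t.2.2)⟩) ?_ ?_ ?_ ?_ ?_ <;>
    rintro ⟨⟨a, b⟩, c, d⟩ h <;> simp_all <;> omega

/-- The coefficient of `X ^ p` in the expansion of `(1 + X) ^ (-k)`. -/
noncomputable def negBinom (k p : ℕ) : ℂ := (-1) ^ p * (Nat.multichoose k p : ℂ)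

/-- The series `∑ p, negBinom k p * X ^ p * F p`. -/
noncomputable def binomSum (k : ℕ) (F : ℕ → ℂ⟦X⟧) : ℂ⟦X⟧ :=
  PowerSeries.mk fun a => ∑ p ∈ antidiagonal a, negBinom k p.1 * coeff p.2 (F p.1)

lemma coeff_binomSum (k a : ℕ) (F : ℕ → ℂ⟦X⟧) :
    coeff a (binomSum k F) = ∑ p ∈ antidiagonal a, negBinom k p.1 * coeff p.2 (F p.1) :=
  coeff_mk _ _

lemma binomSum_add (k : ℕ) (F G : ℕ → ℂ⟦X⟧) :
    binomSum k (fun p => F p + G p) = binomSum k F + binomSum k G := by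
  ext a
  simp [coeff_binomSum, mul_add, sum_add_distrib]

lemma binomSum_mul (k : ℕ) (F : ℕ → ℂ⟦X⟧) (g : ℂ⟦X⟧) :
    binomSum k (fun p => F p * g) = binomSum k F * g := by
  ext a
  simp only [coeff_binomSum, coeff_mul, sum_mul, mul_sum]
  rw [sum_antidiagonal_assoc a fun i j l => negBinom k i * coeff j (F i) * coeff l g]
  exact sum_congr rfl fun x _ => sum_congr rfl fun y _ => (mul_assoc _ _ _).symm

lemma binomSum_comm (k l : ℕ) (F : ℕ → ℕ → ℂ⟦X⟧) :
    binomSum k (fun p => binomSum l (F p)) = binomSum l (fun q => binomSum k fun p => F p q) := by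
  ext a
  simp only [coeff_binomSum, mul_sum]
  rw [sum_antidiagonal_comm a fun p q b => negBinom k p * (negBinom l q * coeff b (F p q))]
  exact sum_congr rfl fun x _ => sum_congr rfl fun y _ => mul_left_comm _ _ _

lemma negBinom_zero_right (k : ℕ) : negBinom k 0 = 1 := by
  simp [negBinom, Nat.multichoose_zero_right]

lemma negBinom_zero_succ (p : ℕ) : negBinom 0 (p + 1) = 0 := by
  simp [negBinom, Nat.multichoose_zero_succ]

lemma binomSum_eq_of_forall {k : ℕ} {F : ℕ → ℂ⟦X⟧} (h : ∀ p, p ≠ 0 → negBinom k p = 0 ∨ F p = 0) :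
    binomSum k F = F 0 := by
  ext a
  rw [coeff_binomSum, sum_eq_single (0, a)]
  · simp [negBinom_zero_right]
  · rintro ⟨p, q⟩ hpq hne
    have : p ≠ 0 := by rintro rfl; simp_all
    rcases h p this with h | h <;> simp [h]
  · simp

/-- The Taylor shift: on multiple harmonic sums it replaces each denominator `n` by `n + X`. -/
noncomputable def taylor : List ℕ → (List ℕ → ℂ) → ℂ⟦X⟧
  | [], φ => C (φ [])
  | k :: w, φ => binomSum k fun p => taylor w fun v => φ ((k + p) :: v)

@[simp] lemma taylor_nil (φ : List ℕ → ℂ) : taylor [] φ = C (φ []) := rfl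

lemma taylor_cons (k : ℕ) (w : List ℕ) (φ : List ℕ → ℂ) :
    taylor (k :: w) φ = binomSum k fun p => taylor w fun v => φ ((k + p) :: v) := rfl

lemma taylor_add (w : List ℕ) (φ ψ : List ℕ → ℂ) :
    taylor w (fun v => φ v + ψ v) = taylor w φ + taylor w ψ := by
  induction w generalizing φ ψ with
  | nil => simp
  | cons k w ih => simp only [taylor_cons, ih, binomSum_add]

lemma taylor_mul (w : List ℕ) (c : ℂ) (φ : List ℕ → ℂ) :
    taylor w (fun v => c * φ v) = C c * taylor w φ := by
  induction w generalizing φ with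
  | nil => simp
  | cons k w ih => simp only [taylor_cons, ih, mul_comm (C c), binomSum_mul]

lemma taylor_sub (w : List ℕ) (φ ψ : List ℕ → ℂ) :
    taylor w (fun v => φ v - ψ v) = taylor w φ - taylor w ψ := by
  have := taylor_add w φ (fun v => (-1) * ψ v)
  rw [taylor_mul] at this
  simpa [sub_eq_add_neg] using this

lemma conv_binomSum (k : ℕ) (F : ℕ → List ℕ → ℂ⟦X⟧) (G : List ℕ → ℂ⟦X⟧) (w : List ℕ) :
    conv (fun v => binomSum k fun p => F p v) G w = binomSum k fun p => conv (F p) G w := by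
  induction w generalizing F with
  | nil => simp [binomSum_mul]
  | cons l w ih => simp only [conv_cons, ih, binomSum_add, binomSum_mul]

lemma taylor_conv (w : List ℕ) (φ ψ : List ℕ → ℂ) :
    taylor w (conv φ ψ) = conv (fun v => taylor v φ) (fun v => taylor v ψ) w := by
  induction w generalizing φ with
  | nil => simp
  | cons k w ih =>
    have : taylor (k :: w) (conv φ ψ) = binomSum k fun p => taylor w fun v =>
        φ [] * ψ ((k + p) :: v) + conv (fun u => φ ((k + p) :: u)) ψ v := rfl
    rw [this]
    simp only [taylor_add, taylor_mul, binomSum_add, ih, conv_cons, taylor_nil, mul_comm (C _),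
      binomSum_mul, ← conv_binomSum]
    simp only [taylor_cons]

lemma taylor_of_forall {φ : List ℕ → ℂ} (hφ : ∀ v, (¬ ∀ i ∈ v, i = 1) → φ v = 0) (w : List ℕ) :
    taylor w φ = C (φ w) := by
  have h0 : ∀ v : List ℕ, taylor v (fun _ => (0 : ℂ)) = 0 := fun v => by
    simpa using taylor_mul v 0 (fun _ => 0)
  induction w generalizing φ with
  | nil => rfl
  | cons k w ih =>
    have hp : ∀ p, k + p ≠ 1 → (taylor w fun v => φ ((k + p) :: v)) = 0 := fun p hp => by
      rw [show (fun v => φ ((k + p) :: v)) = fun _ => 0 from funext fun v => hφ _ (by simp [hp]),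
        h0]
    rw [taylor_cons, binomSum_eq_of_forall, ih, add_zero]
    · exact fun v hv => hφ _ (fun h => hv fun i hi => h i (by simp [hi]))
    · intro p hp0
      rcases Nat.eq_zero_or_pos k with rfl | hk
      · obtain ⟨p, rfl⟩ := Nat.exists_eq_succ_of_ne_zero hp0
        exact Or.inl (negBinom_zero_succ p)
      · exact Or.inr (hp p (by omega))

lemma taylor_eps (w : List ℕ) : taylor w eps = eps w := by
  rw [taylor_of_forall]
  · cases w <;> simp
  · intro v hv
    cases v
    · simp at hv
    · rfl

lemma taylor_expo (x : ℂ) (w : List ℕ) : taylor w (expo x) = C (expo x w) :=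
  taylor_of_forall (fun _ => expo_of_not) w

/-- The series of `(n + X) ^ (-k)`. -/
lemma inv_pow_eq {x : ℂ} (hx : x ≠ 0) (k : ℕ) :
    ((X + C x : ℂ⟦X⟧)⁻¹) ^ k = PowerSeries.mk fun a => negBinom k a * x⁻¹ ^ (k + a) := by
  have hne : constantCoeff (X + C x : ℂ⟦X⟧) ≠ 0 := by simpa using hx
  induction k with
  | zero =>
    ext a
    cases a <;> simp [negBinom_zero_right, negBinom_zero_succ, coeff_one]
  | succ k ih =>
    rw [pow_succ, ih, eq_comm, PowerSeries.eq_mul_inv_iff_mul_eq hne, mul_comm]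
    ext a
    cases a with
    | zero => simp [add_mul, negBinom_zero_right, pow_succ, hx]
    | succ a =>
      simp only [add_mul, map_add, coeff_succ_X_mul, coeff_C_mul, coeff_mk, negBinom,
        Nat.multichoose_succ_succ]
      rw [show k + 1 + (a + 1) = (k + a + 1) + 1 by ring, show k + 1 + a = k + a + 1 by ring,
        show k + (a + 1) = k + a + 1 by ring, pow_succ _ (k + a + 1)]
      push_cast
      field_simp
      ring

lemma taylor_letter {x : ℂ} (hx : x ≠ 0) (w : List ℕ) :
    taylor w (letter x⁻¹) = letter ((X + C x : ℂ⟦X⟧)⁻¹) w := by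
  cases w with
  | nil => simp
  | cons k w =>
    rw [taylor_cons]
    simp only [letter_cons, taylor_mul, binomSum_mul, taylor_eps]
    cases w with
    | cons l w => simp
    | nil =>
      rw [eps_nil, mul_one, letter_singleton, inv_pow_eq hx]
      ext a
      rw [coeff_binomSum, coeff_mk, sum_eq_single (a, 0)]
      · simp
      · rintro ⟨p, q⟩ hpq hne
        have : q ≠ 0 := by rintro rfl; simp_all
        simp [coeff_C, this]
      · simp

lemma taylor_ordSum {xs : List ℂ} (hx : ∀ x ∈ xs, x ≠ 0) (w : List ℕ) :
    taylor w (ordSum (xs.map fun x => x⁻¹)) =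
      ordSum (xs.map fun x => (X + C x : ℂ⟦X⟧)⁻¹) w := by
  induction xs generalizing w with
  | nil => exact taylor_eps w
  | cons x xs ih =>
    rw [List.map_cons, List.map_cons, ordSum_cons_left, taylor_conv, ordSum_cons_left]
    exact conv_congr fun u v _ =>
      ⟨taylor_letter (hx x (by simp)) u, ih (fun y hy => hx y (by simp [hy])) v⟩

lemma taylor_append_singleton (w : List ℕ) (k : ℕ) (φ : List ℕ → ℂ) :
    taylor (w ++ [k]) φ = binomSum k fun p => taylor w fun v => φ (v ++ [k + p]) := by
  induction w generalizing φ with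
  | nil => simp [taylor_cons]
  | cons j w ih =>
    rw [List.cons_append, taylor_cons]
    simp only [ih, taylor_cons, List.cons_append]
    exact binomSum_comm _ _ _

lemma taylor_reverse (w : List ℕ) (φ : List ℕ → ℂ) :
    taylor w (fun v => φ v.reverse) = taylor w.reverse φ := by
  induction w generalizing φ with
  | nil => simp
  | cons k w ih =>
    rw [List.reverse_cons, taylor_append_singleton, taylor_cons]
    congr 1
    funext p
    rw [← ih]
    simp only [List.reverse_cons]

lemma multichoose_le (k a : ℕ) : Nat.multichoose k a ≤ (a + 1) ^ k := by
  induction k generalizing a with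
  | zero => cases a <;> simp [Nat.multichoose_zero_right, Nat.multichoose_zero_succ]
  | succ k ih =>
    induction a with
    | zero => simp [Nat.multichoose_zero_right]
    | succ a ih' =>
      rw [Nat.multichoose_succ_succ]
      have h1 : (a + 1) ^ (k + 1) ≤ (a + 1) * (a + 1 + 1) ^ k := by
        rw [pow_succ']; gcongr; omega
      have h2 := ih (a + 1)
      have h3 : (a + 1 + 1) ^ (k + 1) = (a + 1 + 1) ^ k + (a + 1) * (a + 1 + 1) ^ k := by ring
      omega

lemma norm_negBinom_le (k a : ℕ) : ‖negBinom k a‖ ≤ ((a : ℝ) + 1) ^ k := by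
  rw [negBinom, norm_mul, norm_pow, norm_neg, norm_one, one_pow, one_mul, Complex.norm_natCast]
  exact_mod_cast multichoose_le k a

lemma norm_coeff_taylor_le {φ : List ℕ → ℂ} {ε : ℝ} (hε : 0 ≤ ε) {w : List ℕ}
    (hw : ∀ i ∈ w, 0 < i)
    (h : ∀ v : List ℕ, (∀ i ∈ v, 0 < i) → v.length = w.length → ‖φ v‖ ≤ ε) (a : ℕ) :
    ‖coeff a (taylor w φ)‖ ≤ ε * ((a : ℝ) + 1) ^ (w.sum + w.length) := by
  induction w generalizing φ a with
  | nil =>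
    rw [taylor_nil, coeff_C]
    split_ifs
    · simpa using h [] (by simp) rfl
    · simpa using hε
  | cons k w ih =>
    have hk : 0 < k := hw k (by simp)
    have hw' : ∀ i ∈ w, 0 < i := fun i hi => hw i (by simp [hi])
    rw [taylor_cons, coeff_binomSum]
    have : ∀ x ∈ antidiagonal a, ‖negBinom k x.1 * coeff x.2 (taylor w fun v => φ ((k + x.1) :: v))‖
        ≤ ((a : ℝ) + 1) ^ k * (ε * ((a : ℝ) + 1) ^ (w.sum + w.length)) := by
      rintro ⟨p, q⟩ hpq
      rw [HasAntidiagonal.mem_antidiagonal] at hpq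
      have hp : (p : ℝ) ≤ a := by exact_mod_cast (by omega : p ≤ a)
      have hq : (q : ℝ) ≤ a := by exact_mod_cast (by omega : q ≤ a)
      rw [norm_mul]
      have h1 := norm_negBinom_le k p
      have h2 := ih (φ := fun v => φ ((k + p) :: v)) hw' (fun v hv hl => h _ (by
        simp only [List.mem_cons, forall_eq_or_imp]; exact ⟨by omega, hv⟩) (by simp [hl])) q
      refine mul_le_mul (h1.trans ?_) (h2.trans ?_) (norm_nonneg _) (by positivity) <;> gcongr
    refine (norm_sum_le_of_le _ this).trans ?_
    rw [sum_const, Nat.card_antidiagonal, nsmul_eq_mul, List.sum_cons, List.length_cons]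
    push_cast
    exact le_of_eq (by ring)

lemma filter_piFinset_eq (n a : ℕ) :
    (Fintype.piFinset fun _ : Fin n => range (a + 1)).filter (fun f => ∑ i, f i = a) =
      Finset.Nat.antidiagonalTuple n a := by
  ext f
  simp only [mem_filter, Fintype.mem_piFinset, mem_range, Finset.Nat.mem_antidiagonalTuple,
    and_iff_right_iff_imp]
  rintro rfl i
  exact Nat.lt_succ_iff.2 (single_le_sum (fun _ _ => Nat.zero_le _) (mem_univ i))

lemma sum_antidiagonalTuple_succ {M : Type*} [AddCommMonoid M] (n a : ℕ)
    (g : (Fin (n + 1) → ℕ) → M) :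
    ∑ f ∈ Finset.Nat.antidiagonalTuple (n + 1) a, g f =
      ∑ x ∈ antidiagonal a, ∑ f ∈ Finset.Nat.antidiagonalTuple n x.2, g (Fin.cons x.1 f) := by
  rw [sum_sigma']
  refine sum_nbij' (fun f => ⟨(f 0, a - f 0), Fin.tail f⟩) (fun t => Fin.cons t.1.1 t.2)
    ?_ ?_ ?_ ?_ ?_
  · intro f hf
    rw [Finset.Nat.mem_antidiagonalTuple, Fin.sum_univ_succ] at hf
    simp only [mem_sigma, HasAntidiagonal.mem_antidiagonal,
      Finset.Nat.mem_antidiagonalTuple, Fin.tail]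
    omega
  · rintro ⟨⟨p, q⟩, f⟩ hf
    simp only [mem_sigma, HasAntidiagonal.mem_antidiagonal, Finset.Nat.mem_antidiagonalTuple] at hf
    simp [Finset.Nat.mem_antidiagonalTuple, Fin.sum_univ_succ, hf]
  · intro f _; exact Fin.cons_self_tail f
  · rintro ⟨⟨p, q⟩, f⟩ hf
    simp only [mem_sigma, HasAntidiagonal.mem_antidiagonal] at hf
    obtain ⟨rfl, -⟩ := hf
    simp
  · intro f _
    simp only [Fin.cons_self_tail]

lemma zetaA_eq_coeff {Z : List ℕ → ℝ} {l : List ℕ} (hl : ∀ i ∈ l, 0 < i) (a : ℕ) :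
    ((zetaA Z a l : ℝ) : ℂ) = coeff a (taylor l fun v => (Z v : ℂ)) := by
  rw [zetaA, filter_piFinset_eq]
  induction l generalizing Z a with
  | nil =>
    cases a with
    | zero => simp
    | succ a => simp [Finset.Nat.antidiagonalTuple_zero_succ]
  | cons k l ih =>
    have hk : 0 < k := hl k (by simp)
    rw [taylor_cons, coeff_binomSum]
    simp only [List.length_cons]
    rw [sum_antidiagonalTuple_succ, mul_sum, Complex.ofReal_sum]
    refine sum_congr rfl fun x hx => ?_
    rw [← ih (Z := fun v => Z ((k + x.1) :: v)) (fun i hi => hl i (by simp [hi]))]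
    rw [HasAntidiagonal.mem_antidiagonal] at hx
    have e : Nat.multichoose k x.1 = Nat.choose (k - 1 + x.1) x.1 := by
      rw [Nat.multichoose_eq]; congr 1; omega
    simp only [List.ofFn_succ, Fin.prod_univ_succ, Fin.cons_zero, Fin.cons_succ, negBinom, e,
      List.get_cons_zero, List.get_cons_succ']
    rw [← hx, pow_add]
    push_cast
    simp only [mul_sum]
    exact sum_congr rfl fun f _ => by
      simp only [List.get_eq_getElem]
      ring

end Taylor

section Evaluation

open PowerSeries

/-- The series `F` converges absolutely at `z`, with sum `v`. -/
def HasEval (z : ℂ) (F : ℂ⟦X⟧) (v : ℂ) : Prop :=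
  Summable (fun a => ‖coeff a F * z ^ a‖) ∧ ∑' a, coeff a F * z ^ a = v

lemma HasEval.add {z v w : ℂ} {F G : ℂ⟦X⟧} (hF : HasEval z F v) (hG : HasEval z G w) :
    HasEval z (F + G) (v + w) := by
  have e : ∀ a, coeff a (F + G) * z ^ a = coeff a F * z ^ a + coeff a G * z ^ a := fun a => by
    rw [map_add, add_mul]
  refine ⟨?_, ?_⟩
  · simp only [e]
    exact Summable.of_nonneg_of_le (fun _ => norm_nonneg _) (fun a => norm_add_le _ _)
      (hF.1.add hG.1)
  · simp only [e]
    rw [hF.1.of_norm.tsum_add hG.1.of_norm, hF.2, hG.2]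

lemma hasEval_C (z c : ℂ) : HasEval z (C c) c := by
  have e : ∀ a, a ≠ 0 → coeff a (C c : ℂ⟦X⟧) * z ^ a = 0 := fun a ha => by simp [coeff_C, ha]
  refine ⟨summable_of_ne_finset_zero (s := {0}) fun a ha => ?_, ?_⟩
  · rw [e a (by simpa using ha), norm_zero]
  · rw [tsum_eq_single 0 e]; simp

lemma HasEval.mul {z v w : ℂ} {F G : ℂ⟦X⟧} (hF : HasEval z F v) (hG : HasEval z G w) :
    HasEval z (F * G) (v * w) := by
  have e : ∀ a, coeff a (F * G) * z ^ a =
      ∑ p ∈ Finset.HasAntidiagonal.antidiagonal a,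
        (coeff p.1 F * z ^ p.1) * (coeff p.2 G * z ^ p.2) := fun a => by
    rw [coeff_mul, Finset.sum_mul]
    refine Finset.sum_congr rfl fun p hp => ?_
    rw [← Finset.HasAntidiagonal.mem_antidiagonal.1 hp, pow_add]; ring
  refine ⟨?_, ?_⟩
  · simp only [e]
    exact summable_norm_sum_mul_antidiagonal_of_summable_norm
      (f := fun a => coeff a F * z ^ a) (g := fun a => coeff a G * z ^ a) hF.1 hG.1
  · simp only [e]
    rw [← hF.2, ← hG.2, tsum_mul_tsum_eq_tsum_sum_antidiagonal_of_summable_norm hF.1 hG.1]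

lemma HasEval.pow {z v : ℂ} {F : ℂ⟦X⟧} (hF : HasEval z F v) (n : ℕ) :
    HasEval z (F ^ n) (v ^ n) := by
  induction n with
  | zero => simpa using hasEval_C z 1
  | succ n ih => rw [pow_succ, pow_succ]; exact ih.mul hF

lemma HasEval.conv {z : ℂ} {φ ψ : List ℕ → ℂ⟦X⟧} {f g : List ℕ → ℂ}
    (hφ : ∀ w, HasEval z (φ w) (f w)) (hψ : ∀ w, HasEval z (ψ w) (g w)) (w : List ℕ) :
    HasEval z (conv φ ψ w) (conv f g w) := by
  induction w generalizing φ f with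
  | nil => simpa using (hφ []).mul (hψ [])
  | cons k w ih => exact ((hφ []).mul (hψ _)).add (ih fun v => hφ (k :: v))

lemma hasEval_inv {z : ℂ} {n : ℕ} (hn : 0 < n) (hz : ‖z‖ < 1) :
    HasEval z (X + C (n : ℂ) : ℂ⟦X⟧)⁻¹ (z + n)⁻¹ := by
  have hn0 : (n : ℂ) ≠ 0 := Nat.cast_ne_zero.2 hn.ne'
  have e : ∀ a, coeff a ((X + C (n : ℂ) : ℂ⟦X⟧)⁻¹) * z ^ a = (n : ℂ)⁻¹ * (-z * (n : ℂ)⁻¹) ^ a := by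
    intro a
    have := inv_pow_eq hn0 1
    rw [pow_one] at this
    rw [this, coeff_mk, negBinom, Nat.multichoose_one, mul_pow, neg_pow z, pow_add]
    push_cast; ring
  have hlt : ‖-z * (n : ℂ)⁻¹‖ < 1 := by
    rw [norm_mul, norm_neg, norm_inv, Complex.norm_natCast]
    have : ((n : ℝ))⁻¹ ≤ 1 := inv_le_one_of_one_le₀ (by exact_mod_cast hn)
    have h0 := norm_nonneg z
    nlinarith
  refine ⟨?_, ?_⟩
  · simp only [e, norm_mul _ ((-z * _) ^ _), norm_pow]
    exact (summable_geometric_of_lt_one (norm_nonneg _) hlt).mul_left _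
  · simp only [e]
    rw [tsum_mul_left, tsum_geometric_of_norm_lt_one hlt, ← mul_inv]
    congr 1
    field_simp
    ring

lemma HasEval.ordSum {ι : Type*} {z : ℂ} {F : ι → ℂ⟦X⟧} {f : ι → ℂ} {xs : List ι}
    (h : ∀ x ∈ xs, HasEval z (F x) (f x)) (w : List ℕ) :
    HasEval z (ordSum (xs.map F) w) (ordSum (xs.map f) w) := by
  induction xs generalizing w with
  | nil => cases w <;> simp <;> [simpa using hasEval_C z 1; simpa using hasEval_C z 0]
  | cons x xs ih =>
    have ih' := ih fun y hy => h y (by simp [hy])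
    cases w with
    | nil => simpa using hasEval_C z 1
    | cons k w =>
      rw [List.map_cons, List.map_cons, ordSum_cons, ordSum_cons]
      exact (ih' _).add (((h x (by simp)).pow k).mul (ih' w))

lemma mem_desc_pos {M n : ℕ} (h : n ∈ desc M) : 0 < n := by
  induction M with
  | zero => simp [desc] at h
  | succ M ih =>
    rw [desc, List.mem_cons] at h
    rcases h with rfl | h
    · exact Nat.succ_pos _
    · exact ih h

lemma taylor_hsum (M : ℕ) (w : List ℕ) :
    taylor w (hsum M) = ordSum ((desc M).map fun n : ℕ => (X + C (n : ℂ) : ℂ⟦X⟧)⁻¹) w := by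
  have := taylor_ordSum (xs := (desc M).map fun n : ℕ => (n : ℂ)) (fun x hx => by
    obtain ⟨n, hn, rfl⟩ := List.mem_map.1 hx
    exact Nat.cast_ne_zero.2 (mem_desc_pos hn).ne') w
  rw [List.map_map, List.map_map] at this
  exact this

lemma hasEval_taylor {z : ℂ} (hz : ‖z‖ < 1) (x : ℂ) (M : ℕ) (w : List ℕ) :
    HasEval z (taylor w (conv (expo x) (hsum M)))
      (conv (expo x) (ordSum ((desc M).map fun n : ℕ => (z + n)⁻¹)) w) := by
  rw [taylor_conv]
  refine HasEval.conv (fun w => ?_) (fun w => ?_) w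
  · rw [taylor_expo]; exact hasEval_C _ _
  · rw [taylor_hsum]
    exact HasEval.ordSum (fun n hn => hasEval_inv (mem_desc_pos hn) hz) w

lemma summable_succ_pow_mul_geometric {r : ℝ} (h0 : 0 ≤ r) (h1 : r < 1) (c : ℕ) :
    Summable fun a : ℕ => ((a : ℝ) + 1) ^ c * r ^ a := by
  rcases h0.eq_or_lt with rfl | h0
  · refine summable_of_ne_finset_zero (s := {0}) fun a ha => ?_
    rw [zero_pow (by simpa using ha), mul_zero]
  · have := (summable_nat_add_iff 1).2
      (summable_pow_mul_geometric_of_norm_lt_one c (r := r) (by rwa [Real.norm_of_nonneg h0.le]))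
    refine (this.mul_left r⁻¹).congr fun a => ?_
    rw [pow_succ]; push_cast; field_simp

lemma tendsto_rate : Filter.Tendsto rate Filter.atTop (nhds 0) := by
  unfold rate
  refine tendsto_inv_atTop_zero.comp (Real.tendsto_sqrt_atTop.comp ?_)
  exact Filter.tendsto_atTop_add_const_right _ _ tendsto_natCast_atTop_atTop

lemma tendsto_HReg {Z : List ℕ → ℝ} (hZ : IsStuffleReg Z) {z : ℂ} (hz : ‖z‖ < 1) {w : List ℕ}
    (hw : ∀ i ∈ w, 0 < i) :
    Filter.Tendsto (fun N => conv (expo ((Z [1] - harm N : ℝ) : ℂ))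
      (ordSum ((desc N).map fun n : ℕ => (z + n)⁻¹)) w) Filter.atTop
      (nhds (HReg Z z w.reverse)) := by
  obtain ⟨K, hK, h1⟩ := exists_norm_regHsum_sub_le hZ w.length
  obtain ⟨K', hK', h2⟩ := exists_norm_le hZ w.length
  set c := w.sum + w.length
  have hs := summable_succ_pow_mul_geometric (norm_nonneg z) hz c
  have hb : ∀ {φ : List ℕ → ℂ} {ε : ℝ}, 0 ≤ ε →
      (∀ v : List ℕ, (∀ i ∈ v, 0 < i) → v.length = w.length → ‖φ v‖ ≤ ε) →
      ∀ a, ‖coeff a (taylor w φ) * z ^ a‖ ≤ ε * (((a : ℝ) + 1) ^ c * ‖z‖ ^ a) := by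
    intro φ ε hε h a
    rw [norm_mul, norm_pow, ← mul_assoc]
    gcongr
    exact norm_coeff_taylor_le hε hw h a
  have hr : HReg Z z w.reverse = ∑' a, coeff a (taylor w (revZ Z)) * z ^ a := by
    rw [HReg]
    refine tsum_congr fun a => ?_
    rw [zetaA_eq_coeff (by simpa using hw), ← taylor_reverse, mul_comm]
    rfl
  have hsum : Summable fun a => coeff a (taylor w (revZ Z)) * z ^ a :=
    Summable.of_norm (Summable.of_nonneg_of_le (fun _ => norm_nonneg _)
      (hb hK' fun v hv hl => h2 v hv hl.le) (hs.mul_left K'))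
  rw [tendsto_iff_norm_sub_tendsto_zero]
  refine squeeze_zero (g := fun N => K * rate N * ∑' a : ℕ, ((a : ℝ) + 1) ^ c * ‖z‖ ^ a)
    (fun _ => norm_nonneg _) (fun N => ?_) ?_
  · have hN := hasEval_taylor hz ((Z [1] - harm N : ℝ) : ℂ) N w
    rw [← hN.2, hr, ← hN.1.of_norm.tsum_sub hsum, ← tsum_mul_left]
    have := hb (φ := fun v => regHsum (Z [1]) N v - revZ Z v)
      (mul_nonneg hK (rate_pos N).le) fun v hv hl => h1 N v hv hl.le
    refine tsum_of_norm_bounded (hs.mul_left _).hasSum fun a => ?_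
    rw [← sub_mul, ← map_sub, ← taylor_sub]
    exact this a
  · have := (tendsto_rate.const_mul K).mul_const (∑' a : ℕ, ((a : ℝ) + 1) ^ c * ‖z‖ ^ a)
    simpa using this

end Evaluation

section RegTan

/-- The values of `e` on the window of integers `-N, …, N`, in increasing order. -/
def window {A : Type*} (e : ℤ → A) (N : ℕ) : List A :=
  (List.range (2 * N + 1)).map fun i : ℕ => e ((i : ℤ) - N)

lemma map_range_eq_desc {A : Type*} (e : ℤ → A) (a : ℤ) (p : ℕ) :
    ((List.range p).map fun i : ℕ => e (a + i)) = (desc p).map fun n : ℕ => e (a + p - n) := by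
  induction p generalizing a with
  | zero => rfl
  | succ p ih =>
    rw [List.range_succ_eq_map, desc, List.map_cons, List.map_cons, List.map_map]
    congr 1
    · congr 1; push_cast; ring
    · have := ih (a + 1)
      convert this using 3
      · simp only [Function.comp, Nat.succ_eq_add_one]; congr 1; push_cast; ring
      · congr 1; push_cast; ring

lemma map_range_eq_reverse_desc {A : Type*} (f : ℕ → A) (q : ℕ) :
    ((List.range q).map fun i => f (i + 1)) = ((desc q).map f).reverse := by
  induction q with
  | zero => rfl
  | succ q ih => rw [List.range_succ, List.map_append, ih]; simp [desc]

lemma window_split {A : Type*} (e : ℤ → A) {N p q : ℕ} (h : p + q = 2 * N) :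
    window e N = ((desc p).map fun n : ℕ => e ((p : ℤ) - N - n)) ++
      e ((p : ℤ) - N) :: ((desc q).map fun n : ℕ => e ((p : ℤ) - N + n)).reverse := by
  rw [window, ← h, show p + q + 1 = p + (q + 1) by ring, List.range_add, List.map_append,
    List.range_succ_eq_map, List.map_cons, List.map_cons, List.map_map, List.map_map,
    ← map_range_eq_reverse_desc fun n => e ((p : ℤ) - N + n)]
  congr 1
  · have := map_range_eq_desc e (-N) p
    convert this using 3
    · congr 1; ring
    · congr 1; ring
  · congr 1
    congr 1
    funext i
    simp only [Function.comp]; congr 1; push_cast; ring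

/-- The truncated multitangent sums, with both ends regularized. -/
noncomputable def regTan {R : Type*} [CommRing R] [Algebra ℂ R] (e : ℤ → R) (x : ℂ) (N : ℕ) :
    List ℕ → R :=
  conv (fun v => algebraMap ℂ R (expo x v))
    (conv (ordSum (window e N)) fun v => algebraMap ℂ R (expo (-x) v))

lemma tendsto_conv {f g : ℕ → List ℕ → ℂ} {φ ψ : List ℕ → ℂ} {w : List ℕ}
    (hf : ∀ u v, u ++ v = w → Filter.Tendsto (fun N => f N u) Filter.atTop (nhds (φ u)))
    (hg : ∀ u v, u ++ v = w → Filter.Tendsto (fun N => g N v) Filter.atTop (nhds (ψ v))) :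
    Filter.Tendsto (fun N => conv (f N) (g N) w) Filter.atTop (nhds (conv φ ψ w)) := by
  simp only [conv_eq_sum]
  refine tendsto_finsetSum _ fun i _ => ?_
  exact (hf _ _ (List.take_append_drop i w)).mul (hg _ _ (List.take_append_drop i w))

/-- The monotangent summands. -/
noncomputable def cpole (z : ℂ) (m : ℤ) : ℂ := (z + m)⁻¹

lemma regTan_split {R : Type*} [CommRing R] [Algebra ℂ R] (e : ℤ → R) (x : ℂ) {N p q : ℕ}
    (h : p + q = 2 * N) :
    regTan e x N = conv
      (conv (fun v => algebraMap ℂ R (expo x v))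
        (ordSum ((desc p).map fun n : ℕ => e ((p : ℤ) - N - n))))
      (conv (letter (e ((p : ℤ) - N)))
        (conv (ordSum ((desc q).map fun n : ℕ => e ((p : ℤ) - N + n)).reverse)
          fun v => algebraMap ℂ R (expo (-x) v))) := by
  rw [regTan, window_split e h, ordSum_append, ordSum_cons_left, conv_assoc', conv_assoc',
    conv_assoc']

lemma PsiReg_eq_conv (Z : List ℕ → ℝ) (k : List ℕ) (z : ℂ) :
    PsiReg Z k z = conv (fun u => (-1) ^ u.sum * HReg Z (-z) u.reverse)
      (conv (letter z⁻¹) (HReg Z z)) k := by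
  rw [conv_letter_conv, conv_eq_sum, PsiReg]
  congr 1
  refine Finset.sum_congr rfl fun i _ => ?_
  rw [one_div, inv_pow]; ring

lemma tendsto_regTan {Z : List ℕ → ℝ} (hZ : IsStuffleReg Z) {z : ℂ} (hz : ‖z‖ < 1) {k : List ℕ}
    (hk : ∀ i ∈ k, 0 < i) :
    Filter.Tendsto (fun N => regTan (cpole z) ((harm N - Z [1] : ℝ) : ℂ) N k) Filter.atTop
      (nhds (PsiReg Z k z)) := by
  rw [PsiReg_eq_conv]
  have hneg : ∀ N : ℕ, (-((harm N - Z [1] : ℝ) : ℂ)) = ((Z [1] - harm N : ℝ) : ℂ) := fun N => by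
    push_cast; ring
  simp only [fun N => regTan_split (cpole z) ((harm N - Z [1] : ℝ) : ℂ) (two_mul N).symm,
    Algebra.algebraMap_self, RingHom.id_apply, sub_self, hneg]
  refine tendsto_conv (fun u v h => ?_) (fun u v h => ?_)
  · have hu := (pos_of_append h hk).1
    refine ((tendsto_HReg hZ (z := -z) (by simpa using hz) hu).const_mul ((-1) ^ u.sum)).congr
      fun N => ?_
    rw [← conv_sign]
    refine conv_congr fun a b _ => ⟨?_, ?_⟩
    · rw [sign_mul_expo, ← hneg, neg_neg]
    · rw [← ordSum_neg, List.map_map]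
      congr 2
      funext n
      simp only [Function.comp, cpole]
      rw [← inv_neg]; congr 1; push_cast; ring
  · have hv := (pos_of_append h hk).2
    refine tendsto_conv (fun a b h' => ?_) (fun a b h' => ?_)
    · have : letter (cpole z 0) = letter z⁻¹ := by simp [cpole]
      rw [this]; exact tendsto_const_nhds
    · have hb := (pos_of_append h' hv).2
      have := tendsto_HReg hZ (z := z) hz (w := b.reverse) (by simpa using hb)
      rw [List.reverse_reverse] at this
      refine this.congr fun N => ?_
      rw [conv_reverse]
      refine conv_congr fun c d _ => ⟨?_, expo_reverse _ _⟩
      rw [ordSum_reverse]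
      simp [cpole]

end RegTan

section PartialFractions

variable {A : Type*} [CommRing A] [Algebra ℂ A]

/-- The span of the powers `e i ^ s` with `i ∈ W` and `1 ≤ s ≤ S`. -/
def poleSpan (e : ℤ → A) (W : Finset ℤ) (S : ℕ) : Submodule ℂ A :=
  Submodule.span ℂ {a | ∃ i ∈ W, ∃ s, 1 ≤ s ∧ s ≤ S ∧ a = e i ^ s}

lemma pow_mem_poleSpan {e : ℤ → A} {W : Finset ℤ} {i : ℤ} {s S : ℕ} (hi : i ∈ W) (hs : 1 ≤ s)
    (hS : s ≤ S) : e i ^ s ∈ poleSpan e W S :=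
  Submodule.subset_span ⟨i, hi, s, hs, hS, rfl⟩

lemma poleSpan_mono (e : ℤ → A) (W : Finset ℤ) : Monotone (poleSpan e W) := fun _ _ h =>
  Submodule.span_mono fun _ ⟨i, hi, s, hs, hS, ha⟩ => ⟨i, hi, s, hs, hS.trans h, ha⟩

variable {e : ℤ → A} {W : Finset ℤ} {ρ : A →ₗ[ℂ] ℂ}

lemma mul_pow_mem_poleSpan (he : ∀ i j : ℤ, ((j : ℂ) - i) • (e i * e j) = e i - e j)
    (h1 : ∀ i ∈ W, ρ (e i) = 1) (h2 : ∀ i ∈ W, ∀ s, 2 ≤ s → ρ (e i ^ s) = 0)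
    {i j : ℤ} (hi : i ∈ W) (hj : j ∈ W) {s : ℕ} (hs : 1 ≤ s) :
    e i * e j ^ s ∈ poleSpan e W (s + 1) ⊓ LinearMap.ker ρ := by
  rcases eq_or_ne i j with rfl | hij
  · rw [← pow_succ']
    exact ⟨pow_mem_poleSpan hi (by omega) le_rfl, h2 i hi _ (by omega)⟩
  have hij' : ((j : ℂ) - i) ≠ 0 := sub_ne_zero.2 (by exact_mod_cast hij.symm)
  have key : e i * e j = ((j : ℂ) - i)⁻¹ • (e i - e j) := by
    rw [← he, smul_smul, inv_mul_cancel₀ hij', one_smul]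
  induction s, hs using Nat.le_induction with
  | base =>
    rw [pow_one, key]
    refine Submodule.smul_mem _ _ ⟨Submodule.sub_mem _ ?_ ?_, ?_⟩
    · simpa using pow_mem_poleSpan (e := e) hi le_rfl (show 1 ≤ 1 + 1 by omega)
    · simpa using pow_mem_poleSpan (e := e) hj le_rfl (show 1 ≤ 1 + 1 by omega)
    · rw [SetLike.mem_coe, LinearMap.mem_ker, map_sub, h1 i hi, h1 j hj, sub_self]
  | succ s hs ih =>
    have : e i * e j ^ (s + 1) = ((j : ℂ) - i)⁻¹ • (e i * e j ^ s - e j ^ (s + 1)) := by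
      rw [pow_succ', ← mul_assoc, key, smul_mul_assoc, sub_mul]
    rw [this]
    refine Submodule.smul_mem _ _ (Submodule.sub_mem _ ?_ ⟨?_, ?_⟩)
    · exact ⟨poleSpan_mono e W (by omega) ih.1, ih.2⟩
    · exact pow_mem_poleSpan hj (by omega) (by omega)
    · exact h2 j hj _ (by omega)

lemma mul_mem_poleSpan (he : ∀ i j : ℤ, ((j : ℂ) - i) • (e i * e j) = e i - e j)
    (h1 : ∀ i ∈ W, ρ (e i) = 1) (h2 : ∀ i ∈ W, ∀ s, 2 ≤ s → ρ (e i ^ s) = 0)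
    {i : ℤ} (hi : i ∈ W) {S : ℕ} {a : A} (ha : a ∈ poleSpan e W S) :
    e i * a ∈ poleSpan e W (S + 1) ⊓ LinearMap.ker ρ := by
  unfold poleSpan at ha
  induction ha using Submodule.span_induction with
  | mem a ha =>
    obtain ⟨j, hj, s, hs, hS, rfl⟩ := ha
    have := mul_pow_mem_poleSpan he h1 h2 hi hj hs
    exact ⟨poleSpan_mono e W (by omega) this.1, this.2⟩
  | zero => rw [mul_zero]; exact Submodule.zero_mem _
  | add a b _ _ ha hb => rw [mul_add]; exact Submodule.add_mem _ ha hb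
  | smul c a _ ha => rw [mul_smul_comm]; exact Submodule.smul_mem _ _ ha

lemma pow_mul_mem_poleSpan (he : ∀ i j : ℤ, ((j : ℂ) - i) • (e i * e j) = e i - e j)
    (h1 : ∀ i ∈ W, ρ (e i) = 1) (h2 : ∀ i ∈ W, ∀ s, 2 ≤ s → ρ (e i ^ s) = 0)
    {i : ℤ} (hi : i ∈ W) {S k : ℕ} (hk : 1 ≤ k) {a : A} (ha : a ∈ poleSpan e W S) :
    e i ^ k * a ∈ poleSpan e W (k + S) ⊓ LinearMap.ker ρ := by
  induction k, hk using Nat.le_induction with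
  | base => rw [pow_one, add_comm]; exact mul_mem_poleSpan he h1 h2 hi ha
  | succ k hk ih =>
    rw [pow_succ', mul_assoc, show k + 1 + S = (k + S) + 1 by ring]
    exact mul_mem_poleSpan he h1 h2 hi ih.1

lemma ordSum_mem_poleSpan (he : ∀ i j : ℤ, ((j : ℂ) - i) • (e i * e j) = e i - e j)
    (h1 : ∀ i ∈ W, ρ (e i) = 1) (h2 : ∀ i ∈ W, ∀ s, 2 ≤ s → ρ (e i ^ s) = 0)
    {xs : List A} (hxs : ∀ x ∈ xs, ∃ i ∈ W, x = e i) {w : List ℕ} (hw : ∀ i ∈ w, 0 < i)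
    (hne : w ≠ []) :
    ordSum xs w ∈ poleSpan e W w.sum ∧ (2 ≤ w.sum → ρ (ordSum xs w) = 0) := by
  induction xs generalizing w with
  | nil =>
    cases w with
    | nil => exact absurd rfl hne
    | cons k w => simp
  | cons x xs ih =>
    have ih' := fun {w} => ih (w := w) fun y hy => hxs y (by simp [hy])
    obtain ⟨i, hi, rfl⟩ := hxs x (by simp)
    cases w with
    | nil => exact absurd rfl hne
    | cons k w =>
      have hk : 1 ≤ k := hw k (by simp)
      have h := ih' hw hne
      rw [ordSum_cons, map_add]
      rcases eq_or_ne w [] with rfl | hw0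
      · rw [ordSum_nil, mul_one]
        refine ⟨Submodule.add_mem _ h.1 (pow_mem_poleSpan hi hk (by simp)), fun hs => ?_⟩
        rw [h.2 hs, h2 i hi k (by simpa using hs), add_zero]
      · have h' := pow_mul_mem_poleSpan he h1 h2 hi hk
          (ih' (w := w) (fun j hj => hw j (by simp [hj])) hw0).1
        rw [List.sum_cons] at h ⊢
        refine ⟨Submodule.add_mem _ h.1 h'.1, fun hs => ?_⟩
        rw [h.2 hs, zero_add]
        exact h'.2

lemma two_le_sum_of_not_ones {w : List ℕ} (hw : ∀ i ∈ w, 0 < i) (h : ¬ ∀ i ∈ w, i = 1) :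
    w ≠ [] ∧ 2 ≤ w.sum := by
  push Not at h
  obtain ⟨i, hi, h1⟩ := h
  refine ⟨List.ne_nil_of_mem hi, ?_⟩
  have := List.le_sum_of_mem hi
  have := hw i hi
  omega

/-- A double convolution with functions supported on words in the letter `1`. -/
lemma conv_conv_algebraMap_mem {V : Submodule ℂ A} {f g : List ℕ → ℂ} {φ : List ℕ → A}
    {k : List ℕ}
    (h : ∀ u v w, u ++ (v ++ w) = k → f u = 0 ∨ g w = 0 ∨ φ v ∈ V) :
    conv (fun v => algebraMap ℂ A (f v)) (conv φ fun v => algebraMap ℂ A (g v)) k ∈ V := by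
  rw [conv_eq_sum]
  refine Submodule.sum_mem _ fun i _ => ?_
  rw [conv_eq_sum, Finset.mul_sum]
  refine Submodule.sum_mem _ fun j _ => ?_
  have hk : k.take i ++ ((k.drop i).take j ++ (k.drop i).drop j) = k := by
    rw [List.take_append_drop, List.take_append_drop]
  rcases h _ _ _ hk with h | h | h
  · rw [h, map_zero, zero_mul]; exact V.zero_mem
  · rw [h, map_zero, mul_zero, mul_zero]; exact V.zero_mem
  · rw [mul_comm (φ _), ← mul_assoc, ← map_mul, ← Algebra.smul_def]
    exact Submodule.smul_mem _ _ h

lemma not_ones_of_append {u v w k : List ℕ} (h : u ++ (v ++ w) = k) (hk : ¬ ∀ i ∈ k, i = 1)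
    (hu : ∀ i ∈ u, i = 1) (hw : ∀ i ∈ w, i = 1) : ¬ ∀ i ∈ v, i = 1 := by
  intro hv
  refine hk fun i hi => ?_
  rw [← h, List.mem_append, List.mem_append] at hi
  rcases hi with hi | hi | hi
  exacts [hu i hi, hv i hi, hw i hi]

lemma regTan_mem_poleSpan (he : ∀ i j : ℤ, ((j : ℂ) - i) • (e i * e j) = e i - e j) {N : ℕ}
    (h1 : ∀ i ∈ Finset.Icc (-(N : ℤ)) N, ρ (e i) = 1)
    (h2 : ∀ i ∈ Finset.Icc (-(N : ℤ)) N, ∀ s, 2 ≤ s → ρ (e i ^ s) = 0)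
    (x : ℂ) {k : List ℕ} (hk : ∀ i ∈ k, 0 < i) (hne : ¬ ∀ i ∈ k, i = 1) :
    regTan e x N k ∈ poleSpan e (Finset.Icc (-(N : ℤ)) N) k.sum ⊓ LinearMap.ker ρ := by
  refine conv_conv_algebraMap_mem fun u v w h => ?_
  by_cases hu : ∀ i ∈ u, i = 1
  · by_cases hw : ∀ i ∈ w, i = 1
    · have hv := not_ones_of_append h hne hu hw
      have hv0 := (pos_of_append rfl (pos_of_append h hk).2).1
      obtain ⟨hv1, hv2⟩ := two_le_sum_of_not_ones hv0 hv
      have := ordSum_mem_poleSpan he h1 h2 (xs := window e N) (fun x hx => by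
        obtain ⟨i, hi, rfl⟩ := List.mem_map.1 hx
        rw [List.mem_range] at hi
        exact ⟨_, Finset.mem_Icc.2 ⟨by omega, by omega⟩, rfl⟩) hv0 hv1
      refine Or.inr (Or.inr ⟨poleSpan_mono _ _ ?_ this.1, this.2 hv2⟩)
      rw [← h, List.sum_append, List.sum_append]
      omega
    · exact Or.inr (Or.inl (expo_of_not hw))
  · exact Or.inl (expo_of_not hu)

end PartialFractions

section Laurent

open PowerSeries

/-- The coefficientwise algebra structure. -/
noncomputable instance laurentAlgebra : Algebra ℂ (LaurentSeries ℂ) :=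
  @HahnSeries.instAlgebra ℤ ℂ _ _ _ _ _ _ _

/-- The expansion at `0` of `(X + n)⁻¹`. -/
noncomputable def lpole (n : ℤ) : LaurentSeries ℂ :=
  (HahnSeries.ofPowerSeries ℤ ℂ (X + C (n : ℂ)))⁻¹

lemma X_add_C_ne_zero (c : ℂ) : (X + C c : ℂ⟦X⟧) ≠ 0 := fun h => by
  have := congrArg (coeff 1) h
  simp at this

lemma ofPowerSeries_ne_zero {F : ℂ⟦X⟧} (h : F ≠ 0) : HahnSeries.ofPowerSeries ℤ ℂ F ≠ 0 :=
  fun h' => h (HahnSeries.ofPowerSeries_injective (h'.trans (map_zero _).symm))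

lemma ofPowerSeries_inv {F : ℂ⟦X⟧} (h : constantCoeff F ≠ 0) :
    HahnSeries.ofPowerSeries ℤ ℂ F⁻¹ = (HahnSeries.ofPowerSeries ℤ ℂ F)⁻¹ := by
  refine eq_inv_of_mul_eq_one_left ?_
  rw [← map_mul, PowerSeries.inv_mul_cancel _ h, map_one]

lemma algebraMap_eq_ofPowerSeries_C (c : ℂ) :
    algebraMap ℂ (LaurentSeries ℂ) c = HahnSeries.ofPowerSeries ℤ ℂ (C c) := by
  rw [HahnSeries.ofPowerSeries_C]; rfl

lemma coeff_ofPowerSeries (F : ℂ⟦X⟧) (n : ℤ) :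
    (HahnSeries.ofPowerSeries ℤ ℂ F).coeff n = if n < 0 then 0 else coeff n.natAbs F :=
  PowerSeries.coeff_coe F n

lemma coeff_ofPowerSeries_neg (F : ℂ⟦X⟧) {s : ℕ} (hs : 1 ≤ s) :
    (HahnSeries.ofPowerSeries ℤ ℂ F).coeff (-(s : ℤ)) = 0 := by
  rw [coeff_ofPowerSeries, if_pos (by omega)]

lemma coeff_lpole_zero_pow_mul (F : ℂ⟦X⟧) (k s : ℕ) :
    (lpole 0 ^ k * HahnSeries.ofPowerSeries ℤ ℂ F).coeff (-(s : ℤ)) =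
      if s ≤ k then coeff (k - s) F else 0 := by
  have : lpole 0 ^ k = HahnSeries.single (-(k : ℤ)) 1 := by
    rw [lpole]
    simp [HahnSeries.inv_single, HahnSeries.single_pow]
  rw [this, HahnSeries.coeff_single_mul, one_mul, coeff_ofPowerSeries]
  split_ifs with h1 h2 h2
  · omega
  · rfl
  · congr 2; omega
  · omega

lemma coeff_lpole_pow {n : ℤ} (k s : ℕ) (hs : 1 ≤ s) :
    (lpole n ^ k).coeff (-(s : ℤ)) = if n = 0 ∧ k = s then 1 else 0 := by
  rcases eq_or_ne n 0 with rfl | hn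
  · have := coeff_lpole_zero_pow_mul 1 k s
    rw [map_one, mul_one] at this
    rw [this, PowerSeries.coeff_one]
    simp only [true_and]
    split_ifs <;> first | rfl | omega
  · rw [lpole, ← ofPowerSeries_inv (by simpa using hn), ← map_pow, coeff_ofPowerSeries_neg _ hs,
      if_neg (fun h => hn h.1)]

lemma lpole_mul (n m : ℤ) : algebraMap ℂ (LaurentSeries ℂ) ((m : ℂ) - n) * (lpole n * lpole m) =
    lpole n - lpole m := by
  have hn := ofPowerSeries_ne_zero (X_add_C_ne_zero (n : ℂ))
  have hm := ofPowerSeries_ne_zero (X_add_C_ne_zero (m : ℂ))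
  have : algebraMap ℂ (LaurentSeries ℂ) ((m : ℂ) - n) =
      HahnSeries.ofPowerSeries ℤ ℂ (X + C (m : ℂ)) -
        HahnSeries.ofPowerSeries ℤ ℂ (X + C (n : ℂ)) := by
    rw [algebraMap_eq_ofPowerSeries_C, ← map_sub]
    congr 1
    rw [map_sub]; ring
  rw [this, lpole, lpole]
  field_simp

/-- Partial fraction expansion of the truncated multitangent sums, and their residue sum. -/
lemma regTan_eq_sum_poles {z : ℂ} (hz : ∀ m : ℤ, z + m ≠ 0) (x : ℂ) (N : ℕ) {k : List ℕ}
    (hk : ∀ i ∈ k, 0 < i) (hne : ¬ ∀ i ∈ k, i = 1) :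
    regTan (cpole z) x N k = ∑ m ∈ Finset.Icc (-(N : ℤ)) N, ∑ s ∈ Finset.Icc 1 k.sum,
        (regTan (fun i => lpole (i - m)) x N k).coeff (-(s : ℤ)) * cpole z m ^ s ∧
      ∑ m ∈ Finset.Icc (-(N : ℤ)) N, (regTan (fun i => lpole (i - m)) x N k).coeff (-1) = 0 := by
  set W := Finset.Icc (-(N : ℤ)) N
  let e : ℤ → ℂ × (ℤ → LaurentSeries ℂ) := fun i => (cpole z i, fun m => lpole (i - m))
  let co : ℤ → ℕ → (ℂ × (ℤ → LaurentSeries ℂ)) →ₗ[ℂ] ℂ := fun m s =>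
    { toFun := fun q => (q.2 m).coeff (-(s : ℤ))
      map_add' := fun _ _ => rfl
      map_smul' := fun _ _ => rfl }
  let ρ : (ℂ × (ℤ → LaurentSeries ℂ)) →ₗ[ℂ] ℂ := ∑ m ∈ W, co m 1
  let D : (ℂ × (ℤ → LaurentSeries ℂ)) →ₗ[ℂ] ℂ :=
    LinearMap.fst ℂ _ _ - ∑ m ∈ W, ∑ s ∈ Finset.Icc 1 k.sum, (cpole z m ^ s) • co m s
  have hco : ∀ m s i t, 1 ≤ s → co m s (e i ^ t) = if m = i ∧ s = t then 1 else 0 := by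
    intro m s i t hs
    change (lpole (i - m) ^ t).coeff (-(s : ℤ)) = _
    rw [coeff_lpole_pow _ _ hs]
    refine if_congr ?_ rfl rfl
    rw [sub_eq_zero, eq_comm, @eq_comm _ t]
  have hρ : ∀ i ∈ W, ∀ t, ρ (e i ^ t) = if 1 = t then 1 else 0 := by
    intro i hi t
    simp only [ρ, LinearMap.sum_apply, hco _ 1 _ _ le_rfl]
    rw [Finset.sum_eq_single_of_mem i hi fun b _ hb => if_neg fun h => hb h.1]
    simp
  have he : ∀ i j : ℤ, ((j : ℂ) - i) • (e i * e j) = e i - e j := by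
    intro i j
    refine Prod.ext ?_ (funext fun m => ?_)
    · change ((j : ℂ) - i) * ((z + i)⁻¹ * (z + j)⁻¹) = (z + i)⁻¹ - (z + j)⁻¹
      have := hz i
      have := hz j
      field_simp
      ring
    · change ((j : ℂ) - i) • (lpole (i - m) * lpole (j - m)) = _
      have := lpole_mul (i - m) (j - m)
      rw [← Algebra.smul_def,
        show (((j - m : ℤ) : ℂ) - ((i - m : ℤ) : ℂ)) = (j : ℂ) - i by push_cast; ring] at this
      exact this
  have hmem := regTan_mem_poleSpan (ρ := ρ) he (fun i hi => by simpa using hρ i hi 1)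
    (fun i hi s hs => by rw [hρ i hi s, if_neg (by omega)]) x hk hne
  have hD : poleSpan e W k.sum ≤ LinearMap.ker D := by
    refine Submodule.span_le.2 ?_
    rintro _ ⟨i, hi, t, ht, hS, rfl⟩
    have h1 : ∀ m ∈ W, ∀ s ∈ Finset.Icc 1 k.sum, ((cpole z m ^ s) • co m s) (e i ^ t) =
        if m = i ∧ s = t then cpole z m ^ s else 0 := fun m _ s hs => by
      rw [LinearMap.smul_apply, hco _ _ _ _ (Finset.mem_Icc.1 hs).1, smul_eq_mul, mul_ite, mul_one,
        mul_zero]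
    simp only [SetLike.mem_coe, LinearMap.mem_ker, D, LinearMap.sub_apply, LinearMap.sum_apply]
    rw [Finset.sum_congr rfl fun m hm => Finset.sum_congr rfl (h1 m hm),
      Finset.sum_eq_single_of_mem i hi fun b _ hb =>
        Finset.sum_eq_zero fun s _ => if_neg fun h => hb h.1,
      Finset.sum_eq_single_of_mem t (Finset.mem_Icc.2 ⟨ht, hS⟩) fun b _ hb =>
        if_neg fun h => hb h.2]
    simp [e]
  have hfst : (regTan e x N k).1 = regTan (cpole z) x N k := by
    have := map_conv (RingHom.fst ℂ (ℤ → LaurentSeries ℂ))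
      (fun v => algebraMap ℂ (ℂ × (ℤ → LaurentSeries ℂ)) (expo x v))
      (conv (ordSum (window e N)) fun v => algebraMap ℂ _ (expo (-x) v)) k
    rw [regTan, RingHom.coe_fst] at *
    rw [this, regTan]
    congr 1
    funext w
    have := map_conv (RingHom.fst ℂ (ℤ → LaurentSeries ℂ))
      (ordSum (window e N)) (fun v => algebraMap ℂ _ (expo (-x) v)) w
    rw [RingHom.coe_fst] at this
    rw [this]
    congr 1
    funext v
    have := map_ordSum (RingHom.fst ℂ (ℤ → LaurentSeries ℂ)) (window e N) v
    rw [RingHom.coe_fst] at this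
    rw [this, window, window, List.map_map]
    rfl
  have hsnd : ∀ m, (regTan e x N k).2 m = regTan (fun i => lpole (i - m)) x N k := by
    intro m
    let θ : ℂ × (ℤ → LaurentSeries ℂ) →+* LaurentSeries ℂ :=
      (Pi.evalRingHom (fun _ : ℤ => LaurentSeries ℂ) m).comp (RingHom.snd _ _)
    change θ (regTan e x N k) = _
    rw [regTan, map_conv, regTan]
    congr 1
    funext w
    rw [map_conv]
    congr 1
    funext v
    rw [map_ordSum, window, window, List.map_map]
    rfl
  constructor
  · have := hD hmem.1
    simp only [LinearMap.mem_ker, D, LinearMap.sub_apply, LinearMap.sum_apply,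
      LinearMap.fst_apply, hfst] at this
    rw [sub_eq_zero.1 this]
    refine Finset.sum_congr rfl fun m _ => Finset.sum_congr rfl fun s _ => ?_
    rw [LinearMap.smul_apply, smul_eq_mul, mul_comm, ← hsnd]
    rfl
  · have := hmem.2
    simp only [SetLike.mem_coe, LinearMap.mem_ker, ρ, LinearMap.sum_apply] at this
    rw [← this]
    refine Finset.sum_congr rfl fun m _ => ?_
    rw [← hsnd]
    rfl

end Laurent

section Residue

open PowerSeries

lemma rescale_C_eq (a c : ℂ) : rescale a (C c) = C c := by
  ext n
  rw [coeff_rescale, coeff_C]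
  split_ifs with h <;> simp [h]

/-- The expansion of the part of a multitangent sum to the left of a pole. -/
noncomputable def leftPart (g : List ℕ → ℂ) (u : List ℕ) : LaurentSeries ℂ :=
  (-1) ^ u.sum * HahnSeries.ofPowerSeries ℤ ℂ (rescale (-1) (taylor u g))

/-- The expansion of the part of a multitangent sum to the right of a pole. -/
noncomputable def rightPart (h : List ℕ → ℂ) (v : List ℕ) : LaurentSeries ℂ :=
  HahnSeries.ofPowerSeries ℤ ℂ (taylor v.reverse h)

lemma leftPart_conv (f g : List ℕ → ℂ) :
    leftPart (conv f g) = conv (leftPart f) (leftPart g) := by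
  funext u
  unfold leftPart
  rw [taylor_conv, map_conv, map_conv, conv_sign]

lemma rightPart_conv (f g : List ℕ → ℂ) :
    rightPart (conv f g) = conv (rightPart g) (rightPart f) := by
  funext u
  unfold rightPart
  rw [taylor_conv, map_conv, conv_reverse]

lemma leftPart_expo (x : ℂ) :
    leftPart (expo x) = fun v => algebraMap ℂ (LaurentSeries ℂ) (expo (-x) v) := by
  funext u
  rw [leftPart, taylor_expo, rescale_C_eq, ← algebraMap_eq_ofPowerSeries_C, ← sign_mul_expo,
    map_mul,
    map_pow, map_neg, map_one]

lemma rightPart_expo (x : ℂ) :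
    rightPart (expo x) = fun v => algebraMap ℂ (LaurentSeries ℂ) (expo x v) := by
  funext u
  rw [rightPart, taylor_expo, ← algebraMap_eq_ofPowerSeries_C, expo_reverse]

lemma leftPart_hsum (p : ℕ) :
    leftPart (hsum p) = ordSum ((desc p).map fun n : ℕ => lpole (-n)) := by
  funext u
  rw [leftPart, taylor_hsum, map_ordSum, map_ordSum, ← ordSum_neg, List.map_map, List.map_map,
    List.map_map]
  congr 1
  refine List.map_congr_left fun n hn => ?_
  have hn0 : (n : ℂ) ≠ 0 := Nat.cast_ne_zero.2 (mem_desc_pos hn).ne'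
  have h : (rescale (-1) ((X + C (n : ℂ) : ℂ⟦X⟧)⁻¹)) * (-(X + C ((-(n : ℤ) : ℤ) : ℂ))) = 1 := by
    have : (-(X + C ((-(n : ℤ) : ℤ) : ℂ)) : ℂ⟦X⟧) = rescale (-1) (X + C (n : ℂ)) := by
      rw [map_add, rescale_C_eq, rescale_X]
      simp
      ring
    rw [this, ← map_mul, PowerSeries.inv_mul_cancel _ (by simpa using hn0), map_one]
  have h' := congrArg (HahnSeries.ofPowerSeries ℤ ℂ) h
  rw [map_mul, map_one, map_neg, mul_neg, ← neg_mul] at h'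
  exact eq_inv_of_mul_eq_one_left h'

lemma rightPart_hsum (q : ℕ) :
    rightPart (hsum q) = ordSum ((desc q).map fun n : ℕ => lpole n).reverse := by
  funext v
  rw [rightPart, taylor_hsum, map_ordSum, ordSum_reverse, List.map_map]
  congr 1
  refine List.map_congr_left fun n hn => ?_
  have hn0 : (n : ℂ) ≠ 0 := Nat.cast_ne_zero.2 (mem_desc_pos hn).ne'
  simp only [Function.comp]
  rw [ofPowerSeries_inv (by simpa using hn0), lpole]
  simp

/-- The coefficient of `X ^ (-s)` in the expansion at a pole. -/
noncomputable def res (s : ℕ) (g h : List ℕ → ℂ) (k : List ℕ) : ℂ :=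
  (conv (leftPart g) (conv (letter (lpole 0)) (rightPart h)) k).coeff (-(s : ℤ))

lemma coeff_regTan (x : ℂ) {N p q : ℕ} (hpq : p + q = 2 * N) (s : ℕ) (k : List ℕ) :
    (regTan (fun i => lpole (i - (p - N))) x N k).coeff (-(s : ℤ)) =
      res s (conv (expo (-x)) (hsum p)) (conv (expo (-x)) (hsum q)) k := by
  rw [res, leftPart_conv, rightPart_conv, leftPart_expo, rightPart_expo, leftPart_hsum,
    rightPart_hsum, regTan_split _ x hpq, neg_neg]
  simp

lemma coeff_conv_algebraMap_left (f : List ℕ → ℂ) (F : List ℕ → LaurentSeries ℂ) (n : ℤ)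
    (k : List ℕ) : (conv (fun v => algebraMap ℂ (LaurentSeries ℂ) (f v)) F k).coeff n =
      conv f (fun v => (F v).coeff n) k := by
  rw [conv_eq_sum, conv_eq_sum, HahnSeries.coeff_sum]
  refine Finset.sum_congr rfl fun i _ => ?_
  rw [← Algebra.smul_def, HahnSeries.coeff_smul, smul_eq_mul]

lemma coeff_conv_algebraMap_right (f : List ℕ → ℂ) (F : List ℕ → LaurentSeries ℂ) (n : ℤ)
    (k : List ℕ) : (conv F (fun v => algebraMap ℂ (LaurentSeries ℂ) (f v)) k).coeff n =
      conv (fun v => (F v).coeff n) f k := by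
  rw [conv_eq_sum, conv_eq_sum, HahnSeries.coeff_sum]
  refine Finset.sum_congr rfl fun i _ => ?_
  rw [mul_comm, ← Algebra.smul_def, HahnSeries.coeff_smul, smul_eq_mul, mul_comm]

lemma res_conv (s : ℕ) (x y : ℂ) (g h : List ℕ → ℂ) (k : List ℕ) :
    res s (conv (expo x) g) (conv (expo y) h) k =
      conv (expo (-x)) (conv (res s g h) (expo y)) k := by
  rw [res, leftPart_conv, rightPart_conv, leftPart_expo, rightPart_expo, conv_assoc',
    coeff_conv_algebraMap_left]
  congr 1
  funext w
  rw [← conv_assoc', ← conv_assoc', coeff_conv_algebraMap_right, conv_assoc']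
  rfl

lemma res_eq (s : ℕ) (hs : 1 ≤ s) (g h : List ℕ → ℂ) (k : List ℕ) :
    res s g h k = ∑ j ∈ Finset.range k.length, if s ≤ k.getD j 0 then
      (-1) ^ (k.take j).sum * coeff (k.getD j 0 - s)
        (rescale (-1) (taylor (k.take j) g) * taylor (k.drop (j + 1)).reverse h) else 0 := by
  have hc : ∀ (n : ℕ) (F : LaurentSeries ℂ), (-1) ^ n * F = algebraMap ℂ _ ((-1) ^ n) * F :=
    fun n F => by rw [map_pow, map_neg, map_one]
  rw [res, conv_letter_conv, HahnSeries.coeff_add, HahnSeries.coeff_sum]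
  have h0 : (conv (leftPart g) (rightPart h) k).coeff (-(s : ℤ)) = 0 := by
    rw [conv_eq_sum, HahnSeries.coeff_sum]
    refine Finset.sum_eq_zero fun i _ => ?_
    rw [leftPart, rightPart, mul_assoc, ← map_mul, hc, ← Algebra.smul_def, HahnSeries.coeff_smul,
      coeff_ofPowerSeries_neg _ hs, smul_zero]
  rw [h0, zero_add]
  refine Finset.sum_congr rfl fun j _ => ?_
  rw [leftPart, rightPart, mul_assoc, mul_left_comm (HahnSeries.ofPowerSeries _ _ _), ← map_mul, hc,
    ← Algebra.smul_def, HahnSeries.coeff_smul, coeff_lpole_zero_pow_mul, smul_eq_mul,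
    mul_ite, mul_zero]

lemma res_sub_left (s : ℕ) (hs : 1 ≤ s) (g g' h : List ℕ → ℂ) (k : List ℕ) :
    res s (fun v => g v - g' v) h k = res s g h k - res s g' h k := by
  simp only [res_eq s hs, taylor_sub, map_sub, sub_mul, ← Finset.sum_sub_distrib]
  refine Finset.sum_congr rfl fun j _ => ?_
  split_ifs <;> ring

lemma res_sub_right (s : ℕ) (hs : 1 ≤ s) (g h h' : List ℕ → ℂ) (k : List ℕ) :
    res s g (fun v => h v - h' v) k = res s g h k - res s g h' k := by
  simp only [res_eq s hs, taylor_sub, map_sub, mul_sub, ← Finset.sum_sub_distrib]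
  refine Finset.sum_congr rfl fun j _ => ?_
  split_ifs <;> ring

lemma norm_res_le (n : ℕ) : ∃ K : ℝ, 0 ≤ K ∧ ∀ (s : ℕ) (g h : List ℕ → ℂ) (a b : ℝ), 1 ≤ s →
    0 ≤ a → 0 ≤ b → ∀ k : List ℕ, (∀ i ∈ k, 0 < i) → k.sum + k.length ≤ n →
    (∀ v : List ℕ, (∀ i ∈ v, 0 < i) → v.length ≤ k.length → ‖g v‖ ≤ a) →
    (∀ v : List ℕ, (∀ i ∈ v, 0 < i) → v.length ≤ k.length → ‖h v‖ ≤ b) →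
    ‖res s g h k‖ ≤ K * (a * b) := by
  refine ⟨n * ((n + 1) * (((n : ℝ) + 1) ^ n * ((n : ℝ) + 1) ^ n)), by positivity,
    fun s g h a b hs ha hb k hk hn hg hh => ?_⟩
  have hco : ∀ {φ : List ℕ → ℂ} {ε : ℝ}, 0 ≤ ε →
      (∀ v : List ℕ, (∀ i ∈ v, 0 < i) → v.length ≤ k.length → ‖φ v‖ ≤ ε) →
      ∀ (w : List ℕ) (i : ℕ), (∀ i ∈ w, 0 < i) → w.sum ≤ k.sum → w.length ≤ k.length → i ≤ n →
        ‖coeff i (taylor w φ)‖ ≤ ε * ((n : ℝ) + 1) ^ n := by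
    intro φ ε hε hφ w i hw h1 h2 hi
    refine (norm_coeff_taylor_le hε hw (fun v hv hl => hφ v hv (hl.le.trans h2)) i).trans ?_
    have : (i : ℝ) ≤ n := by exact_mod_cast hi
    refine mul_le_mul_of_nonneg_left ((pow_le_pow_left₀ (by positivity) (by linarith) _).trans
      (pow_le_pow_right₀ (by linarith [(Nat.cast_nonneg n : (0 : ℝ) ≤ n)]) (by omega))) hε
  rw [res_eq s hs]
  refine (norm_sum_le _ _).trans ((Finset.sum_le_card_nsmul _ _
    ((n + 1) * (a * ((n : ℝ) + 1) ^ n * (b * ((n : ℝ) + 1) ^ n))) fun j hj => ?_).trans ?_)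
  · have hj := Finset.mem_range.1 hj
    split_ifs with hsj
    swap
    · rw [norm_zero]; positivity
    have hjs : k.getD j 0 ≤ n := by
      rw [List.getD_eq_getElem _ _ hj]
      have := List.le_sum_of_mem (List.getElem_mem hj)
      omega
    have hsum := congrArg List.sum (List.take_append_drop j k)
    have hsum' := congrArg List.sum (List.take_append_drop (j + 1) k)
    rw [List.sum_append] at hsum hsum'
    rw [norm_mul, norm_pow, norm_neg, norm_one, one_pow, one_mul, PowerSeries.coeff_mul]
    refine (norm_sum_le _ _).trans ((Finset.sum_le_card_nsmul _ _
      (a * ((n : ℝ) + 1) ^ n * (b * ((n : ℝ) + 1) ^ n)) fun p hp => ?_).trans ?_)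
    · have hp := Finset.HasAntidiagonal.mem_antidiagonal.1 hp
      rw [norm_mul, coeff_rescale, norm_mul, norm_pow, norm_neg, norm_one, one_pow, one_mul]
      refine mul_le_mul (hco ha hg _ _ (fun i hi => hk i (List.mem_of_mem_take hi)) (by omega)
        (by simp) (by omega)) (hco hb hh _ _
          (fun i hi => hk i (List.mem_of_mem_drop (by simpa using hi)))
        (by rw [List.sum_reverse]; omega) (by simp) (by omega)) (norm_nonneg _) (by positivity)
    · rw [nsmul_eq_mul, Finset.Nat.card_antidiagonal]
      have : ((k.getD j 0 - s + 1 : ℕ) : ℝ) ≤ n + 1 := by exact_mod_cast (by omega)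
      gcongr
  · rw [nsmul_eq_mul, Finset.card_range]
    have : (k.length : ℝ) ≤ n := by exact_mod_cast (by omega)
    calc (k.length : ℝ) * ((n + 1) * (a * ((n : ℝ) + 1) ^ n * (b * ((n : ℝ) + 1) ^ n)))
        ≤ n * ((n + 1) * (a * ((n : ℝ) + 1) ^ n * (b * ((n : ℝ) + 1) ^ n))) := by gcongr
      _ = _ := by ring

end Residue

section Estimates

lemma length_add_of_append {u v w : List ℕ} (h : u ++ v = w) : u.length + v.length = w.length := by
  rw [← h, List.length_append]

lemma sum_add_of_append {u v w : List ℕ} (h : u ++ v = w) : u.sum + v.sum = w.sum := by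
  rw [← h, List.sum_append]

lemma norm_conv_le {φ ψ : List ℕ → ℂ} {w : List ℕ} {a b : ℝ} (ha : 0 ≤ a)
    (h : ∀ u v, u ++ v = w → ‖φ u‖ ≤ a ∧ ‖ψ v‖ ≤ b) :
    ‖conv φ ψ w‖ ≤ (w.length + 1) * (a * b) := by
  rw [conv_eq_sum]
  refine (norm_sum_le _ _).trans ((Finset.sum_le_card_nsmul _ _ (a * b) fun i _ => ?_).trans ?_)
  · obtain ⟨h1, h2⟩ := h _ _ (List.take_append_drop i w)
    rw [norm_mul]
    exact mul_le_mul h1 h2 (norm_nonneg _) ha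
  · simp

lemma norm_expo_le_pow {x : ℂ} {Λ : ℝ} (hx : 1 + ‖x‖ ≤ Λ) {w : List ℕ} {d : ℕ} (hw : w.length ≤ d) :
    ‖expo x w‖ ≤ Λ ^ d :=
  (norm_expo_le x w).trans ((pow_le_pow_left₀ (by positivity) hx _).trans
    (pow_le_pow_right₀ (by linarith [norm_nonneg x]) hw))

lemma norm_expo_sub_eps_le {x : ℂ} {Λ : ℝ} (hx : 1 + ‖x‖ ≤ Λ) {w : List ℕ} {d : ℕ}
    (hw : w.length ≤ d) : ‖expo x w - eps w‖ ≤ ‖x‖ * Λ ^ d := by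
  have hΛ : 1 ≤ Λ := by linarith [norm_nonneg x]
  cases w with
  | nil => simp; positivity
  | cons k w =>
    rw [eps_cons, sub_zero]
    refine (norm_expo_cons_le x k w).trans (mul_le_mul_of_nonneg_left
      ((pow_le_pow_left₀ (by positivity) hx _).trans (pow_le_pow_right₀ hΛ ?_)) (norm_nonneg _))
    exact (Nat.le_succ _).trans hw

lemma norm_expo_conv_expo_le {x y : ℂ} {Λ b : ℝ} (hx : 1 + ‖x‖ ≤ Λ) (hy : 1 + ‖y‖ ≤ Λ)
    {φ : List ℕ → ℂ} {w : List ℕ} (hb : 0 ≤ b) (h : ∀ u v t, u ++ (v ++ t) = w → ‖φ v‖ ≤ b) :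
    ‖conv (expo x) (conv φ (expo y)) w‖ ≤
      (w.length + 1) ^ 2 * (Λ ^ (2 * w.length) * b) := by
  have hΛ : 1 ≤ Λ := by linarith [norm_nonneg x]
  refine (norm_conv_le (a := Λ ^ w.length) (b := (w.length + 1) * (b * Λ ^ w.length))
    (by positivity) fun u v huv => ⟨norm_expo_le_pow hx ?_, ?_⟩).trans (le_of_eq (by ring))
  · have := length_add_of_append huv; omega
  · refine (norm_conv_le (b := Λ ^ w.length) hb fun v' t hvt =>
      ⟨h u v' t (by rw [hvt, huv]), norm_expo_le_pow hy ?_⟩).trans ?_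
    · have := length_add_of_append huv; have := length_add_of_append hvt; omega
    · have := length_add_of_append huv
      gcongr
      omega

lemma norm_expo_conv_expo_sub_le {x y : ℂ} {Λ b : ℝ} (hx : 1 + ‖x‖ ≤ Λ) (hy : 1 + ‖y‖ ≤ Λ)
    {φ : List ℕ → ℂ} {w : List ℕ} (hb : 0 ≤ b) (h : ∀ u v t, u ++ (v ++ t) = w → ‖φ v‖ ≤ b) :
    ‖conv (expo x) (conv φ (expo y)) w - φ w‖ ≤
      (w.length + 1) ^ 2 * (Λ ^ (2 * w.length) * b) * (‖x‖ + ‖y‖) := by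
  have hΛ : 1 ≤ Λ := by linarith [norm_nonneg x]
  have e1 : conv (expo x) (conv φ (expo y)) w - φ w =
      conv (fun v => expo x v - eps v) (conv φ (expo y)) w +
        conv φ (fun v => expo y v - eps v) w := by
    rw [conv_sub_right, conv_eps, ← sub_add_sub_cancel _ (conv φ (expo y) w), ← eps_conv (conv φ _)]
    congr 1
    simp [conv_eq_sum, sub_mul, Finset.sum_sub_distrib]
  have hl : (w.length : ℝ) + 1 ≤ (w.length + 1) ^ 2 := by
    have : (0 : ℝ) ≤ w.length := by positivity
    nlinarith
  have hp : Λ ^ w.length ≤ Λ ^ (2 * w.length) := pow_le_pow_right₀ hΛ (by omega)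
  rw [e1, mul_add]
  refine (norm_add_le _ _).trans (add_le_add ?_ ?_)
  · refine (norm_conv_le (a := ‖x‖ * Λ ^ w.length) (b := (w.length + 1) * (b * Λ ^ w.length))
      (by positivity) fun u v huv => ⟨norm_expo_sub_eps_le hx ?_, ?_⟩).trans (le_of_eq (by ring))
    · have := length_add_of_append huv; omega
    · refine (norm_conv_le (b := Λ ^ w.length) hb fun v' t hvt =>
        ⟨h u v' t (by rw [hvt, huv]), norm_expo_le_pow hy ?_⟩).trans ?_
      · have := length_add_of_append huv; have := length_add_of_append hvt; omega
      · have := length_add_of_append huv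
        gcongr
        omega
  · refine (norm_conv_le (b := ‖y‖ * Λ ^ w.length) hb fun u v huv =>
      ⟨h [] u v huv, norm_expo_sub_eps_le hy ?_⟩).trans ?_
    · have := length_add_of_append huv; omega
    · calc (w.length + 1) * (b * (‖y‖ * Λ ^ w.length))
          = (w.length + 1) * (Λ ^ w.length * b) * ‖y‖ := by ring
        _ ≤ _ := by gcongr

lemma rate_le_one (M : ℕ) : rate M ≤ 1 := by
  unfold rate
  refine inv_le_one_of_one_le₀ (Real.one_le_sqrt.2 ?_)
  linarith [(Nat.cast_nonneg M : (0 : ℝ) ≤ M)]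

/-- The size of the logarithmic factors. -/
noncomputable def logSize (N : ℕ) : ℝ := 2 + harm (2 * N)

lemma one_le_logSize (N : ℕ) : 1 ≤ logSize N := by
  unfold logSize; linarith [harm_nonneg (2 * N)]

lemma one_add_abs_harm_sub_le {N p : ℕ} (hp : p ≤ 2 * N) : 1 + |harm N - harm p| ≤ logSize N := by
  have h1 := harm_mono hp
  have h2 := harm_mono (show N ≤ 2 * N by omega)
  have h3 := harm_nonneg p
  have h4 := harm_nonneg N
  have : |harm N - harm p| ≤ harm (2 * N) := abs_le.2 ⟨by linarith, by linarith⟩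
  unfold logSize; linarith

lemma conv_expo_hsum (T : ℝ) (N p : ℕ) :
    conv (expo (-((harm N - T : ℝ) : ℂ))) (hsum p) =
      conv (expo ((harm p - harm N : ℝ) : ℂ)) (regHsum T p) := by
  rw [regHsum, ← conv_assoc']
  congr 1
  funext w
  rw [conv_expo_expo]
  congr 1
  push_cast
  ring

/-- The coefficient at a pole, with both tails regularized by their own harmonic number. -/
lemma coeff_regTan_eq (T : ℝ) {N p q : ℕ} (hpq : p + q = 2 * N) (s : ℕ) (k : List ℕ) :
    (regTan (fun i => lpole (i - (p - N))) ((harm N - T : ℝ) : ℂ) N k).coeff (-(s : ℤ)) =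
      conv (expo ((harm N - harm p : ℝ) : ℂ)) (conv (res s (regHsum T p) (regHsum T q))
        (expo ((harm q - harm N : ℝ) : ℂ))) k := by
  rw [coeff_regTan _ hpq, conv_expo_hsum, conv_expo_hsum, res_conv, ← Complex.ofReal_neg, neg_sub]

variable {Z : List ℕ → ℝ}

lemma exists_norm_res_regHsum_sub_le (hZ : IsStuffleReg Z) (n : ℕ) :
    ∃ K : ℝ, 0 ≤ K ∧ ∀ (s p q : ℕ) (k : List ℕ), 1 ≤ s → (∀ i ∈ k, 0 < i) →
      k.sum + k.length ≤ n →
      ‖res s (regHsum (Z [1]) p) (regHsum (Z [1]) q) k - res s (revZ Z) (revZ Z) k‖ ≤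
        K * (rate p + rate q) := by
  obtain ⟨A, hA, h1⟩ := norm_res_le n
  obtain ⟨B, hB, h2⟩ := exists_norm_regHsum_sub_le hZ n
  obtain ⟨C, hC, h3⟩ := exists_norm_le hZ n
  refine ⟨A * (B * (B + C)), by positivity, fun s p q k hs hk hn => ?_⟩
  have hp := rate_pos p
  have hq := rate_pos q
  have e : res s (regHsum (Z [1]) p) (regHsum (Z [1]) q) k - res s (revZ Z) (revZ Z) k =
      res s (fun v => regHsum (Z [1]) p v - revZ Z v) (regHsum (Z [1]) q) k +
        res s (revZ Z) (fun v => regHsum (Z [1]) q v - revZ Z v) k := by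
    rw [res_sub_left s hs, res_sub_right s hs]; ring
  have hq' : ∀ v : List ℕ, (∀ i ∈ v, 0 < i) → v.length ≤ k.length →
      ‖regHsum (Z [1]) q v‖ ≤ B + C := fun v hv hl => by
    have a1 := h2 q v hv (by omega)
    have a2 := h3 v hv (by omega)
    have a3 := mul_le_of_le_one_right hB (rate_le_one q)
    have a4 := norm_le_norm_sub_add (regHsum (Z [1]) q v) (revZ Z v)
    linarith
  rw [e]
  have b1 := h1 s (fun v => regHsum (Z [1]) p v - revZ Z v) (regHsum (Z [1]) q) (B * rate p) (B + C)
    hs (by positivity) (by positivity) k hk hn (fun v hv hl => h2 p v hv (by omega)) hq'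
  have b2 := h1 s (revZ Z) (fun v => regHsum (Z [1]) q v - revZ Z v) C (B * rate q)
    hs (by positivity) (by positivity) k hk hn (fun v hv hl => h3 v hv (by omega))
    (fun v hv hl => h2 q v hv (by omega))
  have b3 : A * (C * (B * rate q)) ≤ A * ((B + C) * (B * rate q)) := by
    gcongr; linarith
  refine (norm_add_le _ _).trans ((add_le_add b1 (b2.trans b3)).trans (le_of_eq (by ring)))

lemma exists_norm_coeff_regTan_sub_le (hZ : IsStuffleReg Z) {k : List ℕ} (hk : ∀ i ∈ k, 0 < i) :
    ∃ K : ℝ, 0 ≤ K ∧ ∀ s N p q : ℕ, 1 ≤ s → p + q = 2 * N →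
      ‖(regTan (fun i => lpole (i - (p - N))) ((harm N - Z [1] : ℝ) : ℂ) N k).coeff (-(s : ℤ)) -
        conv (expo ((harm N - harm p : ℝ) : ℂ)) (conv (res s (revZ Z) (revZ Z))
          (expo ((harm q - harm N : ℝ) : ℂ))) k‖ ≤
        K * logSize N ^ (2 * k.length) * (rate p + rate q) := by
  obtain ⟨K, hK, h⟩ := exists_norm_res_regHsum_sub_le hZ (k.sum + k.length)
  refine ⟨(k.length + 1) ^ 2 * K, by positivity, fun s N p q hs hpq => ?_⟩
  have hp := rate_pos p
  have hq := rate_pos q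
  rw [coeff_regTan_eq _ hpq, ← conv_sub_right,
    conv_congr (φ' := expo ((harm N - harm p : ℝ) : ℂ)) (ψ' := conv (fun v =>
      res s (regHsum (Z [1]) p) (regHsum (Z [1]) q) v - res s (revZ Z) (revZ Z) v)
      (expo ((harm q - harm N : ℝ) : ℂ))) fun u v _ => ⟨rfl, ?_⟩]
  · refine (norm_expo_conv_expo_le (Λ := logSize N) (b := K * (rate p + rate q)) ?_ ?_
      (by positivity) fun u v t huvt => ?_).trans (le_of_eq (by ring))
    · rw [Complex.norm_real]; exact one_add_abs_harm_sub_le (by omega)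
    · rw [Complex.norm_real, Real.norm_eq_abs, abs_sub_comm]
      exact one_add_abs_harm_sub_le (by omega)
    · have a1 := (pos_of_append huvt hk).2
      have a2 := (pos_of_append rfl a1).1
      refine h s p q v hs a2 ?_
      have := length_add_of_append huvt
      have := sum_add_of_append huvt
      simp only [List.length_append, List.sum_append] at *
      omega
  · simp [conv_eq_sum, sub_mul, Finset.sum_sub_distrib]

end Estimates

section Sums

lemma sum_Icc_eq_sum_range {M : Type*} [AddCommMonoid M] (N : ℕ) (f : ℤ → M) :
    ∑ m ∈ Finset.Icc (-(N : ℤ)) N, f m = ∑ p ∈ Finset.range (2 * N + 1), f ((p : ℤ) - N) := by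
  symm
  refine Finset.sum_nbij' (fun p : ℕ => (p : ℤ) - N) (fun m => (m + N).toNat) ?_ ?_ ?_ ?_ ?_
  · intro p hp; simp at hp ⊢; omega
  · intro m hm; simp at hm ⊢; omega
  · intro p hp; simp
  · intro m hm; simp at hm ⊢; omega
  · intro p hp; rfl

lemma sum_range_two_mul_reflect {M : Type*} [AddCommMonoid M] (N : ℕ) (f : ℕ → M) :
    ∑ p ∈ Finset.range (2 * N + 1), f (2 * N - p) = ∑ p ∈ Finset.range (2 * N + 1), f p := by
  exact Finset.sum_range_reflect f (2 * N + 1)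

lemma sum_rate_le (M : ℕ) : ∑ p ∈ Finset.range M, rate p ≤ 2 * √M := by
  induction M with
  | zero => simp
  | succ M ih =>
    rw [Finset.sum_range_succ]
    have h : rate M ≤ 2 * (√((M : ℝ) + 1) - √M) := by
      unfold rate
      have h1 : (0 : ℝ) < √((M : ℝ) + 1) := Real.sqrt_pos.2 (by positivity)
      have h2 := Real.mul_self_sqrt (show (0 : ℝ) ≤ (M : ℝ) + 1 by positivity)
      have h3 := Real.mul_self_sqrt (show (0 : ℝ) ≤ (M : ℝ) by positivity)
      rw [inv_le_iff_one_le_mul₀ h1]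
      nlinarith [sq_nonneg (√((M : ℝ) + 1) - √M)]
    push_cast
    linarith

lemma harm_eq_sum (M : ℕ) : harm M = ∑ n ∈ Finset.range M, ((n : ℝ) + 1)⁻¹ := by
  induction M with
  | zero => simp [harm_zero]
  | succ M ih => rw [harm_succ, ih, Finset.sum_range_succ]

lemma sum_inv_abs_le (N : ℕ) :
    ∑ p ∈ Finset.range (2 * N + 1), (|(p : ℝ) - N| + 1)⁻¹ ≤ 2 * logSize N := by
  rw [show 2 * N + 1 = N + (N + 1) by ring, Finset.sum_range_add]
  have h1 : ∑ p ∈ Finset.range N, (|(p : ℝ) - N| + 1)⁻¹ ≤ harm N := by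
    rw [harm_eq_sum, ← Finset.sum_range_reflect]
    refine Finset.sum_le_sum fun p hp => ?_
    have hp := Finset.mem_range.1 hp
    have e : ((N - 1 - p : ℕ) : ℝ) = N - 1 - p := by
      rw [Nat.cast_sub (by omega), Nat.cast_sub (by omega)]; simp
    rw [e, abs_of_nonpos]
    · gcongr
      linarith
    · have : (0 : ℝ) ≤ p := by positivity
      linarith
  have h2 : ∑ p ∈ Finset.range (N + 1), (|((N + p : ℕ) : ℝ) - N| + 1)⁻¹ = harm (N + 1) := by
    rw [harm_eq_sum]
    refine Finset.sum_congr rfl fun p _ => ?_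
    push_cast
    rw [add_sub_cancel_left, abs_of_nonneg (by positivity)]
  rw [h2, harm_succ]
  have h3 := harm_mono (show N ≤ 2 * N by omega)
  have h4 : ((N : ℝ) + 1)⁻¹ ≤ 1 := inv_le_one_of_one_le₀ (by
    linarith [(Nat.cast_nonneg N : (0 : ℝ) ≤ N)])
  unfold logSize
  linarith

lemma succ_mul_rate (M : ℕ) : ((M : ℝ) + 1) * rate M = √((M : ℝ) + 1) := by
  have h1 : (0 : ℝ) < √((M : ℝ) + 1) := Real.sqrt_pos.2 (by positivity)
  have h2 := Real.mul_self_sqrt (show (0 : ℝ) ≤ (M : ℝ) + 1 by positivity)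
  rw [rate, ← div_eq_mul_inv, div_eq_iff h1.ne', h2]

lemma sqrt_two_mul_add_one_le (N : ℕ) : √(2 * (N : ℝ) + 1) ≤ 2 * √((N : ℝ) + 1) := by
  rw [show (2 : ℝ) * √((N : ℝ) + 1) = √(4 * ((N : ℝ) + 1)) by
    rw [Real.sqrt_mul (by norm_num), show (4 : ℝ) = 2 ^ 2 by norm_num, Real.sqrt_sq (by norm_num)]]
  refine Real.sqrt_le_sqrt ?_
  linarith [(Nat.cast_nonneg N : (0 : ℝ) ≤ N)]

lemma sum_rate_div_le (N : ℕ) :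
    ∑ p ∈ Finset.range (2 * N + 1), rate p * (|(p : ℝ) - N| + 1)⁻¹ ≤ 8 * logSize N * rate N := by
  have hΛ := one_le_logSize N
  have hN : (0 : ℝ) < (N : ℝ) + 1 := by positivity
  refine le_of_mul_le_mul_left ?_ hN
  rw [Finset.mul_sum]
  calc ∑ p ∈ Finset.range (2 * N + 1), ((N : ℝ) + 1) * (rate p * (|(p : ℝ) - N| + 1)⁻¹)
      ≤ ∑ p ∈ Finset.range (2 * N + 1),
        (√(2 * (N : ℝ) + 1) * (|(p : ℝ) - N| + 1)⁻¹ + rate p) := by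
        refine Finset.sum_le_sum fun p hp => ?_
        have hp : (p : ℝ) ≤ 2 * N := by exact_mod_cast Nat.lt_succ_iff.1 (Finset.mem_range.1 hp)
        have h1 : 0 < |(p : ℝ) - N| + 1 := by positivity
        have h2 : (N : ℝ) + 1 ≤ (p + 1) + (|(p : ℝ) - N| + 1) := by
          linarith [neg_abs_le ((p : ℝ) - N)]
        have h3 : √((p : ℝ) + 1) ≤ √(2 * (N : ℝ) + 1) := Real.sqrt_le_sqrt (by linarith)
        have hr := rate_pos p
        calc ((N : ℝ) + 1) * (rate p * (|(p : ℝ) - N| + 1)⁻¹)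
            ≤ ((p + 1) + (|(p : ℝ) - N| + 1)) * (rate p * (|(p : ℝ) - N| + 1)⁻¹) := by gcongr
          _ = √((p : ℝ) + 1) * (|(p : ℝ) - N| + 1)⁻¹ + rate p := by
              rw [← succ_mul_rate]; field_simp
          _ ≤ _ := by gcongr
    _ ≤ √(2 * (N : ℝ) + 1) * (2 * logSize N) + 2 * √(2 * (N : ℝ) + 1) := by
        rw [Finset.sum_add_distrib, ← Finset.mul_sum]
        refine add_le_add (mul_le_mul_of_nonneg_left (sum_inv_abs_le N) (Real.sqrt_nonneg _)) ?_
        refine (sum_rate_le _).trans (le_of_eq ?_)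
        push_cast; rfl
    _ ≤ 4 * logSize N * √(2 * (N : ℝ) + 1) := by
        nlinarith [Real.sqrt_nonneg (2 * (N : ℝ) + 1)]
    _ ≤ 4 * logSize N * (2 * √((N : ℝ) + 1)) := by
        gcongr; exact sqrt_two_mul_add_one_le N
    _ = ((N : ℝ) + 1) * (8 * logSize N * rate N) := by
        rw [← succ_mul_rate]; ring

lemma tendsto_logSize_pow_mul_rate (c : ℕ) :
    Filter.Tendsto (fun N => logSize N ^ c * rate N) Filter.atTop (nhds 0) := by
  obtain ⟨C, hC, h⟩ := exists_harm_pow_le c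
  have h0 : Filter.Tendsto (fun N : ℕ => C * 2 * (2 * (N : ℝ) + 1) ^ (-(1 / 4) : ℝ)) Filter.atTop
      (nhds 0) := by
    have h1 : Filter.Tendsto (fun N : ℕ => 2 * (N : ℝ) + 1) Filter.atTop Filter.atTop :=
      Filter.tendsto_atTop_add_const_right _ _
        (tendsto_natCast_atTop_atTop.const_mul_atTop (by norm_num))
    simpa using ((tendsto_rpow_neg_atTop (show (0 : ℝ) < 1 / 4 by norm_num)).comp h1).const_mul
      (C * 2)
  refine squeeze_zero (fun N => ?_) (fun N => ?_) h0
  · have := one_le_logSize N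
    have := rate_pos N
    positivity
  · have hb : (0 : ℝ) < 2 * (N : ℝ) + 1 := by positivity
    have h2 := h (2 * N)
    push_cast at h2
    have h3 : rate N ≤ 2 * (2 * (N : ℝ) + 1) ^ (-(1 / 2) : ℝ) := by
      have h4 : 0 < √((N : ℝ) + 1) := Real.sqrt_pos.2 (by positivity)
      have h5 : 0 < √(2 * (N : ℝ) + 1) := Real.sqrt_pos.2 hb
      rw [Real.rpow_neg hb.le, ← Real.sqrt_eq_rpow, rate, ← div_eq_mul_inv, le_div_iff₀ h5,
        inv_mul_le_iff₀ h4, mul_comm (√_)]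
      exact sqrt_two_mul_add_one_le N
    calc logSize N ^ c * rate N
        ≤ (C * (2 * (N : ℝ) + 1) ^ (1 / 4 : ℝ)) * (2 * (2 * (N : ℝ) + 1) ^ (-(1 / 2) : ℝ)) := by
          refine mul_le_mul ?_ h3 (rate_pos N).le (by positivity)
          exact h2
      _ = C * 2 * ((2 * (N : ℝ) + 1) ^ (1 / 4 : ℝ) * (2 * (N : ℝ) + 1) ^ (-(1 / 2) : ℝ)) := by ring
      _ = _ := by
          rw [← Real.rpow_add hb]; norm_num

lemma harm_sub_le {a b : ℕ} (h : a ≤ b) : harm b - harm a ≤ ((b : ℝ) - a) / (a + 1) := by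
  induction b, h using Nat.le_induction with
  | base => simp
  | succ b h ih =>
    have h1 : ((b : ℝ) + 1)⁻¹ ≤ ((a : ℝ) + 1)⁻¹ := by
      have : (a : ℝ) ≤ b := by exact_mod_cast h
      gcongr
    rw [harm_succ]
    push_cast
    have : ((b : ℝ) + 1 - a) / (a + 1) = ((b : ℝ) - a) / (a + 1) + ((a : ℝ) + 1)⁻¹ := by
      field_simp; ring
    linarith

lemma abs_harm_sub_le (N p : ℕ) :
    |harm N - harm p| ≤ logSize N * |(p : ℝ) - N| / (N + 1) := by
  have hΛ := one_le_logSize N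
  have hN : (0 : ℝ) < (N : ℝ) + 1 := by positivity
  rcases le_total p N with h | h
  · have hp : (p : ℝ) ≤ N := by exact_mod_cast h
    have h1 := harm_sub_le h
    have h2 := harm_mono h
    have h3 := harm_mono (show N ≤ 2 * N by omega)
    have h4 := harm_nonneg p
    rw [abs_of_nonneg (by linarith), abs_of_nonpos (by linarith), le_div_iff₀ hN]
    rw [le_div_iff₀ (by positivity)] at h1
    unfold logSize
    nlinarith
  · have hp : (N : ℝ) ≤ p := by exact_mod_cast h
    have h1 := harm_sub_le h
    have h2 := harm_mono h
    rw [abs_of_nonpos (by linarith), abs_of_nonneg (by linarith)]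
    rw [neg_sub]
    refine h1.trans ?_
    gcongr
    nlinarith

end Sums

section Reduction

lemma conv_congr_mul {φ φ' ψ ψ' : List ℕ → ℂ} {w : List ℕ}
    (h : ∀ u v, u ++ v = w → φ u * ψ v = φ' u * ψ' v) : conv φ ψ w = conv φ' ψ' w := by
  rw [conv_eq_sum, conv_eq_sum]
  exact Finset.sum_congr rfl fun i _ => h _ _ (List.take_append_drop i w)

lemma expo_mul_of_ne_nil {x : ℂ} {t : List ℕ} (ht : t ≠ []) {a : ℂ} (h : (∀ i ∈ t, i = 1) → a = 0) :
    expo x t * a = eps t * a := by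
  obtain ⟨i, t, rfl⟩ := List.exists_cons_of_ne_nil ht
  by_cases h1 : ∀ j ∈ i :: t, j = 1
  · rw [h h1, mul_zero, mul_zero]
  · rw [expo_of_not h1, eps_cons]

/-- Words of ones cannot be split off a word when all shorter words that are not made of ones
contribute zero. -/
lemma conv_expo_right_of_vanish {φ : List ℕ → ℂ} {n : ℕ}
    (hφ : ∀ v : List ℕ, v.length < n → (∀ i ∈ v, 0 < i) → (¬ ∀ i ∈ v, i = 1) → φ v = 0)
    {w : List ℕ} (hw : ∀ i ∈ w, 0 < i) (hne : ¬ ∀ i ∈ w, i = 1) (hn : w.length ≤ n) (y : ℂ) :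
    conv φ (expo y) w = φ w := by
  rw [← conv_eps φ w]
  refine conv_congr_mul fun u t hut => ?_
  by_cases ht : t = []
  · simp [ht]
  rw [mul_comm, mul_comm (φ u)]
  refine expo_mul_of_ne_nil ht fun h1 => hφ u ?_ (pos_of_append hut hw).1 ?_
  · have := length_add_of_append hut
    have := List.length_pos_iff.2 ht
    omega
  · exact not_ones_of_append (u := []) hut hne (by simp) h1

lemma conv_expo_conv_expo_of_vanish {φ : List ℕ → ℂ} {w : List ℕ}
    (hφ : ∀ v : List ℕ, v.length < w.length → (∀ i ∈ v, 0 < i) → (¬ ∀ i ∈ v, i = 1) → φ v = 0)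
    (hw : ∀ i ∈ w, 0 < i) (hne : ¬ ∀ i ∈ w, i = 1) (x y : ℂ) :
    conv (expo x) (conv φ (expo y)) w = φ w := by
  rw [← conv_expo_right_of_vanish hφ hw hne le_rfl y, ← eps_conv (conv φ _)]
  refine conv_congr_mul fun u v huv => ?_
  by_cases hu : u = []
  · simp [hu]
  refine expo_mul_of_ne_nil hu fun h1 => ?_
  have hl := length_add_of_append huv
  have := List.length_pos_iff.2 hu
  have hv := (pos_of_append huv hw).2
  have hv1 : ¬ ∀ i ∈ v, i = 1 :=
    not_ones_of_append (w := []) (by simpa using huv) hne h1 (by simp)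
  rw [conv_expo_right_of_vanish hφ hv hv1 (by omega), hφ v (by omega) hv hv1]

lemma cast_eq_sub {N p q : ℕ} (h : p + q = 2 * N) : |(q : ℝ) - N| = |(p : ℝ) - N| := by
  have : (p : ℝ) + q = 2 * N := by exact_mod_cast h
  rw [← abs_neg]
  congr 1
  linarith

variable {Z : List ℕ → ℝ}

lemma res_one_eq_zero (hZ : IsStuffleReg Z) {k : List ℕ} (hk : ∀ i ∈ k, 0 < i)
    (hne : ¬ ∀ i ∈ k, i = 1) : res 1 (revZ Z) (revZ Z) k = 0 := by
  induction hn : k.length using Nat.strong_induction_on generalizing k with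
  | _ n ih =>
    obtain ⟨K, hK, h⟩ := exists_norm_coeff_regTan_sub_le hZ hk
    set R := res 1 (revZ Z) (revZ Z) k
    have key : ∀ N, ‖R‖ ≤ 8 * K * (logSize N ^ (2 * k.length) * rate N) := fun N => by
      have hz : ∀ m : ℤ, Complex.I + m ≠ 0 := fun m hm => by simpa using congrArg Complex.im hm
      have h0 := (regTan_eq_sum_poles hz ((harm N - Z [1] : ℝ) : ℂ) N hk hne).2
      rw [sum_Icc_eq_sum_range] at h0
      have e1 : ∀ p ∈ Finset.range (2 * N + 1), ‖(regTan (fun i => lpole (i - ((p : ℤ) - N)))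
          ((harm N - Z [1] : ℝ) : ℂ) N k).coeff (-1) - R‖ ≤
          K * logSize N ^ (2 * k.length) * (rate p + rate (2 * N - p)) := fun p hp => by
        have hp := Finset.mem_range.1 hp
        have := h 1 N p (2 * N - p) le_rfl (by omega)
        rw [conv_expo_conv_expo_of_vanish (fun v hv hv0 hv1 => ih _ (hn ▸ hv) hv0 hv1 rfl) hk hne]
          at this
        exact this
      have hN : (0 : ℝ) < (N : ℝ) + 1 := by positivity
      have hΛ := one_le_logSize N
      refine le_of_mul_le_mul_left ?_ hN
      calc ((N : ℝ) + 1) * ‖R‖ ≤ (2 * N + 1) * ‖R‖ := by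
            gcongr; linarith [(Nat.cast_nonneg N : (0 : ℝ) ≤ N)]
        _ = ‖∑ p ∈ Finset.range (2 * N + 1), ((regTan (fun i => lpole (i - ((p : ℤ) - N)))
              ((harm N - Z [1] : ℝ) : ℂ) N k).coeff (-1) - R)‖ := by
            rw [Finset.sum_sub_distrib, h0, zero_sub, norm_neg, Finset.sum_const, Finset.card_range,
              nsmul_eq_mul, norm_mul, Complex.norm_natCast]
            push_cast; rfl
        _ ≤ ∑ p ∈ Finset.range (2 * N + 1),
              K * logSize N ^ (2 * k.length) * (rate p + rate (2 * N - p)) :=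
            (norm_sum_le _ _).trans (Finset.sum_le_sum e1)
        _ = K * logSize N ^ (2 * k.length) * (2 * ∑ p ∈ Finset.range (2 * N + 1), rate p) := by
            rw [← Finset.mul_sum, Finset.sum_add_distrib, sum_range_two_mul_reflect N rate,
              ← two_mul]
        _ ≤ K * logSize N ^ (2 * k.length) * (2 * (2 * (2 * √((N : ℝ) + 1)))) := by
            have := sum_rate_le (2 * N + 1)
            push_cast at this
            have h2 := sqrt_two_mul_add_one_le N
            gcongr
            linarith
        _ = ((N : ℝ) + 1) * (8 * K * (logSize N ^ (2 * k.length) * rate N)) := by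
            rw [← succ_mul_rate]; ring
    have hlim := (tendsto_logSize_pow_mul_rate (2 * k.length)).const_mul (8 * K)
    rw [mul_zero] at hlim
    exact norm_le_zero_iff.1 (ge_of_tendsto' hlim key)

lemma exists_norm_cpole_le {z : ℂ} (hz0 : z ≠ 0) (hz1 : ‖z‖ < 1) :
    ∃ c : ℝ, 1 ≤ c ∧ ∀ m : ℤ, ‖cpole z m‖ ≤ c / (|(m : ℝ)| + 1) := by
  have h0 : 0 < ‖z‖ := norm_pos_iff.2 hz0
  have h1 : 0 < 1 - ‖z‖ := by linarith
  have h2 : 1 ≤ ‖z‖⁻¹ := (one_le_inv₀ h0).2 hz1.le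
  have h3 : 0 < 2 / (1 - ‖z‖) := by positivity
  refine ⟨2 / (1 - ‖z‖) + ‖z‖⁻¹, by linarith, fun m => ?_⟩
  have hm0 : 0 < |(m : ℝ)| + 1 := by positivity
  rw [cpole, norm_inv, le_div_iff₀ hm0]
  by_cases hm : m = 0
  · simp [hm]; linarith
  have hm1 : (1 : ℝ) ≤ |(m : ℝ)| := by exact_mod_cast Int.one_le_abs hm
  have h4 : |(m : ℝ)| - ‖z‖ ≤ ‖z + m‖ := by
    have := norm_sub_norm_le (m : ℂ) (-z)
    rw [sub_neg_eq_add, norm_neg, Complex.norm_intCast, add_comm] at this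
    exact this
  have h5 : (|(m : ℝ)| + 1) * ((1 - ‖z‖) / 2) ≤ ‖z + m‖ := by nlinarith
  have h6 : 0 < ‖z + m‖ := lt_of_lt_of_le (by positivity) h5
  calc ‖z + m‖⁻¹ * (|(m : ℝ)| + 1) ≤ 2 / (1 - ‖z‖) := by
        rw [inv_mul_le_iff₀ h6, mul_div_assoc', le_div_iff₀ h1]
        linarith
    _ ≤ _ := by linarith

lemma inv_succ_le (N p : ℕ) (hp : p ≤ 2 * N) : ((N : ℝ) + 1)⁻¹ ≤ 2 * rate p := by
  have hp : (p : ℝ) ≤ 2 * N := by exact_mod_cast hp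
  have h0 : (0 : ℝ) < (p : ℝ) + 1 := by positivity
  have h1 : √((p : ℝ) + 1) ≤ (p : ℝ) + 1 := Real.sqrt_le_iff.2 ⟨h0.le, by
    nlinarith [(Nat.cast_nonneg p : (0 : ℝ) ≤ p)]⟩
  have h2 : 0 < √((p : ℝ) + 1) := Real.sqrt_pos.2 h0
  rw [rate, ← div_eq_mul_inv, inv_eq_one_div, div_le_div_iff₀ (by positivity) h2]
  linarith

lemma exists_norm_coeff_regTan_mul_le (hZ : IsStuffleReg Z) {k : List ℕ} (hk : ∀ i ∈ k, 0 < i)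
    (hne : ¬ ∀ i ∈ k, i = 1) {z : ℂ} (hz0 : z ≠ 0) (hz1 : ‖z‖ < 1) :
    ∃ K : ℝ, 0 ≤ K ∧ ∀ N p s : ℕ, p ≤ 2 * N → s ∈ Finset.Icc 1 k.sum →
      ‖((regTan (fun i => lpole (i - ((p : ℤ) - N))) ((harm N - Z [1] : ℝ) : ℂ) N k).coeff
        (-(s : ℤ)) - res s (revZ Z) (revZ Z) k) * cpole z ((p : ℤ) - N) ^ s‖ ≤
      K * logSize N ^ (2 * k.length + 1) *
        ((rate p + rate (2 * N - p)) * (|(p : ℝ) - N| + 1)⁻¹) := by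
  obtain ⟨c, hc, hcp⟩ := exists_norm_cpole_le hz0 hz1
  obtain ⟨K, hK, h⟩ := exists_norm_coeff_regTan_sub_le hZ hk
  obtain ⟨A, hA, hA'⟩ := norm_res_le (k.sum + k.length)
  obtain ⟨B, hB, hB'⟩ := exists_norm_le hZ k.length
  have hR : ∀ s : ℕ, 1 ≤ s → ∀ u v t : List ℕ, u ++ (v ++ t) = k →
      ‖res s (revZ Z) (revZ Z) v‖ ≤ A * (B * B) := by
    intro s hs u v t huvt
    have a1 := (pos_of_append huvt hk).2
    have a2 := (pos_of_append rfl a1).1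
    have a3 := length_add_of_append huvt
    have a4 := sum_add_of_append huvt
    simp only [List.length_append, List.sum_append] at a3 a4
    exact hA' s _ _ B B hs hB hB v a2 (by omega) (fun w hw hl => hB' w hw (by omega))
      (fun w hw hl => hB' w hw (by omega))
  refine ⟨(K + 4 * ((k.length + 1) ^ 2 * (A * (B * B)))) * c ^ k.sum, by positivity,
    fun N p s hp hs => ?_⟩
  obtain ⟨hs1, hs2⟩ := Finset.mem_Icc.1 hs
  have hpq : p + (2 * N - p) = 2 * N := by omega
  have hΛ := one_le_logSize N
  have hp0 := rate_pos p
  have hq0 := rate_pos (2 * N - p)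
  set n := |(p : ℝ) - N| with hn
  have hn0 : 0 ≤ n := abs_nonneg _
  have hpole : ∀ r, r ≤ s → 0 < r → ‖cpole z ((p : ℤ) - N) ^ s‖ ≤ c ^ k.sum * ((n + 1)⁻¹) ^ r := by
    intro r hr hr0
    rw [norm_pow]
    have h1 := hcp ((p : ℤ) - N)
    push_cast at h1
    have h2 : (n + 1)⁻¹ ≤ 1 := inv_le_one_of_one_le₀ (by linarith)
    have h3 : (0 : ℝ) ≤ (n + 1)⁻¹ := by positivity
    calc ‖cpole z ((p : ℤ) - N)‖ ^ s ≤ (c * (n + 1)⁻¹) ^ s := by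
          gcongr; rw [← div_eq_mul_inv]; exact h1
      _ = c ^ s * ((n + 1)⁻¹) ^ s := mul_pow _ _ _
      _ ≤ _ := mul_le_mul (pow_le_pow_right₀ hc hs2) (pow_le_pow_of_le_one h3 h2 hr) (by positivity)
        (by positivity)
  have hmain := h s N p (2 * N - p) hs1 hpq
  have hpow : logSize N ^ (2 * k.length) ≤ logSize N ^ (2 * k.length + 1) :=
    pow_le_pow_right₀ hΛ (by omega)
  set a := (regTan (fun i => lpole (i - ((p : ℤ) - N))) ((harm N - Z [1] : ℝ) : ℂ) N k).coeff
    (-(s : ℤ))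
  rw [norm_mul]
  rcases hs1.eq_or_lt with rfl | hs3
  · rw [res_one_eq_zero hZ hk hne, sub_zero]
    rw [conv_expo_conv_expo_of_vanish (fun v _ hv0 hv1 => res_one_eq_zero hZ hv0 hv1) hk hne,
      res_one_eq_zero hZ hk hne, sub_zero] at hmain
    calc ‖a‖ * ‖cpole z ((p : ℤ) - N) ^ 1‖
        ≤ (K * logSize N ^ (2 * k.length + 1) * (rate p + rate (2 * N - p))) *
          (c ^ k.sum * ((n + 1)⁻¹) ^ 1) :=
          mul_le_mul (hmain.trans (by gcongr)) (hpole 1 le_rfl one_pos) (norm_nonneg _)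
            (by positivity)
      _ = (K * c ^ k.sum) * logSize N ^ (2 * k.length + 1) *
          ((rate p + rate (2 * N - p)) * (n + 1)⁻¹) := by ring
      _ ≤ _ := by
          gcongr
          linarith [show 0 ≤ 4 * (((k.length : ℝ) + 1) ^ 2 * (A * (B * B))) by positivity]
  · have hsub := norm_expo_conv_expo_sub_le (x := ((harm N - harm p : ℝ) : ℂ))
      (y := ((harm (2 * N - p) - harm N : ℝ) : ℂ)) (Λ := logSize N) (b := A * (B * B))
      (by rw [Complex.norm_real]; exact one_add_abs_harm_sub_le hp)
      (by rw [Complex.norm_real, Real.norm_eq_abs, abs_sub_comm]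
          exact one_add_abs_harm_sub_le (by omega)) (by positivity) (hR s hs1)
    have hx : ‖((harm N - harm p : ℝ) : ℂ)‖ + ‖((harm (2 * N - p) - harm N : ℝ) : ℂ)‖ ≤
        2 * (logSize N * n / (N + 1)) := by
      rw [Complex.norm_real, Complex.norm_real, Real.norm_eq_abs, Real.norm_eq_abs,
        abs_sub_comm (harm (2 * N - p)), two_mul (_ / _)]
      refine add_le_add (abs_harm_sub_le N p) ?_
      rw [hn, ← cast_eq_sub hpq]
      exact abs_harm_sub_le N _
    have hn1 : n * (n + 1)⁻¹ ≤ 1 := by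
      rw [← div_eq_mul_inv]; exact div_le_one_of_le₀ (by linarith) (by linarith)
    have hn2 : (n + 1)⁻¹ ≤ 1 := inv_le_one_of_one_le₀ (by linarith)
    have hN := inv_succ_le N p hp
    set D := ((k.length : ℝ) + 1) ^ 2 * (A * (B * B)) with hD
    have hD0 : 0 ≤ D := by positivity
    have hdiff : ‖a - res s (revZ Z) (revZ Z) k‖ ≤
        logSize N ^ (2 * k.length + 1) * (K * (rate p + rate (2 * N - p)) +
          4 * D * (rate p * n)) := by
      refine (norm_sub_le_norm_sub_add_norm_sub _ _ _).trans ((add_le_add hmain hsub).trans ?_)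
      rw [mul_add (logSize N ^ _)]
      refine add_le_add ?_ ?_
      · calc _ ≤ K * logSize N ^ (2 * k.length + 1) * (rate p + rate (2 * N - p)) := by gcongr
          _ = _ := by ring
      · calc (k.length + 1) ^ 2 * (logSize N ^ (2 * k.length) * (A * (B * B))) *
              (‖((harm N - harm p : ℝ) : ℂ)‖ + ‖((harm (2 * N - p) - harm N : ℝ) : ℂ)‖)
            ≤ (k.length + 1) ^ 2 * (logSize N ^ (2 * k.length) * (A * (B * B))) *
              (2 * (logSize N * n / (N + 1))) := by gcongr
          _ = logSize N ^ (2 * k.length + 1) * (2 * D * n * ((N : ℝ) + 1)⁻¹) := by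
              rw [hD]; ring
          _ ≤ logSize N ^ (2 * k.length + 1) * (2 * D * n * (2 * rate p)) := by gcongr
          _ = _ := by ring
    calc ‖a - res s (revZ Z) (revZ Z) k‖ * ‖cpole z ((p : ℤ) - N) ^ s‖
        ≤ (logSize N ^ (2 * k.length + 1) * (K * (rate p + rate (2 * N - p)) +
          4 * D * (rate p * n))) * (c ^ k.sum * ((n + 1)⁻¹) ^ 2) :=
          mul_le_mul hdiff (hpole 2 hs3 two_pos) (norm_nonneg _) (by positivity)
      _ = c ^ k.sum * logSize N ^ (2 * k.length + 1) * (n + 1)⁻¹ *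
          (K * (rate p + rate (2 * N - p)) * (n + 1)⁻¹ + 4 * D * rate p * (n * (n + 1)⁻¹)) := by
          ring
      _ ≤ c ^ k.sum * logSize N ^ (2 * k.length + 1) * (n + 1)⁻¹ *
          (K * (rate p + rate (2 * N - p)) * 1 + 4 * D * (rate p + rate (2 * N - p)) * 1) := by
          gcongr
          linarith
      _ = _ := by ring

lemma ordSum_singleton_word {R : Type*} [CommRing R] (xs : List R) (s : ℕ) :
    ordSum xs [s] = (xs.map (· ^ s)).sum := by
  induction xs with
  | nil => simp [ordSum_nil_left]
  | cons x xs ih =>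
    rw [ordSum_cons_left, conv_cons, conv_nil, ih, letter_nil, letter_singleton, ordSum_nil]
    simp [add_comm]

lemma regTan_cpole_singleton (z x : ℂ) (N s : ℕ) :
    regTan (cpole z) x N [s] = ∑ p ∈ Finset.range (2 * N + 1), cpole z ((p : ℤ) - N) ^ s := by
  have h : expo x [s] + expo (-x) [s] = 0 := by
    by_cases hs : s = 1 <;> simp [expo, hs]
  rw [regTan]
  simp only [conv_cons, conv_nil, Algebra.algebraMap_self, RingHom.id_apply, ordSum_nil, expo_nil,
    one_mul, mul_one, ordSum_singleton_word]
  rw [add_right_comm, add_comm (expo (-x) [s]), h, zero_add, window, List.map_map]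
  rw [Finset.sum_eq_multiset_sum]
  rfl

lemma add_intCast_ne_zero {z : ℂ} (hz0 : z ≠ 0) (hz1 : ‖z‖ < 1) (m : ℤ) : z + m ≠ 0 := by
  intro hm
  obtain rfl : z = ((-m : ℤ) : ℂ) := by push_cast; exact eq_neg_of_add_eq_zero_left hm
  rw [Complex.norm_intCast] at hz1
  have h1 : -m = 0 := Int.abs_lt_one_iff.1 (by exact_mod_cast hz1)
  exact hz0 (by rw [h1, Int.cast_zero])

lemma PsiReg_eq_sum_res (hZ : IsStuffleReg Z) {k : List ℕ} (hk : ∀ i ∈ k, 0 < i)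
    (hne : ¬ ∀ i ∈ k, i = 1) {z : ℂ} (hz0 : z ≠ 0) (hz1 : ‖z‖ < 1) :
    PsiReg Z k z = ∑ s ∈ Finset.Icc 1 k.sum, res s (revZ Z) (revZ Z) k * PsiReg Z [s] z := by
  obtain ⟨K, hK, h⟩ := exists_norm_coeff_regTan_mul_le hZ hk hne hz0 hz1
  have hz := add_intCast_ne_zero hz0 hz1
  have hlim := (tendsto_regTan hZ hz1 hk).sub (tendsto_finsetSum (Finset.Icc 1 k.sum) fun s hs =>
    (tendsto_regTan hZ hz1 (k := [s])
      (by simpa [Nat.pos_iff_ne_zero, Nat.one_le_iff_ne_zero] using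
        (Finset.mem_Icc.1 hs).1)).const_mul (res s (revZ Z) (revZ Z) k))
  refine sub_eq_zero.1 (tendsto_nhds_unique hlim ?_)
  have h0 := (tendsto_logSize_pow_mul_rate (2 * k.length + 2)).const_mul (k.sum * (K * 16))
  rw [mul_zero] at h0
  refine squeeze_zero_norm (fun N => ?_) h0
  rw [(regTan_eq_sum_poles hz _ N hk hne).1, sum_Icc_eq_sum_range, Finset.sum_comm,
    ← Finset.sum_sub_distrib]
  have hΛ := one_le_logSize N
  refine (norm_sum_le _ _).trans ((Finset.sum_le_card_nsmul _ _
    (K * 16 * (logSize N ^ (2 * k.length + 2) * rate N)) fun s hs => ?_).trans (le_of_eq ?_))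
  · rw [regTan_cpole_singleton, Finset.mul_sum, ← Finset.sum_sub_distrib]
    refine (norm_sum_le _ _).trans ((Finset.sum_le_sum (g := fun p : ℕ =>
      K * logSize N ^ (2 * k.length + 1) *
        ((rate p + rate (2 * N - p)) * (|(p : ℝ) - N| + 1)⁻¹)) fun p hp => ?_).trans ?_)
    · rw [← sub_mul]
      exact h N p s (Nat.lt_succ_iff.1 (Finset.mem_range.1 hp)) hs
    · rw [← Finset.mul_sum]
      simp only [add_mul, Finset.sum_add_distrib]
      have h1 := sum_rate_div_le N
      have h2 : ∑ p ∈ Finset.range (2 * N + 1), rate (2 * N - p) * (|(p : ℝ) - N| + 1)⁻¹ =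
          ∑ p ∈ Finset.range (2 * N + 1), rate p * (|(p : ℝ) - N| + 1)⁻¹ := by
        rw [← sum_range_two_mul_reflect N fun p => rate p * (|(p : ℝ) - N| + 1)⁻¹]
        refine Finset.sum_congr rfl fun p hp => ?_
        have := Finset.mem_range.1 hp
        rw [cast_eq_sub (show p + (2 * N - p) = 2 * N by omega)]
      rw [h2]
      calc _ ≤ K * logSize N ^ (2 * k.length + 1) *
            (8 * logSize N * rate N + 8 * logSize N * rate N) := by gcongr
        _ = _ := by ring
  · rw [Nat.card_Icc, nsmul_eq_mul, Nat.add_sub_cancel]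
    ring

lemma coeff_mul_eq_sum_zetaA {u v : List ℕ} (hu : ∀ i ∈ u, 0 < i)
    (hv : ∀ i ∈ v, 0 < i) (n : ℕ) :
    PowerSeries.coeff n (PowerSeries.rescale (-1) (taylor u (revZ Z)) *
      taylor v.reverse (revZ Z)) = ∑ a ∈ Finset.range (n + 1),
        (-1) ^ a * ((zetaA Z a u.reverse : ℝ) : ℂ) * ((zetaA Z (n - a) v : ℝ) : ℂ) := by
  have h1 : taylor u (revZ Z) = taylor u.reverse fun w => (Z w : ℂ) := by
    rw [← taylor_reverse]; rfl
  have h2 : taylor v.reverse (revZ Z) = taylor v fun w => (Z w : ℂ) := by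
    rw [← taylor_reverse]; simp [revZ]
  rw [PowerSeries.coeff_mul, h1, h2]
  erw [Finset.Nat.sum_antidiagonal_eq_sum_range_succ_mk]
  refine Finset.sum_congr rfl fun a _ => ?_
  rw [PowerSeries.coeff_rescale, zetaA_eq_coeff (by simpa using hu), zetaA_eq_coeff hv]

lemma reduction_of_not_ones (hZ : IsStuffleReg Z) {k : List ℕ} (hk : ∀ i ∈ k, 0 < i)
    (hne : ¬ ∀ i ∈ k, i = 1) {z : ℂ} (hz0 : z ≠ 0) (hz1 : ‖z‖ < 1) :
    PsiReg Z k z = ∑ j ∈ Finset.range k.length, ∑ s ∈ Finset.Icc 1 (k.getD j 0),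
        ∑ a ∈ Finset.range (k.getD j 0 - s + 1),
          (-1 : ℂ) ^ ((k.take j).sum + a) *
            ((zetaA Z a ((k.take j).reverse) : ℝ) : ℂ) *
            ((zetaA Z (k.getD j 0 - s - a) (k.drop (j + 1)) : ℝ) : ℂ) *
            PsiReg Z [s] z := by
  rw [PsiReg_eq_sum_res hZ hk hne hz0 hz1]
  have h1 : ∀ s ∈ Finset.Icc 1 k.sum, res s (revZ Z) (revZ Z) k * PsiReg Z [s] z =
      ∑ j ∈ Finset.range k.length, if s ≤ k.getD j 0 then
        ∑ a ∈ Finset.range (k.getD j 0 - s + 1),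
          (-1 : ℂ) ^ ((k.take j).sum + a) *
            ((zetaA Z a ((k.take j).reverse) : ℝ) : ℂ) *
            ((zetaA Z (k.getD j 0 - s - a) (k.drop (j + 1)) : ℝ) : ℂ) *
            PsiReg Z [s] z else 0 := by
    intro s hs
    rw [res_eq s (Finset.mem_Icc.1 hs).1, Finset.sum_mul]
    refine Finset.sum_congr rfl fun j _ => ?_
    split_ifs
    · rw [coeff_mul_eq_sum_zetaA (fun i hi => hk i (List.mem_of_mem_take hi))
        (fun i hi => hk i (List.mem_of_mem_drop hi)), Finset.mul_sum, Finset.sum_mul]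
      refine Finset.sum_congr rfl fun a _ => ?_
      rw [pow_add]; ring
    · rw [zero_mul]
  rw [Finset.sum_congr rfl h1, Finset.sum_comm]
  refine Finset.sum_congr rfl fun j hj => ?_
  rw [← Finset.sum_filter]
  refine Finset.sum_congr ?_ fun _ _ => rfl
  ext s
  have : k.getD j 0 ≤ k.sum := by
    have hj := Finset.mem_range.1 hj
    rw [List.getD_eq_getElem _ _ hj]
    exact List.le_sum_of_mem (List.getElem_mem hj)
  simp only [Finset.mem_filter, Finset.mem_Icc]
  omega

end Reduction

section Product

open Polynomial

/-- The partial products `(1 + a X) ∏ (1 + α_n X + β_n X²)`. -/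
noncomputable def quadProd {R : Type*} [CommRing R] (a : R) (α β : ℕ → R) (N : ℕ) : R[X] :=
  (1 + C a * X) * ∏ n ∈ Finset.range N, (1 + C (α n) * X + C (β n) * X ^ 2)

lemma norm_coeff_mul_le {P P' : ℂ[X]} {Q Q' : ℝ[X]} (h : ∀ d, ‖P.coeff d‖ ≤ Q.coeff d)
    (h' : ∀ d, ‖P'.coeff d‖ ≤ Q'.coeff d) (d : ℕ) : ‖(P * P').coeff d‖ ≤ (Q * Q').coeff d := by
  rw [coeff_mul, coeff_mul]
  refine (norm_sum_le _ _).trans (Finset.sum_le_sum fun i _ => ?_)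
  rw [norm_mul]
  exact mul_le_mul (h _) (h' _) (norm_nonneg _) ((norm_nonneg _).trans (h _))

lemma norm_coeff_quad_le (a b : ℂ) (d : ℕ) :
    ‖(1 + C a * X + C b * X ^ 2 : ℂ[X]).coeff d‖ ≤
      (1 + C ‖a‖ * X + C ‖b‖ * X ^ 2 : ℝ[X]).coeff d := by
  rcases d with - | - | - | d <;> simp [coeff_one, coeff_X, coeff_X_pow]

lemma norm_coeff_quadProd_le (a : ℂ) (α β : ℕ → ℂ) (N d : ℕ) :
    ‖(quadProd a α β N).coeff d‖ ≤
      (quadProd ‖a‖ (fun n => ‖α n‖) (fun n => ‖β n‖) N).coeff d := by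
  unfold quadProd
  refine norm_coeff_mul_le (fun d => by simpa using norm_coeff_quad_le a 0 d) (fun d => ?_) d
  induction N generalizing d with
  | zero => simp [coeff_one]; split_ifs <;> simp
  | succ N ih =>
    rw [Finset.prod_range_succ, Finset.prod_range_succ]
    exact norm_coeff_mul_le ih (norm_coeff_quad_le _ _) d

lemma coeff_le_eval_one {Q : ℝ[X]} (h : ∀ d, 0 ≤ Q.coeff d) (d : ℕ) : Q.coeff d ≤ Q.eval 1 := by
  rw [eval_eq_sum_range]
  simp only [one_pow, mul_one]
  by_cases hd : d ∈ Finset.range (Q.natDegree + 1)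
  · exact Finset.single_le_sum (f := fun i => Q.coeff i) (fun i _ => h i) hd
  · rw [coeff_eq_zero_of_natDegree_lt (by simpa [Nat.lt_succ_iff] using hd)]
    exact Finset.sum_nonneg fun i _ => h i

lemma exists_norm_coeff_quadProd_le (a : ℂ) {α β : ℕ → ℂ} {K : ℝ}
    (h : ∀ n : ℕ, ‖α n‖ + ‖β n‖ ≤ K * (((n + 1 : ℕ) : ℝ) ^ 2)⁻¹) :
    ∃ B : ℝ, ∀ N d, ‖(quadProd a α β N).coeff d‖ ≤ B := by
  have hs : Summable fun n : ℕ => K * (((n + 1 : ℕ) : ℝ) ^ 2)⁻¹ :=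
    (((summable_nat_add_iff 1).2 (Real.summable_nat_pow_inv.2 one_lt_two))).mul_left K
  refine ⟨(1 + ‖a‖) * Real.exp (∑' n : ℕ, K * (((n + 1 : ℕ) : ℝ) ^ 2)⁻¹), fun N d => ?_⟩
  refine (norm_coeff_quadProd_le a α β N d).trans ((coeff_le_eval_one (fun i =>
    (norm_nonneg _).trans (norm_coeff_quadProd_le a α β N i)) d).trans ?_)
  simp only [quadProd, eval_mul, eval_prod, eval_add, eval_one, eval_C, eval_X, eval_pow, mul_one,
    one_pow]
  refine mul_le_mul_of_nonneg_left ?_ (by positivity)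
  have h0 : ∀ n : ℕ, 0 ≤ K * (((n + 1 : ℕ) : ℝ) ^ 2)⁻¹ := fun n =>
    (by positivity : 0 ≤ ‖α n‖ + ‖β n‖).trans (h n)
  calc ∏ n ∈ Finset.range N, (1 + ‖α n‖ + ‖β n‖)
      ≤ ∏ n ∈ Finset.range N, Real.exp (K * (((n + 1 : ℕ) : ℝ) ^ 2)⁻¹) := by
        refine Finset.prod_le_prod (fun n _ => by positivity) fun n _ => ?_
        have := Real.add_one_le_exp (K * (((n + 1 : ℕ) : ℝ) ^ 2)⁻¹)
        linarith [h n]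
    _ = Real.exp (∑ n ∈ Finset.range N, K * (((n + 1 : ℕ) : ℝ) ^ 2)⁻¹) := (Real.exp_sum _ _).symm
    _ ≤ _ := Real.exp_le_exp.2 (hs.sum_le_tsum _ fun n _ => h0 n)

lemma tsum_coeff_mul_pow (P : ℂ[X]) (x : ℂ) : ∑' d, P.coeff d * x ^ d = P.eval x := by
  rw [eval_eq_sum_range, tsum_eq_sum]
  intro d hd
  rw [coeff_eq_zero_of_natDegree_lt (by simpa [Nat.lt_succ_iff] using hd), zero_mul]

/-- The coefficientwise limit of the partial products is the power series of their pointwise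
limit. -/
lemma hasSum_of_tendsto_quadProd {a : ℂ} {α β : ℕ → ℂ} {K : ℝ}
    (h : ∀ n : ℕ, ‖α n‖ + ‖β n‖ ≤ K * (((n + 1 : ℕ) : ℝ) ^ 2)⁻¹) {t : ℕ → ℂ}
    (ht : ∀ d, Filter.Tendsto (fun N => (quadProd a α β N).coeff d) Filter.atTop (nhds (t d)))
    {x : ℂ} (hx : ‖x‖ < 1) {F : ℂ}
    (hF : Filter.Tendsto (fun N => (quadProd a α β N).eval x) Filter.atTop (nhds F)) :
    HasSum (fun d => t d * x ^ d) F := by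
  obtain ⟨B, hB⟩ := exists_norm_coeff_quadProd_le a h
  have hsum : Summable fun d : ℕ => B * ‖x‖ ^ d :=
    (summable_geometric_of_lt_one (norm_nonneg x) hx).mul_left B
  have hlim := tendsto_tsum_of_dominated_convergence (𝓕 := Filter.atTop)
    (f := fun N d => (quadProd a α β N).coeff d * x ^ d) hsum
    (fun d => (ht d).mul_const (x ^ d)) (Filter.Eventually.of_forall fun N d => by
      rw [norm_mul, norm_pow]
      exact mul_le_mul_of_nonneg_right (hB N d) (by positivity))
  simp only [tsum_coeff_mul_pow] at hlim
  rw [tendsto_nhds_unique hF hlim]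
  refine (Summable.of_norm_bounded hsum fun d => ?_).hasSum
  rw [norm_mul, norm_pow]
  exact mul_le_mul_of_nonneg_right (le_of_tendsto' (ht d).norm fun N => hB N d) (by positivity)

end Product

section Generating

open PowerSeries

/-- The generating series of the values on the words `1^d`. -/
noncomputable def gen (φ : List ℕ → ℂ) : ℂ⟦X⟧ := mk fun d => φ (List.replicate d 1)

lemma coeff_gen (φ : List ℕ → ℂ) (d : ℕ) : coeff d (gen φ) = φ (List.replicate d 1) := coeff_mk _ _

lemma gen_conv (φ ψ : List ℕ → ℂ) : gen (conv φ ψ) = gen φ * gen ψ := by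
  ext d
  rw [coeff_gen, PowerSeries.coeff_mul, conv_eq_sum]
  erw [Finset.Nat.sum_antidiagonal_eq_sum_range_succ_mk]
  rw [List.length_replicate]
  refine Finset.sum_congr rfl fun i hi => ?_
  have hi := Finset.mem_range.1 hi
  rw [coeff_gen, coeff_gen, List.take_replicate, List.drop_replicate, min_eq_left (by omega)]

lemma gen_eps : gen eps = 1 := by
  ext d
  cases d <;> simp [coeff_gen, coeff_one, List.replicate_succ]

lemma gen_expo_mul_gen_expo_neg (x : ℂ) : gen (expo x) * gen (expo (-x)) = 1 := by
  rw [← gen_conv, ← gen_eps]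
  congr 1
  funext w
  rw [conv_expo_expo, add_neg_cancel, expo_zero]

lemma gen_letter (x : ℂ) : gen (letter x) = 1 + C x * X := by
  ext d
  rcases d with - | - | d <;> simp [coeff_gen, List.replicate_succ, coeff_one]

lemma gen_ordSum (xs : List ℂ) :
    gen (ordSum xs) = (xs.map fun x => (1 + C x * X : ℂ⟦X⟧)).prod := by
  induction xs with
  | nil => exact gen_eps
  | cons x xs ih => rw [ordSum_cons_left, gen_conv, gen_letter, ih, List.map_cons, List.prod_cons]

lemma prod_desc {M : Type*} [CommMonoid M] (f : ℕ → M) (N : ℕ) :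
    ((desc N).map f).prod = ∏ n ∈ Finset.range N, f (n + 1) := by
  induction N with
  | zero => rfl
  | succ N ih => rw [desc, List.map_cons, List.prod_cons, ih, Finset.prod_range_succ, mul_comm]

lemma gen_regTan (e : ℤ → ℂ) (x : ℂ) (N : ℕ) :
    gen (regTan e x N) = gen (ordSum (window e N)) := by
  simp only [regTan, Algebra.algebraMap_self, RingHom.id_apply]
  rw [gen_conv, gen_conv, mul_left_comm, gen_expo_mul_gen_expo_neg, mul_one]

lemma coe_quadProd (a : ℂ) (α β : ℕ → ℂ) (N : ℕ) : (quadProd a α β N : ℂ⟦X⟧) =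
    (1 + C a * X) * ∏ n ∈ Finset.range N, (1 + C (α n) * X + C (β n) * X ^ 2) := by
  have h := map_prod (Polynomial.coeToPowerSeries.ringHom (R := ℂ))
    (fun n => (1 + Polynomial.C (α n) * Polynomial.X + Polynomial.C (β n) * Polynomial.X ^ 2))
    (Finset.range N)
  simp only [Polynomial.coeToPowerSeries.ringHom_apply] at h
  rw [quadProd, Polynomial.coe_mul, h]
  simp

lemma gen_ordSum_window (e : ℤ → ℂ) (N : ℕ) : gen (ordSum (window e N)) =
    (quadProd (e 0) (fun n => e (-((n + 1 : ℕ) : ℤ)) + e (n + 1 : ℕ))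
      (fun n => e (-((n + 1 : ℕ) : ℤ)) * e (n + 1 : ℕ)) N : ℂ⟦X⟧) := by
  rw [coe_quadProd, gen_ordSum, window_split e (two_mul N).symm]
  simp only [List.map_append, List.prod_append, List.map_cons, List.prod_cons, List.map_reverse,
    List.prod_reverse, List.map_map, sub_self, zero_sub, zero_add, prod_desc, Function.comp]
  rw [mul_left_comm, ← Finset.prod_mul_distrib]
  congr 1
  refine Finset.prod_congr rfl fun n _ => ?_
  rw [map_add, map_mul]
  ring

lemma gen_sign_hsum_mul_gen_hsum (N : ℕ) :
    gen (fun w => (-1) ^ w.sum * hsum N w) * gen (hsum N) =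
      (quadProd 0 0 (fun n => -(((n + 1 : ℕ) : ℂ) ^ 2)⁻¹) N : ℂ⟦X⟧) := by
  have h : (fun w => (-1) ^ w.sum * hsum N w) =
      ordSum (((desc N).map fun n : ℕ => (n : ℂ)⁻¹).map fun x => -x) := by
    funext w
    rw [ordSum_neg, hsum]
  have h' : hsum N = ordSum ((desc N).map fun n : ℕ => (n : ℂ)⁻¹) := rfl
  rw [coe_quadProd, h, h', gen_ordSum, gen_ordSum, List.map_map, List.map_map, List.map_map,
    prod_desc, prod_desc, ← Finset.prod_mul_distrib, map_zero, zero_mul, add_zero, one_mul]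
  refine Finset.prod_congr rfl fun n _ => ?_
  simp only [Function.comp, Pi.zero_apply, map_zero, zero_mul, add_zero, map_neg, ← inv_pow,
    map_pow]
  ring

end Generating

section Ones

open Filter

lemma eq_of_hasSum_pow {p q : ℕ → ℂ} {F : ℂ → ℂ}
    (hp : ∀ x : ℂ, ‖x‖ < 1 → HasSum (fun d => p d * x ^ d) (F x))
    (hq : ∀ x : ℂ, ‖x‖ < 1 → HasSum (fun d => q d * x ^ d) (F x)) : p = q := by
  have key : ∀ r : ℕ → ℂ, (∀ x : ℂ, ‖x‖ < 1 → HasSum (fun d => r d * x ^ d) (F x)) →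
      HasFPowerSeriesAt F (FormalMultilinearSeries.ofScalars ℂ r) 0 := by
    intro r hr
    rw [hasFPowerSeriesAt_iff]
    filter_upwards [Metric.ball_mem_nhds (0 : ℂ) one_pos] with x hx
    rw [mem_ball_zero_iff] at hx
    simpa [FormalMultilinearSeries.coeff_ofScalars, mul_comm] using hr x hx
  have h := (key p hp).eq_formalMultilinearSeries (key q hq)
  funext d
  simpa [FormalMultilinearSeries.coeff_ofScalars] using congrArg (fun P => P.coeff d) h

lemma deltaVal_replicate (d : ℕ) : deltaVal (List.replicate d 1) =
    if d % 2 = 0 then (-1) ^ (d / 2) * π ^ d / (Nat.factorial d) else 0 := by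
  simp [deltaVal]

lemma hasSum_deltaVal (x : ℂ) :
    HasSum (fun d => (deltaVal (List.replicate d 1) : ℂ) * x ^ d) (Complex.cos (π * x)) := by
  rw [← add_zero (Complex.cos _)]
  refine HasSum.even_add_odd ?_ ?_
  · refine (Complex.hasSum_cos (π * x)).congr_fun fun k => ?_
    rw [deltaVal_replicate, if_pos (by omega), Nat.mul_div_cancel_left _ two_pos, mul_pow]
    push_cast
    ring
  · refine hasSum_zero.congr_fun fun k => ?_
    rw [deltaVal_replicate, if_neg (by omega), Complex.ofReal_zero, zero_mul]

/-- The partial products of Euler's product for the sine. -/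
noncomputable def eulerProd (N : ℕ) (z : ℂ) : ℂ :=
  π * z * ∏ n ∈ Finset.range N, (1 - z ^ 2 / ((n : ℂ) + 1) ^ 2)

lemma eval_quadProd_cpole {z : ℂ} (hz0 : z ≠ 0) (hz1 : ‖z‖ < 1) (N : ℕ) (x : ℂ) :
    (quadProd (cpole z 0) (fun n => cpole z (-((n + 1 : ℕ) : ℤ)) + cpole z (n + 1 : ℕ))
      (fun n => cpole z (-((n + 1 : ℕ) : ℤ)) * cpole z (n + 1 : ℕ)) N).eval x *
        eulerProd N z = eulerProd N (z + x) := by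
  have h : ∀ n : ℕ, (1 + (cpole z (-((n + 1 : ℕ) : ℤ)) + cpole z (n + 1 : ℕ)) * x +
      cpole z (-((n + 1 : ℕ) : ℤ)) * cpole z (n + 1 : ℕ) * x ^ 2) *
        (1 - z ^ 2 / ((n : ℂ) + 1) ^ 2) = 1 - (z + x) ^ 2 / ((n : ℂ) + 1) ^ 2 := by
    intro n
    have h1 := add_intCast_ne_zero hz0 hz1 (-((n + 1 : ℕ) : ℤ))
    have h2 := add_intCast_ne_zero hz0 hz1 ((n + 1 : ℕ) : ℤ)
    have h3 : (n : ℂ) + 1 ≠ 0 := Nat.cast_add_one_ne_zero n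
    simp only [cpole]
    push_cast at h1 h2 ⊢
    field_simp
    ring
  have h0 : (1 + cpole z 0 * x) * z = z + x := by
    simp only [cpole, Int.cast_zero, add_zero]
    field_simp
  simp only [quadProd, eulerProd, Polynomial.eval_mul, Polynomial.eval_prod, Polynomial.eval_add,
    Polynomial.eval_one, Polynomial.eval_C, Polynomial.eval_X, Polynomial.eval_pow]
  rw [← Finset.prod_congr rfl fun n _ => h n, Finset.prod_mul_distrib]
  linear_combination (π * (∏ n ∈ Finset.range N, (1 + (cpole z (-((n + 1 : ℕ) : ℤ)) +
    cpole z (n + 1 : ℕ)) * x + cpole z (-((n + 1 : ℕ) : ℤ)) * cpole z (n + 1 : ℕ) * x ^ 2)) *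
      ∏ n ∈ Finset.range N, (1 - z ^ 2 / ((n : ℂ) + 1) ^ 2)) * h0

lemma sin_pi_mul_ne_zero {z : ℂ} (hz0 : z ≠ 0) (hz1 : ‖z‖ < 1) : Complex.sin (π * z) ≠ 0 := by
  intro h
  obtain ⟨k, hk⟩ := Complex.sin_eq_zero_iff.1 h
  have hπ : (π : ℂ) ≠ 0 := by exact_mod_cast Real.pi_ne_zero
  refine add_intCast_ne_zero hz0 hz1 (-k) (mul_left_cancel₀ hπ ?_)
  push_cast
  linear_combination hk

lemma tendsto_eval_quadProd_cpole {z : ℂ} (hz0 : z ≠ 0) (hz1 : ‖z‖ < 1) (x : ℂ) :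
    Tendsto (fun N => (quadProd (cpole z 0)
      (fun n => cpole z (-((n + 1 : ℕ) : ℤ)) + cpole z (n + 1 : ℕ))
      (fun n => cpole z (-((n + 1 : ℕ) : ℤ)) * cpole z (n + 1 : ℕ)) N).eval x) atTop
      (nhds (Complex.sin (π * (z + x)) / Complex.sin (π * z))) := by
  have hs := sin_pi_mul_ne_zero hz0 hz1
  have hlim := (Complex.tendsto_euler_sin_prod (z + x)).div (Complex.tendsto_euler_sin_prod z) hs
  refine hlim.congr' ?_
  filter_upwards [(Complex.tendsto_euler_sin_prod z).eventually_ne hs] with N hN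
  exact (eq_div_of_mul_eq hN (eval_quadProd_cpole hz0 hz1 N x)).symm

lemma exists_norm_cpole_add_le {z : ℂ} (hz0 : z ≠ 0) (hz1 : ‖z‖ < 1) : ∃ K : ℝ, ∀ n : ℕ,
    ‖cpole z (-((n + 1 : ℕ) : ℤ)) + cpole z (n + 1 : ℕ)‖ +
      ‖cpole z (-((n + 1 : ℕ) : ℤ)) * cpole z (n + 1 : ℕ)‖ ≤ K * (((n + 1 : ℕ) : ℝ) ^ 2)⁻¹ := by
  obtain ⟨c, hc, h⟩ := exists_norm_cpole_le hz0 hz1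
  refine ⟨3 * c ^ 2, fun n => ?_⟩
  have hn : (0 : ℝ) < (n + 1 : ℕ) := by positivity
  have h1 : ‖cpole z (-((n + 1 : ℕ) : ℤ)) * cpole z (n + 1 : ℕ)‖ ≤
      c ^ 2 * (((n + 1 : ℕ) : ℝ) ^ 2)⁻¹ := by
    have key : ∀ m : ℤ, |(m : ℝ)| = (n + 1 : ℕ) → ‖cpole z m‖ ≤ c / (n + 1 : ℕ) := fun m hm =>
      (h m).trans (by rw [hm]; gcongr; linarith)
    rw [norm_mul]
    calc _ ≤ c / ((n + 1 : ℕ) : ℝ) * (c / (n + 1 : ℕ)) :=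
          mul_le_mul (key _ (by push_cast; rw [abs_neg, abs_of_pos (by exact_mod_cast hn)]))
            (key _ (by push_cast; rw [abs_of_pos (by exact_mod_cast hn)])) (norm_nonneg _)
            (by positivity)
      _ = _ := by rw [← inv_pow]; ring
  have h2 : cpole z (-((n + 1 : ℕ) : ℤ)) + cpole z (n + 1 : ℕ) =
      2 * z * (cpole z (-((n + 1 : ℕ) : ℤ)) * cpole z (n + 1 : ℕ)) := by
    have h1 := add_intCast_ne_zero hz0 hz1 (-((n + 1 : ℕ) : ℤ))
    have h2 := add_intCast_ne_zero hz0 hz1 ((n + 1 : ℕ) : ℤ)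
    simp only [cpole]
    push_cast at h1 h2 ⊢
    field_simp
    ring
  rw [h2, norm_mul, norm_mul, Complex.norm_ofNat]
  nlinarith [norm_nonneg z, norm_nonneg (cpole z (-((n + 1 : ℕ) : ℤ)) * cpole z (n + 1 : ℕ))]

variable {Z : List ℕ → ℝ}

lemma hasSum_PsiReg_ones (hZ : IsStuffleReg Z) {z : ℂ} (hz0 : z ≠ 0) (hz1 : ‖z‖ < 1) {x : ℂ}
    (hx : ‖x‖ < 1) : HasSum (fun d => PsiReg Z (List.replicate d 1) z * x ^ d)
      (Complex.sin (π * (z + x)) / Complex.sin (π * z)) := by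
  obtain ⟨K, hK⟩ := exists_norm_cpole_add_le hz0 hz1
  refine hasSum_of_tendsto_quadProd hK (fun d => ?_) hx (tendsto_eval_quadProd_cpole hz0 hz1 x)
  refine (tendsto_regTan hZ hz1 (k := List.replicate d 1) fun i hi => ?_).congr fun N => ?_
  · rw [List.eq_of_mem_replicate hi]; exact one_pos
  · rw [← coeff_gen (regTan _ _ _), gen_regTan, gen_ordSum_window, Polynomial.coeff_coe]

/-- The values at the words `1^d` of the coefficient of `Ψ_1` in the reduction. -/
noncomputable def onesRes (Z : List ℕ → ℝ) (d : ℕ) : ℂ :=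
  conv (fun u => (-1) ^ u.sum * revZ Z u) (revZ Z) (List.replicate d 1)

lemma coeff_quadProd_eq_conv_regHsum (T : ℝ) (N d : ℕ) :
    (quadProd 0 0 (fun n => -(((n + 1 : ℕ) : ℂ) ^ 2)⁻¹) N).coeff d =
      conv (fun u => (-1) ^ u.sum * regHsum T N u) (regHsum T N) (List.replicate d 1) := by
  have h : (fun u => (-1) ^ u.sum * regHsum T N u) =
      conv (expo (-((T - harm N : ℝ) : ℂ))) fun u => (-1) ^ u.sum * hsum N u := by
    funext u
    rw [regHsum, ← conv_sign]
    simp only [sign_mul_expo]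
  rw [← coeff_gen (conv _ _), gen_conv, h, regHsum, gen_conv, gen_conv, mul_mul_mul_comm,
    mul_comm (gen (expo _)), gen_expo_mul_gen_expo_neg, one_mul, gen_sign_hsum_mul_gen_hsum,
    Polynomial.coeff_coe]

lemma tendsto_coeff_quadProd (hZ : IsStuffleReg Z) (d : ℕ) :
    Tendsto (fun N => (quadProd 0 0 (fun n => -(((n + 1 : ℕ) : ℂ) ^ 2)⁻¹) N).coeff d) atTop
      (nhds (onesRes Z d)) := by
  obtain ⟨K, hK, h⟩ := exists_norm_regHsum_sub_le hZ d
  have key : ∀ w : List ℕ, (∀ i ∈ w, 0 < i) → w.length ≤ d →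
      Tendsto (fun N => regHsum (Z [1]) N w) atTop (nhds (revZ Z w)) := fun w hw hd => by
    rw [tendsto_iff_norm_sub_tendsto_zero]
    refine squeeze_zero (fun _ => norm_nonneg _) (fun N => h N w hw hd) ?_
    simpa using tendsto_rate.const_mul K
  have hpos : ∀ i ∈ List.replicate d 1, 0 < i := fun i hi => by
    rw [List.eq_of_mem_replicate hi]; exact one_pos
  simp only [coeff_quadProd_eq_conv_regHsum (Z [1])]
  refine tendsto_conv (fun u v huv => (key u ?_ ?_).const_mul _) fun u v huv => key v ?_ ?_
  · exact fun i hi => hpos i (huv ▸ List.mem_append_left _ hi)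
  · have := congrArg List.length huv; simp at this; omega
  · exact fun i hi => hpos i (huv ▸ List.mem_append_right _ hi)
  · have := congrArg List.length huv; simp at this; omega

lemma hasSum_onesRes (hZ : IsStuffleReg Z) {x : ℂ} (hx : ‖x‖ < 1) :
    HasSum (fun d => (if d = 0 then 0 else π * onesRes Z (d - 1)) * x ^ d)
      (Complex.sin (π * x)) := by
  have heval : ∀ N, π * x * (quadProd 0 0 (fun n => -(((n + 1 : ℕ) : ℂ) ^ 2)⁻¹) N).eval x =
      π * x * ∏ n ∈ Finset.range N, (1 - x ^ 2 / ((n : ℂ) + 1) ^ 2) := fun N => by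
    congr 1
    simp only [quadProd, Polynomial.eval_mul, Polynomial.eval_prod, Polynomial.eval_add,
      Polynomial.eval_one, Polynomial.eval_C, Polynomial.eval_X, Polynomial.eval_pow,
      Pi.zero_apply, zero_mul, add_zero, one_mul]
    refine Finset.prod_congr rfl fun n _ => ?_
    push_cast
    ring
  rw [← hasSum_nat_add_iff' 1]
  simp only [Finset.sum_range_one, if_true, zero_mul, sub_zero, Nat.add_sub_cancel,
    Nat.succ_ne_zero, if_false]
  by_cases hx0 : x = 0
  · simp [hx0]
  have hπ : (π : ℂ) * x ≠ 0 := mul_ne_zero (by exact_mod_cast Real.pi_ne_zero) hx0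
  have h := hasSum_of_tendsto_quadProd (a := 0) (α := 0)
    (β := fun n => -(((n + 1 : ℕ) : ℂ) ^ 2)⁻¹) (K := 1) (fun n => by simp [-Nat.cast_add])
    (tendsto_coeff_quadProd hZ) hx (F := Complex.sin (π * x) / (π * x)) ?_
  · have h' := h.mul_left (π * x)
    rw [mul_div_cancel₀ _ hπ] at h'
    exact h'.congr_fun fun d => by ring
  · refine ((Complex.tendsto_euler_sin_prod x).div_const (π * x)).congr fun N => ?_
    rw [← heval N, mul_div_cancel_left₀ _ hπ]

lemma PsiReg_ones_eq (hZ : IsStuffleReg Z) {z : ℂ} (hz0 : z ≠ 0) (hz1 : ‖z‖ < 1) (d : ℕ) :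
    PsiReg Z (List.replicate d 1) z = (deltaVal (List.replicate d 1) : ℂ) +
      Complex.cos (π * z) / Complex.sin (π * z) * if d = 0 then 0 else π * onesRes Z (d - 1) := by
  refine congrFun (eq_of_hasSum_pow (q := fun d => (deltaVal (List.replicate d 1) : ℂ) +
      Complex.cos (π * z) / Complex.sin (π * z) * if d = 0 then 0 else π * onesRes Z (d - 1))
    (fun x hx => hasSum_PsiReg_ones hZ hz0 hz1 hx) (fun x hx => ?_)) d
  have hs := sin_pi_mul_ne_zero hz0 hz1
  have h := (hasSum_deltaVal x).add ((hasSum_onesRes hZ hx).mul_left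
    (Complex.cos (π * z) / Complex.sin (π * z)))
  have h1 : Complex.cos (π * x) + Complex.cos (π * z) / Complex.sin (π * z) *
      Complex.sin (π * x) = Complex.sin (π * (z + x)) / Complex.sin (π * z) := by
    rw [mul_add, Complex.sin_add]
    field_simp
  rw [h1] at h
  exact h.congr_fun fun d => by ring

lemma onesRes_zero (hZ : IsStuffleReg Z) : onesRes Z 0 = 1 := by
  simp [onesRes, conv_nil, revZ_nil hZ]

lemma PsiReg_ones_succ (hZ : IsStuffleReg Z) {z : ℂ} (hz0 : z ≠ 0) (hz1 : ‖z‖ < 1) (d : ℕ) :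
    PsiReg Z (List.replicate (d + 1) 1) z = (deltaVal (List.replicate (d + 1) 1) : ℂ) +
      onesRes Z d * PsiReg Z [1] z := by
  have h := PsiReg_ones_eq hZ hz0 hz1 1
  rw [deltaVal_replicate] at h
  simp [onesRes_zero hZ] at h
  rw [PsiReg_ones_eq hZ hz0 hz1, h]
  simp
  ring

lemma coeff_zero_taylor (w : List ℕ) (φ : List ℕ → ℂ) :
    PowerSeries.coeff 0 (taylor w φ) = φ w := by
  induction w generalizing φ with
  | nil => simp
  | cons k w ih => simp [taylor_cons, coeff_binomSum, negBinom_zero_right, ih]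

lemma zetaA_zero {l : List ℕ} (hl : ∀ i ∈ l, 0 < i) : zetaA Z 0 l = Z l := by
  exact_mod_cast (zetaA_eq_coeff (Z := Z) hl 0).trans (coeff_zero_taylor l _)

lemma reduction_of_ones (hZ : IsStuffleReg Z) (d : ℕ) {z : ℂ} (hz0 : z ≠ 0) (hz1 : ‖z‖ < 1) :
    PsiReg Z (List.replicate d 1) z = (deltaVal (List.replicate d 1) : ℂ) +
      ∑ j ∈ Finset.range (List.replicate d 1).length,
        ∑ s ∈ Finset.Icc 1 ((List.replicate d 1).getD j 0),
          ∑ a ∈ Finset.range ((List.replicate d 1).getD j 0 - s + 1),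
            (-1 : ℂ) ^ (((List.replicate d 1).take j).sum + a) *
              ((zetaA Z a (((List.replicate d 1).take j).reverse) : ℝ) : ℂ) *
              ((zetaA Z ((List.replicate d 1).getD j 0 - s - a)
                ((List.replicate d 1).drop (j + 1)) : ℝ) : ℂ) * PsiReg Z [s] z := by
  cases d with
  | zero => simpa using PsiReg_ones_eq hZ hz0 hz1 0
  | succ d =>
    rw [PsiReg_ones_succ hZ hz0 hz1, onesRes, conv_eq_sum, Finset.sum_mul]
    simp only [List.length_replicate]
    congr 1
    refine Finset.sum_congr rfl fun j hj => ?_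
    have hj := Finset.mem_range.1 hj
    have h1 : (List.replicate (d + 1) 1).getD j 0 = 1 := by
      rw [List.getD_eq_getElem _ _ (by simpa using hj), List.getElem_replicate]
    have h2 : min j d = j := min_eq_left (by omega)
    have h3 : min j (d + 1) = j := min_eq_left (by omega)
    have hpos : ∀ n, ∀ i ∈ List.replicate n 1, 0 < i := fun n i hi => by
      rw [List.eq_of_mem_replicate hi]; exact one_pos
    rw [h1]
    simp [h2, h3, revZ, zetaA_zero (hpos _)]

end Ones

end Multitangent

/-- Bouillot's monotangent reduction: for positive integers `k₁,…,k_d`,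
`Ψ_{k₁,…,k_d}(z) = δ^{k₁,…,k_d} + ∑_{j=1}^d ∑_{a+s+b=k_j, s≥1}
(-1)^{k₁+⋯+k_{j-1}+a} ζ_a^*(k_{j-1},…,k₁) ζ_b^*(k_{j+1},…,k_d) Ψ_s(z)`
(here `j ∈ Finset.range k.length` plays the role of the paper's `j - 1`, and the
depth-one `Ψ_s` is the regularized monotangent, which for `s ≥ 2` is the classical one). -/
theorem bouillot_reduction (Z : List ℕ → ℝ) (hZ : IsStuffleReg Z)
    (k : List ℕ) (hk : ∀ i ∈ k, 0 < i)
    (z : ℂ) (hz0 : z ≠ 0) (hz1 : ‖z‖ < 1) :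
    PsiReg Z k z = ((deltaVal k : ℝ) : ℂ) +
      ∑ j ∈ Finset.range k.length, ∑ s ∈ Finset.Icc 1 (k.getD j 0),
        ∑ a ∈ Finset.range (k.getD j 0 - s + 1),
          (-1 : ℂ) ^ ((k.take j).sum + a) *
            ((zetaA Z a ((k.take j).reverse) : ℝ) : ℂ) *
            ((zetaA Z (k.getD j 0 - s - a) (k.drop (j + 1)) : ℝ) : ℂ) *
            PsiReg Z [s] z := by
  by_cases hones : ∀ i ∈ k, i = 1
  · rw [List.eq_replicate_of_mem hones]
    exact Multitangent.reduction_of_ones hZ k.length hz0 hz1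
  · have h0 : deltaVal k = 0 := if_neg fun h => hones (by simpa using h.1)
    rw [h0, Complex.ofReal_zero, zero_add]
    exact Multitangent.reduction_of_not_ones hZ hk hones hz0 hz1
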